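/- arXiv:math/0701591 — 4 statements merged into one kernel-verified Lean document; each statement's English description precedes it below -/
import Mathlib

section
/- Let u ∈ R be such that Δ(E_S) is the map R/I → R/I^{[p]} given by multiplication by u (equivalently, T acts on E_S as the restriction of uφ, where φ is the natural Frobenius on E). Then the E_S-ideals in R are exactly the ideals L ⊆ R containing I for which uL ⊆ L^{[p]}. -/
open IsLocalRing

/-- The `q`-th Frobenius power of an ideal: the ideal generated by `q`-th powers of elements. -/
def Ideal.frobPow {R : Type*} [CommSemiring R] (q : ℕ) (I : Ideal R) : Ideal R :=
  Ideal.span ((fun a => a ^ q) '' (I : Set R))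

/-- A `q`-Frobenius map on a module `M`: additive, with `ψ (r • x) = r ^ q • ψ x`. -/
structure FrobeniusMap (R : Type*) [CommSemiring R] (M : Type*) [AddCommMonoid M]
    [Module R M] (q : ℕ) where
  toFun : M → M
  map_add' : ∀ x y, toFun (x + y) = toFun x + toFun y
  map_smul' : ∀ (r : R) (x : M), toFun (r • x) = r ^ q • toFun x

/-- `E` is an injective hull of the residue field of the local ring `R`. -/
def IsInjectiveHullOfResidueField (R : Type*) [CommRing R] [IsLocalRing R]
    (E : Type*) [AddCommGroup E] [Module R E] : Prop :=
  Module.Injective R E ∧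
    ∃ ι : ResidueField R →ₗ[R] E, Function.Injective ι ∧
      ∀ N : Submodule R E, N ≠ ⊥ → ∃ x, x ≠ 0 ∧ x ∈ N ∧ x ∈ LinearMap.range ι

/-- Regularity for a Noetherian local ring: the maximal ideal is generated by
`dim R` elements. -/
def IsRegularLocal (R : Type*) [CommRing R] [IsLocalRing R] : Prop :=
  ∃ (n : ℕ) (x : Fin n → R), maximalIdeal R = Ideal.span (Set.range x) ∧
    ringKrullDim R = n

/-- `φ` is (up to normalization) the natural Frobenius on `E = E_R(R/m)`: every `e`-th
Frobenius map on `E` is uniquely of the form `u • φ^[e]`. -/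
def IsNaturalFrobenius {R : Type*} [CommRing R] (p : ℕ) (E : Type*) [AddCommGroup E]
    [Module R E] (φ : FrobeniusMap R E p) : Prop :=
  ∀ e : ℕ, 1 ≤ e → ∀ θ : FrobeniusMap R E (p ^ e),
    ∃! u : R, ∀ x : E, θ.toFun x = u • (φ.toFun)^[e] x

/-- The annihilator of an ideal `I` inside a module `E`, as a submodule of `E`. -/
def annIn {R : Type*} [CommRing R] (I : Ideal R) (E : Type*) [AddCommGroup E]
    [Module R E] : Submodule R E where
  carrier := { x | ∀ a ∈ I, a • x = 0 }
  add_mem' hx hy := fun a ha => by rw [smul_add, hx a ha, hy a ha, add_zero]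
  zero_mem' := fun a _ => smul_zero a
  smul_mem' := fun r x hx a ha => by rw [smul_comm, hx a ha, smul_zero]

/-- `ν_e = 1 + p + ⋯ + p^{e-1}`. -/
def nuExp (p e : ℕ) : ℕ := ∑ i ∈ Finset.range e, p ^ i



lemma dim_le_card {R : Type*} [CommRing R] [IsLocalRing R] [IsNoetherianRing R]
    (s : Finset R) (hm : maximalIdeal R = Ideal.span (s : Set R)) :
    ringKrullDim R ≤ (s.card : WithBot ℕ∞) := by
  refine (ringKrullDim_le_spanFinrank_maximalIdeal R).trans ?_
  rw [hm]
  have := Submodule.spanFinrank_span_le_ncard_of_finite (R := R) (s.finite_toSet)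
  rw [Set.ncard_coe_finset] at this
  exact_mod_cast this

lemma quot_local {R : Type*} [CommRing R] [IsLocalRing R]
    (A : Ideal R) (hA : A ≤ maximalIdeal R) : IsLocalRing (R ⧸ A) := by
  have : Nontrivial (R ⧸ A) := Ideal.Quotient.nontrivial_iff.mpr
    (fun h => (maximalIdeal.isMaximal R).ne_top (top_le_iff.mp (h ▸ hA)))
  exact IsLocalRing.of_surjective' (Ideal.Quotient.mk A) Ideal.Quotient.mk_surjective

open Classical in
lemma quot_max {R : Type*} [CommRing R] [IsLocalRing R]
    (A : Ideal R) (s : Finset R) (hm : maximalIdeal R = A ⊔ Ideal.span (s : Set R))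
    [IsLocalRing (R ⧸ A)] :
    maximalIdeal (R ⧸ A) = Ideal.span (s.image (Ideal.Quotient.mk A) : Set (R ⧸ A)) := by
  have h1 : (maximalIdeal R).map (Ideal.Quotient.mk A) = maximalIdeal (R ⧸ A) :=
    IsLocalRing.eq_maximalIdeal (by
      refine (Ideal.map_eq_top_or_isMaximal_of_surjective _ Ideal.Quotient.mk_surjective
        (maximalIdeal.isMaximal R)).resolve_left ?_
      intro h
      have := congrArg (Ideal.comap (Ideal.Quotient.mk A)) h
      rw [Ideal.comap_map_of_surjective _ Ideal.Quotient.mk_surjective, ← RingHom.ker_eq_comap_bot,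
        Ideal.mk_ker, Ideal.comap_top, sup_eq_left.mpr (hm ▸ le_sup_left)] at this
      exact (maximalIdeal.isMaximal R).ne_top this)
  rw [← h1, hm, Ideal.map_sup, Ideal.map_quotient_self, bot_sup_eq, Ideal.map_span]
  simp

open Classical in
lemma quot_dim {R : Type*} [CommRing R] [IsLocalRing R] [IsNoetherianRing R]
    (T s : Finset R) (hm : maximalIdeal R = Ideal.span (T : Set R) ⊔ Ideal.span (s : Set R))
    (h : ((T.card + s.card : ℕ) : WithBot ℕ∞) ≤ ringKrullDim R) :
    ((s.card : ℕ) : WithBot ℕ∞) ≤ ringKrullDim (R ⧸ Ideal.span (T : Set R)) := by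
  have h2 := ringKrullDim_le_ringKrullDim_quotient_add_card T (by
    rw [IsLocalRing.ringJacobson_eq_maximalIdeal, hm]
    exact Ideal.subset_span.trans (SetLike.coe_subset_coe.mpr le_sup_left))
  have h3 := h.trans h2
  generalize ringKrullDim (R ⧸ Ideal.span (T : Set R)) = d at h3
  induction d using WithBot.recBotCoe with
  | bot => simp at h3
  | coe d =>
    induction d using ENat.recTopCoe with
    | top => exact WithBot.coe_le_coe.mpr le_top
    | coe d => norm_cast at h3 ⊢; omega

open Classical in
lemma reg_domain (k : ℕ) : ∀ {R : Type*} [CommRing R] [IsLocalRing R] [IsNoetherianRing R]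
    (s : Finset R), s.card = k → maximalIdeal R = Ideal.span (s : Set R) →
    ((s.card : ℕ) : WithBot ℕ∞) ≤ ringKrullDim R → IsDomain R := by
  induction k with
  | zero =>
    intro R _ _ _ s hs hm _
    have : s = ∅ := Finset.card_eq_zero.mp hs
    subst this
    have := (IsLocalRing.isField_iff_maximalIdeal_eq (R := R)).mpr (by simpa using hm)
    exact this.isDomain
  | succ k ih =>
    intro R _ _ _ s hs hm hd
    obtain ⟨x, hx⟩ : s.Nonempty := Finset.card_pos.mp (by omega)
    set s' := s.erase x with hs'
    have hc' : s'.card = k := by rw [hs', Finset.card_erase_of_mem hx, hs]; rfl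
    have hins : insert x s' = s := Finset.insert_erase hx
    have hmx : maximalIdeal R = Ideal.span {x} ⊔ Ideal.span (s' : Set R) := by
      rw [hm, ← hins, Finset.coe_insert, Ideal.span_insert]
    -- primes
    have key : ∀ y : R, maximalIdeal R = Ideal.span {y} ⊔ Ideal.span (s' : Set R) →
        (Ideal.span {y}).IsPrime ∧ (k : WithBot ℕ∞) ≤ ringKrullDim (R ⧸ Ideal.span {y}) := by
      intro y hy
      have := quot_local (Ideal.span {y}) (hy ▸ le_sup_left)
      have hmax := quot_max (Ideal.span {y}) s' hy
      have hdim := quot_dim {y} s' (by simpa using hy)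
        (by rw [Finset.card_singleton, hc', add_comm, ← hs]; exact hd)
      rw [Finset.coe_singleton, hc'] at hdim
      have hle := dim_le_card _ hmax
      have hci : (s'.image (Ideal.Quotient.mk (Ideal.span {y}))).card = k := by
        apply le_antisymm (hc' ▸ Finset.card_image_le)
        exact_mod_cast hdim.trans hle
      refine ⟨?_, hdim⟩
      have := ih _ hci hmax (by rw [hci]; exact hdim)
      exact (Ideal.Quotient.isDomain_iff_prime _).mp this
    have hex : ∃ y : R, maximalIdeal R = Ideal.span {y} ⊔ Ideal.span (s' : Set R) ∧
        Ideal.span {y} ∉ minimalPrimes R := by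
      by_contra hcon
      push Not at hcon
      rcases s'.eq_empty_or_nonempty with h0 | ⟨z, hz⟩
      · have h1 := hcon x hmx
        rw [h0] at hmx
        simp only [Finset.coe_empty, Ideal.span_empty, bot_le, sup_of_le_left] at hmx
        rw [← hmx] at h1
        have := Ideal.height_eq_zero_iff.mpr h1
        have h2 := IsLocalRing.maximalIdeal_height_eq_ringKrullDim (R := R)
        rw [this] at h2
        rw [← h2, hs] at hd
        norm_cast at hd
      · have hY : ∀ j : ℕ, maximalIdeal R = Ideal.span {x + z ^ (j+1)} ⊔ Ideal.span (s' : Set R) := by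
          intro j
          have hzj : z ^ (j+1) ∈ Ideal.span (s' : Set R) :=
            Ideal.pow_mem_of_mem _ (Ideal.subset_span hz) _ (Nat.succ_pos _)
          rw [hmx]
          apply le_antisymm
          · refine sup_le ?_ le_sup_right
            rw [Ideal.span_singleton_le_iff_mem]
            have h9 := sub_mem (Ideal.mem_sup_left (Ideal.mem_span_singleton_self (x + z^(j+1))))
              (Ideal.mem_sup_right (S := Ideal.span {x + z^(j+1)}) hzj)
            rwa [add_sub_cancel_right] at h9
          · refine sup_le ?_ le_sup_right
            rw [Ideal.span_singleton_le_iff_mem]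
            exact add_mem (Ideal.mem_sup_left (Ideal.mem_span_singleton_self _))
              (Ideal.mem_sup_right hzj)
        have hni : ¬ Function.Injective (fun j : ℕ => Ideal.span {x + z ^ (j+1)}) := by
          intro hinj
          exact Set.infinite_of_injective_forall_mem hinj (fun j => hcon _ (hY j))
            (minimalPrimes.finite_of_isNoetherianRing R)
        rw [Function.Injective] at hni
        push Not at hni
        obtain ⟨i, j, hij, hne⟩ := hni
        wlog hlt : i < j generalizing i j
        · exact this j i hij.symm hne.symm (by omega)
        obtain ⟨d, rfl⟩ := Nat.exists_eq_add_of_lt hlt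
        obtain ⟨hP, hPd⟩ := key _ (hY i)
        set Q := Ideal.span {x + z ^ (i+1)} with hQ
        have hzm : z ∈ maximalIdeal R := by
          rw [hmx]; exact Ideal.mem_sup_right (Ideal.subset_span hz)
        have ha : x + z ^ (i+1) ∈ Q := Ideal.mem_span_singleton_self _
        have hb : x + z ^ (i+d+1+1) ∈ Q := by
          have h3 : Q = Ideal.span {x + z ^ (i+d+1+1)} := hij
          rw [h3]; exact Ideal.mem_span_singleton_self _
        have hz1 : z ^ (i+1) * (1 - z^(d+1)) ∈ Q := by
          have := sub_mem ha hb
          convert this using 1; ring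
        have hu : IsUnit (1 - z^(d+1)) := by
          by_contra hnu
          have h4 : 1 - z^(d+1) ∈ maximalIdeal R := (mem_maximalIdeal _).mpr hnu
          have h5 := add_mem h4 (Ideal.pow_mem_of_mem _ hzm (d+1) (Nat.succ_pos _))
          rw [sub_add_cancel] at h5
          exact (Ideal.ne_top_iff_one _).mp (maximalIdeal.isMaximal R).ne_top h5
        have hzQ : z ∈ Q := by
          have := (Ideal.mul_unit_mem_iff_mem Q hu).mp hz1
          exact hP.mem_of_pow_mem _ this
        have := quot_local Q (by rw [hY i]; exact le_sup_left)
        have hmax := quot_max Q (s'.erase z) (by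
          rw [hY i]
          apply le_antisymm
          · refine sup_le le_sup_left ?_
            rw [← Finset.insert_erase hz, Finset.coe_insert, Ideal.span_insert]
            refine sup_le ((Ideal.span_singleton_le_iff_mem _).mpr (Ideal.mem_sup_left hzQ)) ?_
            simp
          · exact sup_le_sup_left (Ideal.span_mono (by simp)) _)
        have hle := hPd.trans (dim_le_card _ hmax)
        have h6 : k ≤ ((s'.erase z).image (Ideal.Quotient.mk Q)).card := by exact_mod_cast hle
        have h7 := h6.trans Finset.card_image_le
        have h8 := Finset.card_erase_lt_of_mem hz
        omega
    obtain ⟨y, hy, hymin⟩ := hex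
    obtain ⟨hyp, -⟩ := key y hy
    obtain ⟨P, hP, hPy⟩ := Ideal.exists_minimalPrimes_le (I := (⊥ : Ideal R)) (J := Ideal.span {y}) bot_le
    have hPp : P.IsPrime := hP.1.1
    have hyP : y ∉ P := by
      intro h
      apply hymin
      have : Ideal.span {y} = P := le_antisymm ((Ideal.span_singleton_le_iff_mem _).mpr h) hPy
      rw [this]; exact hP
    have hle : P ≤ maximalIdeal R • P := by
      intro a ha
      obtain ⟨b, rfl⟩ := Ideal.mem_span_singleton.mp (hPy ha)
      have hb : b ∈ P := (hPp.mem_or_mem ha).resolve_left hyP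
      exact Submodule.smul_mem_smul (by rw [hy]; exact Ideal.mem_sup_left (Ideal.mem_span_singleton_self _)) hb
    have hbot : P = ⊥ := Submodule.eq_bot_of_le_smul_of_le_jacobson_bot _ P
      (IsNoetherian.noetherian P) hle (IsLocalRing.maximalIdeal_le_jacobson _)
    have : (⊥ : Ideal R).IsPrime := hbot ▸ hPp
    exact IsDomain.of_bot_isPrime R

open Classical in
/-- interface -/
lemma reg_prime {R : Type*} [CommRing R] [IsLocalRing R] [IsNoetherianRing R]
    {n : ℕ} (x : Fin n → R) (hm : maximalIdeal R = Ideal.span (Set.range x))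
    (hd : ringKrullDim R = n) (S : Finset (Fin n)) :
    (Ideal.span (x '' S)).IsPrime ∧ ∀ i ∉ S, x i ∉ Ideal.span (x '' S) := by
  have hsup : ∀ S : Finset (Fin n), maximalIdeal R =
      Ideal.span (x '' S) ⊔ Ideal.span ((Sᶜ.image x : Finset R) : Set R) := by
    intro S
    rw [hm, ← Ideal.span_union, Finset.coe_image, ← Set.image_union, Finset.coe_compl,
      Set.union_compl_self, Set.image_univ]
  have hinj : Function.Injective x := by
    have h1 := dim_le_card (Finset.univ.image x) (by simpa using hm)
    rw [hd] at h1
    have h2 : n ≤ (Finset.univ.image x).card := by exact_mod_cast h1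
    have h3 := Finset.card_image_iff.mp (le_antisymm (Finset.card_image_le (s := Finset.univ) (f := x))
      (by simpa using h2))
    simpa [Set.injOn_univ] using h3
  have := quot_local (Ideal.span (x '' S)) (by rw [hsup S]; exact le_sup_left)
  have hmax := quot_max _ _ (hsup S)
  have hdim := quot_dim (S.image x) (Sᶜ.image x) (by rw [hsup S, Finset.coe_image (s := S)]) (by
    rw [Finset.card_image_of_injective _ hinj, Finset.card_image_of_injective _ hinj,
      Finset.card_add_card_compl, Fintype.card_fin, hd])
  rw [Finset.coe_image] at hdim
  refine ⟨?_, ?_⟩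
  · have := reg_domain _ _ rfl hmax ((Nat.cast_le.mpr Finset.card_image_le).trans hdim)
    exact (Ideal.Quotient.isDomain_iff_prime _).mp this
  · intro i hi hmem
    have hmax2 := quot_max (Ideal.span (x '' S)) ((Sᶜ.erase i).image x) (by
      rw [hsup S]
      refine le_antisymm (sup_le le_sup_left ?_) (sup_le le_sup_left ?_)
      · rw [Ideal.span_le]
        rintro _ h
        obtain ⟨j, hj, rfl⟩ := Finset.mem_image.mp (Finset.mem_coe.mp h)
        by_cases hji : j = i
        · subst hji; exact Ideal.mem_sup_left hmem
        · exact Ideal.mem_sup_right (Ideal.subset_span (Finset.mem_coe.mpr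
            (Finset.mem_image_of_mem _ (Finset.mem_erase.mpr ⟨hji, hj⟩))))
      · exact le_trans (Ideal.span_mono (Finset.coe_subset.mpr
          (Finset.image_subset_image (Finset.erase_subset _ _)))) le_sup_right)
    have h1 := hdim.trans (dim_le_card _ hmax2)
    have h2 := Nat.cast_le.mp h1
    have h3 := (h2.trans Finset.card_image_le).trans Finset.card_image_le
    rw [Finset.card_image_of_injective _ hinj] at h3
    have h4 := Finset.card_erase_lt_of_mem (Finset.mem_compl.mpr hi)
    omega

/-! Monomial ideals -/

/-- The ideal generated by the powers `x i ^ (a i)`. -/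
def powIdeal {R : Type*} [CommRing R] {n : ℕ} (x : Fin n → R) (a : Fin n → ℕ) : Ideal R :=
  Ideal.span (Set.range fun i => x i ^ a i)

lemma pow_mem_powIdeal {R : Type*} [CommRing R] {n : ℕ} (x : Fin n → R) (a : Fin n → ℕ) (i) {k : ℕ}
    (h : a i ≤ k) : x i ^ k ∈ powIdeal x a :=
  Ideal.pow_mem_of_pow_mem _ (Ideal.subset_span ⟨i, rfl⟩) h

lemma prod_update {R : Type*} [CommRing R] {n : ℕ} (x : Fin n → R) (a : Fin n → ℕ) (i) (b : ℕ) :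
    ∏ j, x j ^ (Function.update a i b j) = x i ^ b * ∏ j ∈ Finset.univ.erase i, x j ^ a j := by
  rw [← Finset.mul_prod_erase _ _ (Finset.mem_univ i), Function.update_self]
  congr 1
  refine Finset.prod_congr rfl fun j hj => ?_
  rw [Function.update_of_ne (Finset.ne_of_mem_erase hj)]

lemma prod_split {R : Type*} [CommRing R] {n : ℕ} (x : Fin n → R) (a : Fin n → ℕ) (i) :
    ∏ j, x j ^ (a j) = x i ^ a i * ∏ j ∈ Finset.univ.erase i, x j ^ a j :=
  (Finset.mul_prod_erase _ _ (Finset.mem_univ i)).symm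

lemma sum_update_lt {n : ℕ} (a : Fin n → ℕ) (i) (b : ℕ) (h : b < a i) :
    ∑ j, Function.update a i b j < ∑ j, a j := by
  apply Finset.sum_lt_sum
  · intro j _
    by_cases hj : j = i
    · subst hj; simp [h.le]
    · simp [hj]
  · exact ⟨i, Finset.mem_univ _, by simpa using h⟩

/-- Every element outside `(x i ^ (a i + 1))` has a multiple congruent to `∏ x i ^ a i`. -/
lemma mono_ess {R : Type*} [CommRing R] [IsLocalRing R] {n : ℕ} (x : Fin n → R)
    (hm : maximalIdeal R = Ideal.span (Set.range x)) (N : ℕ) :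
    ∀ (a : Fin n → ℕ), ∑ i, a i = N → ∀ c : R, c ∉ powIdeal x (fun i => a i + 1) →
      ∏ i, x i ^ a i ∈ powIdeal x (fun i => a i + 1) ⊔ Ideal.span {c} := by
  induction N using Nat.strong_induction_on with
  | _ N ih =>
  intro a ha c hc
  by_cases h0 : ∀ i, a i = 0
  · have : powIdeal x (fun i => a i + 1) = maximalIdeal R := by
      rw [hm]; simp [powIdeal, h0]
    rw [this] at hc
    have hu : IsUnit c := by simpa using hc
    rw [Ideal.span_singleton_eq_top.mpr hu]
    simp
  · push Not at h0
    obtain ⟨i, hi⟩ := h0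
    have hlt1 := sum_update_lt a i (a i - 1) (by omega)
    have hlt0 := sum_update_lt a i 0 (by omega)
    rw [ha] at hlt1 hlt0
    by_cases hc1 : c ∈ powIdeal x (fun j => Function.update a i (a i - 1) j + 1)
    · -- c = g x_i ^ a_i + J
      have hle : powIdeal x (fun j => Function.update a i (a i - 1) j + 1) ≤
          powIdeal x (fun i => a i + 1) ⊔ Ideal.span {x i ^ a i} := by
        refine Ideal.span_le.mpr ?_
        rintro _ ⟨j, rfl⟩
        by_cases hj : j = i
        · subst hj
          refine Ideal.mem_sup_right ?_
          simp only [Function.update_self]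
          rw [Nat.sub_add_cancel (by omega)]
          exact Ideal.mem_span_singleton_self _
        · refine Ideal.mem_sup_left ?_
          simp only [Function.update_of_ne hj]
          exact pow_mem_powIdeal x _ j le_rfl
      obtain ⟨l, hl, g', hg', rfl⟩ := Submodule.mem_sup.mp (hle hc1)
      obtain ⟨g, rfl⟩ := Ideal.mem_span_singleton.mp hg'
      have hmul : ∀ w ∈ powIdeal x (fun j => Function.update a i 0 j + 1),
          x i ^ a i * w ∈ powIdeal x (fun i => a i + 1) := by
        intro w hw
        have : powIdeal x (fun j => Function.update a i 0 j + 1) ≤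
            Submodule.comap (LinearMap.mulLeft R (x i ^ a i)) (powIdeal x (fun i => a i + 1)) := by
          refine Ideal.span_le.mpr ?_
          rintro _ ⟨j, rfl⟩
          change x i ^ a i * x j ^ (Function.update a i 0 j + 1) ∈ powIdeal x (fun i => a i + 1)
          by_cases hj : j = i
          · subst hj
            rw [← pow_add]
            exact pow_mem_powIdeal x _ j (by simp)
          · exact Ideal.mul_mem_left _ _ (pow_mem_powIdeal x _ j (by simp [hj]))
        exact this hw
      have hg : g ∉ powIdeal x (fun j => Function.update a i 0 j + 1) := fun h =>
        hc (add_mem hl (hmul g h))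
      have h1 := ih _ hlt0 _ rfl g hg
      obtain ⟨w, hw, v, hv, hwv⟩ := Submodule.mem_sup.mp h1
      obtain ⟨r, rfl⟩ := Ideal.mem_span_singleton.mp hv
      have h2 : ∏ j, x j ^ a j = (x i ^ a i * w - r * l) + r * (l + x i ^ a i * g) := by
        rw [prod_split x a i]
        rw [prod_update, pow_zero, one_mul] at hwv
        rw [← hwv]; ring
      rw [h2]
      exact add_mem (Ideal.mem_sup_left (sub_mem (hmul w hw) (Ideal.mul_mem_left _ _ hl)))
        (Ideal.mem_sup_right (Ideal.mul_mem_left _ _ (Ideal.mem_span_singleton_self _)))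
    · have h1 := ih _ hlt1 _ rfl c hc1
      obtain ⟨w, hw, v, hv, hwv⟩ := Submodule.mem_sup.mp h1
      have hmul : x i * w ∈ powIdeal x (fun i => a i + 1) := by
        have : powIdeal x (fun j => Function.update a i (a i - 1) j + 1) ≤
            Submodule.comap (LinearMap.mulLeft R (x i)) (powIdeal x (fun i => a i + 1)) := by
          refine Ideal.span_le.mpr ?_
          rintro _ ⟨j, rfl⟩
          change x i * x j ^ (Function.update a i (a i - 1) j + 1) ∈ powIdeal x (fun i => a i + 1)
          by_cases hj : j = i
          · subst hj
            rw [← pow_succ']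
            exact pow_mem_powIdeal x _ j (by simp; omega)
          · exact Ideal.mul_mem_left _ _ (pow_mem_powIdeal x _ j (by simp [hj]))
        exact this hw
      have h2 : ∏ j, x j ^ a j = x i * w + x i * v := by
        rw [← mul_add, hwv, prod_update, prod_split x a i, ← mul_assoc, ← pow_succ',
          Nat.sub_add_cancel (by omega)]
      rw [h2]
      exact add_mem (Ideal.mem_sup_left hmul) (Ideal.mem_sup_right (Ideal.mul_mem_left _ _ hv))

/-- partial power ideals over a set of indices -/
def powIdealOn {R : Type*} [CommRing R] {n : ℕ} (x : Fin n → R) (a : Fin n → ℕ)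
    (S : Finset (Fin n)) : Ideal R :=
  Ideal.span ((fun i => x i ^ (a i + 1)) '' S)

lemma powIdealOn_split {R : Type*} [CommRing R] {n : ℕ} (x : Fin n → R) (a : Fin n → ℕ)
    (S : Finset (Fin n)) (j) (hj : j ∈ S) (b : ℕ) :
    powIdealOn x (Function.update a j b) S =
      Ideal.span {x j ^ (b + 1)} ⊔ powIdealOn x a (S.erase j) := by
  rw [powIdealOn, powIdealOn]
  conv_lhs => rw [← Finset.insert_erase hj, Finset.coe_insert, Set.image_insert_eq, Ideal.span_insert]
  congr 1
  · simp
  · congr 1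
    refine Set.image_congr fun i hi => ?_
    have : i ≠ j := Finset.ne_of_mem_erase (Finset.mem_coe.mp hi)
    simp [this]

lemma powIdealOn_split' {R : Type*} [CommRing R] {n : ℕ} (x : Fin n → R) (a : Fin n → ℕ)
    (S : Finset (Fin n)) (j) (hj : j ∈ S) :
    powIdealOn x a S = Ideal.span {x j ^ (a j + 1)} ⊔ powIdealOn x a (S.erase j) := by
  have := powIdealOn_split x a S j hj (a j)
  rwa [Function.update_eq_self] at this

/-- `x i` is a nonzerodivisor modulo powers of the other parameters. -/
lemma nzd_mod {R : Type*} [CommRing R] {n : ℕ} (x : Fin n → R)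
    (hp : ∀ S : Finset (Fin n), (Ideal.span (x '' S)).IsPrime ∧
      ∀ i ∉ S, x i ∉ Ideal.span (x '' S)) (N : ℕ) :
    ∀ (a : Fin n → ℕ) (S : Finset (Fin n)), ∑ i ∈ S, (a i + 1) = N → ∀ i ∉ S, ∀ c : R,
      x i * c ∈ powIdealOn x a S → c ∈ powIdealOn x a S := by
  induction N using Nat.strong_induction_on with
  | _ N ih =>
  intro a S hN i hi c hc
  by_cases h0 : ∀ j ∈ S, a j = 0
  · have : powIdealOn x a S = Ideal.span (x '' S) := by
      rw [powIdealOn]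
      congr 1
      refine Set.image_congr fun j hj => ?_
      simp [h0 j hj]
    rw [this] at hc ⊢
    exact ((hp S).1.mem_or_mem hc).resolve_left ((hp S).2 i hi)
  · push Not at h0
    obtain ⟨j, hj, hj0⟩ := h0
    obtain ⟨b, hb⟩ := Nat.exists_eq_add_one_of_ne_zero hj0
    have hlt : ∀ b' < a j, ∑ i ∈ S, (Function.update a j b' i + 1) < N := by
      intro b' hb'
      rw [← hN]
      apply Finset.sum_lt_sum
      · intro k _
        by_cases hk : k = j
        · subst hk; simp; omega
        · simp [hk]
      · exact ⟨j, hj, by simp; omega⟩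
    have hlt2 : ∑ i ∈ S.erase j, (a i + 1) < N := by
      rw [← hN, ← Finset.add_sum_erase _ _ hj]; omega
    have hsp := powIdealOn_split' x a S j hj
    set I' := powIdealOn x a (S.erase j) with hI'
    have hle : powIdealOn x a S ≤ powIdealOn x (Function.update a j b) S := by
      rw [hsp, powIdealOn_split x a S j hj]
      refine sup_le_sup_right ?_ _
      rw [Ideal.span_singleton_le_iff_mem, Ideal.mem_span_singleton]
      exact pow_dvd_pow _ (by omega)
    have h1 := ih _ (hlt b (by omega)) (Function.update a j b) S rfl i hi c (hle hc)
    rw [powIdealOn_split x a S j hj] at h1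
    obtain ⟨v, hv, w, hw, rfl⟩ := Submodule.mem_sup.mp h1
    obtain ⟨r, rfl⟩ := Ideal.mem_span_singleton.mp hv
    rw [hsp] at hc ⊢
    obtain ⟨v', hv', w', hw', h2⟩ := Submodule.mem_sup.mp hc
    obtain ⟨r', rfl⟩ := Ideal.mem_span_singleton.mp hv'
    -- x_j^(b+1) * (x_i r - x_j r') ∈ I'
    have h3 : x j ^ (b+1) * (x i * r - x j * r') ∈ I' := by
      have : x j ^ (b+1) * (x i * r - x j * r') = w' - x i * w := by
        rw [hb] at h2
        linear_combination -h2
      rw [this]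
      exact sub_mem hw' (Ideal.mul_mem_left _ _ hw)
    have hcancel : ∀ (k : ℕ) (d : R), x j ^ k * d ∈ I' → d ∈ I' := by
      intro k
      induction k with
      | zero => intro d hd; simpa using hd
      | succ k ihk =>
        intro d hd
        rw [pow_succ, mul_assoc] at hd
        exact ih _ hlt2 a (S.erase j) rfl j (Finset.notMem_erase j S) d (ihk _ hd)
    have h4 := hcancel _ _ h3
    have h5 : x i * r ∈ powIdealOn x (Function.update a j 0) S := by
      rw [powIdealOn_split x a S j hj]
      have : x i * r = x j ^ (0+1) * r' + (x i * r - x j * r') := by ring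
      rw [this]
      exact add_mem (Ideal.mem_sup_left (Ideal.mul_mem_right _ _ (Ideal.mem_span_singleton_self _)))
        (Ideal.mem_sup_right h4)
    have h6 := ih _ (hlt 0 (by omega)) _ S rfl i hi r h5
    rw [powIdealOn_split x a S j hj] at h6
    obtain ⟨v2, hv2, w2, hw2, rfl⟩ := Submodule.mem_sup.mp h6
    obtain ⟨q, rfl⟩ := Ideal.mem_span_singleton.mp hv2
    have h7 : x j ^ (b + 1) * (x j ^ (0+1) * q + w2) + w =
        x j ^ (a j + 1) * q + (x j ^ (b+1) * w2 + w) := by rw [hb]; ring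
    rw [h7]
    exact add_mem (Ideal.mem_sup_left (Ideal.mul_mem_right _ _ (Ideal.mem_span_singleton_self _)))
      (Ideal.mem_sup_right (add_mem (Ideal.mul_mem_left _ _ hw2) hw))

/-- The monomial property. -/
lemma mono_not_mem {R : Type*} [CommRing R] [IsLocalRing R] {n : ℕ} (x : Fin n → R)
    (hm : maximalIdeal R = Ideal.span (Set.range x))
    (hp : ∀ S : Finset (Fin n), (Ideal.span (x '' S)).IsPrime ∧
      ∀ i ∉ S, x i ∉ Ideal.span (x '' S)) (N : ℕ) :
    ∀ (a : Fin n → ℕ), ∑ i, a i = N → ∏ i, x i ^ a i ∉ powIdeal x (fun i => a i + 1) := by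
  have huniv : ∀ a : Fin n → ℕ, powIdeal x (fun i => a i + 1) = powIdealOn x a Finset.univ := by
    intro a; simp [powIdeal, powIdealOn]
  induction N using Nat.strong_induction_on with
  | _ N ih =>
  intro a ha hmem
  by_cases h0 : ∀ i, a i = 0
  · have : powIdeal x (fun i => a i + 1) = maximalIdeal R := by
      rw [hm]; simp [powIdeal, h0]
    rw [this] at hmem
    simp [h0] at hmem
  · push Not at h0
    obtain ⟨i, hi⟩ := h0
    obtain ⟨b, hb⟩ := Nat.exists_eq_add_one_of_ne_zero hi
    have hlt1 := sum_update_lt a i b (by omega)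
    rw [ha] at hlt1
    refine ih _ hlt1 _ rfl ?_
    rw [huniv, powIdealOn_split x a _ i (Finset.mem_univ _), prod_update]
    rw [huniv, powIdealOn_split' x a _ i (Finset.mem_univ _), prod_split x a i] at hmem
    obtain ⟨v, hv, w, hw, h2⟩ := Submodule.mem_sup.mp hmem
    obtain ⟨r, rfl⟩ := Ideal.mem_span_singleton.mp hv
    set Pm := ∏ j ∈ Finset.univ.erase i, x j ^ a j
    have h3 : x i * (x i ^ b * Pm - x i ^ (b+1) * r) ∈ powIdealOn x a (Finset.univ.erase i) := by
      have : x i * (x i ^ b * Pm - x i ^ (b+1) * r) = w := by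
        rw [hb] at h2
        linear_combination -h2
      rwa [this]
    have h4 := nzd_mod x hp _ a _ rfl i (Finset.notMem_erase _ _) _ h3
    have h5 : x i ^ b * Pm = x i ^ (b+1) * r + (x i ^ b * Pm - x i ^ (b+1) * r) := by ring
    rw [h5]
    exact add_mem (Ideal.mem_sup_left (Ideal.mul_mem_right _ _ (Ideal.mem_span_singleton_self _)))
      (Ideal.mem_sup_right h4)

/-! The injective hull -/

lemma krull_sep {R : Type*} [CommRing R] [IsLocalRing R] [IsNoetherianRing R]
    (A : Ideal R) (a : R) (ha : a ∉ A) : ∃ N : ℕ, a ∉ A ⊔ maximalIdeal R ^ N := by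
  by_contra hcon
  push Not at hcon
  apply ha
  have h := Ideal.iInf_pow_smul_eq_bot_of_isLocalRing (R := R) (M := R ⧸ A) (maximalIdeal R)
    (maximalIdeal.isMaximal R).ne_top
  rw [← Ideal.Quotient.eq_zero_iff_mem, ← Submodule.mem_bot R, ← h, Submodule.mem_iInf]
  intro N
  obtain ⟨b, hb, c, hc, hbc⟩ := Submodule.mem_sup.mp (hcon N)
  have : (Ideal.Quotient.mk A a : R ⧸ A) = c • (1 : R ⧸ A) := by
    rw [← hbc, map_add, Ideal.Quotient.eq_zero_iff_mem.mpr hb, zero_add, Algebra.smul_def, mul_one]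
    rfl
  rw [this]
  exact Submodule.smul_mem_smul hc trivial

lemma baer_ext {R : Type*} [CommRing R] {E : Type*} [AddCommGroup E] [Module R E]
    (hB : Module.Baer R E) (A : Ideal R) (b : R) (w : E) (h : ∀ c, c * b ∈ A → c • w = 0) :
    ∃ z : E, (∀ a ∈ A, a • z = 0) ∧ b • z = w := by
  let K : Ideal R := LinearMap.ker ((Submodule.mkQ A) ∘ₗ (LinearMap.mulRight R b))
  have hK : ∀ c, c ∈ K ↔ c * b ∈ A := by
    intro c
    simp only [K, LinearMap.mem_ker, LinearMap.comp_apply, LinearMap.mulRight_apply,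
      Submodule.mkQ_apply, Submodule.Quotient.mk_eq_zero]
  let f : (R ⧸ K) →ₗ[R] (R ⧸ A) := K.liftQ ((Submodule.mkQ A) ∘ₗ (LinearMap.mulRight R b)) le_rfl
  have hf : Function.Injective f := by
    rw [← LinearMap.ker_eq_bot]
    exact Submodule.ker_liftQ_eq_bot _ _ _ le_rfl
  let g : (R ⧸ K) →ₗ[R] E := K.liftQ (LinearMap.toSpanSingleton R E w) (by
    intro c hc
    rw [LinearMap.mem_ker, LinearMap.toSpanSingleton_apply]
    exact h c ((hK c).mp hc))
  obtain ⟨e, he⟩ := hB.extension_property f hf g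
  refine ⟨e (A.mkQ 1), ?_, ?_⟩
  · intro a ha
    rw [← map_smul, ← map_smul, smul_eq_mul, mul_one]
    have : A.mkQ a = 0 := by simpa [Ideal.Quotient.eq_zero_iff_mem] using ha
    rw [this, map_zero]
  · have := LinearMap.congr_fun he (K.mkQ 1)
    simp only [LinearMap.comp_apply, f, g, Submodule.mkQ_apply, Submodule.liftQ_apply,
      LinearMap.toSpanSingleton_apply, one_smul, LinearMap.mulRight_apply, one_mul] at this
    rw [← map_smul, ← map_smul, smul_eq_mul, mul_one]
    exact this

lemma soc_exists {R : Type*} [CommRing R] [IsLocalRing R] {E : Type*} [AddCommGroup E] [Module R E]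
    (hE : IsInjectiveHullOfResidueField R E) :
    ∃ s : E, s ≠ 0 ∧ (∀ a ∈ maximalIdeal R, a • s = 0) ∧ ∀ z : E, z ≠ 0 → ∃ r : R, r • z = s := by
  obtain ⟨-, ι, hι, hess⟩ := hE
  refine ⟨ι 1, ?_, ?_, ?_⟩
  · rw [Ne, map_eq_zero_iff ι hι]; exact one_ne_zero
  · intro a ha
    rw [← map_smul]
    have : a • (1 : ResidueField R) = 0 := by
      rw [Algebra.smul_def, mul_one]
      exact (residue_eq_zero_iff a).mpr ha
    rw [this, map_zero]
  · intro z hz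
    obtain ⟨y, hy0, hyz, c, rfl⟩ := hess (Submodule.span R {z}) (by simpa using hz)
    obtain ⟨r, hr⟩ := Submodule.mem_span_singleton.mp hyz
    have hc : c ≠ 0 := fun h => hy0 (by rw [h, map_zero])
    obtain ⟨d, hd⟩ := residue_surjective c⁻¹
    refine ⟨d * r, ?_⟩
    rw [mul_smul, hr, ← map_smul]
    congr 1
    rw [Algebra.smul_def]
    change residue R d * c = 1
    rw [hd, inv_mul_cancel₀ hc]

lemma soc_mem {R : Type*} [CommRing R] [IsLocalRing R] {E : Type*} [AddCommGroup E] [Module R E]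
    {s : E} (hs0 : s ≠ 0) (hess : ∀ z : E, z ≠ 0 → ∃ r : R, r • z = s)
    (z : E) (hz : ∀ a ∈ maximalIdeal R, a • z = 0) : ∃ r : R, z = r • s := by
  by_cases h : z = 0
  · exact ⟨0, by rw [h, zero_smul]⟩
  obtain ⟨r, hr⟩ := hess z h
  have hu : IsUnit r := by
    by_contra hnu
    exact hs0 (hr ▸ hz r ((mem_maximalIdeal _).mpr hnu))
  obtain ⟨v, rfl⟩ := hu
  refine ⟨(v⁻¹ : Rˣ), ?_⟩
  rw [← hr, smul_smul, Units.inv_mul, one_smul]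

lemma tors {R : Type*} [CommRing R] [IsLocalRing R] [IsNoetherianRing R]
    {E : Type*} [AddCommGroup E] [Module R E]
    {s : E} (hs0 : s ≠ 0) (hess : ∀ z : E, z ≠ 0 → ∃ r : R, r • z = s) (z : E) :
    ∃ N : ℕ, ∀ c ∈ maximalIdeal R ^ N, c • z = 0 := by
  by_cases hz : z = 0
  · exact ⟨0, fun c _ => by rw [hz, smul_zero]⟩
  obtain ⟨r, hr⟩ := hess z hz
  have hrA : r ∉ LinearMap.ker (LinearMap.toSpanSingleton R E z) := by
    rw [LinearMap.mem_ker, LinearMap.toSpanSingleton_apply, hr]; exact hs0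
  obtain ⟨N, hN⟩ := krull_sep _ r hrA
  refine ⟨N, fun c hc => ?_⟩
  by_contra hcz
  obtain ⟨d, hd⟩ := hess _ hcz
  apply hN
  have : r = (r - d * c) + d * c := by ring
  rw [this]
  refine add_mem (Ideal.mem_sup_left ?_) (Ideal.mem_sup_right (Ideal.mul_mem_left _ _ hc))
  rw [LinearMap.mem_ker, LinearMap.toSpanSingleton_apply, sub_smul, hr, mul_smul, hd, sub_self]

lemma smul_powIdeal {R : Type*} [CommRing R] {E : Type*} [AddCommGroup E] [Module R E]
    {n : ℕ} (x : Fin n → R) (a : Fin n → ℕ) (z : E) (h : ∀ i, x i ^ a i • z = 0)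
    (c : R) (hc : c ∈ powIdeal x a) : c • z = 0 := by
  have : powIdeal x a ≤ LinearMap.ker (LinearMap.toSpanSingleton R E z) := by
    refine Ideal.span_le.mpr ?_
    rintro _ ⟨i, rfl⟩
    exact h i
  exact this hc

/-- The annihilator of `x i ^ (b i + 1)` is cyclic. -/
lemma ann_cyclic {R : Type*} [CommRing R] [IsLocalRing R] {E : Type*} [AddCommGroup E] [Module R E]
    {s : E} (hs0 : s ≠ 0) (hess : ∀ z : E, z ≠ 0 → ∃ r : R, r • z = s)
    {n : ℕ} (x : Fin n → R) (hm : maximalIdeal R = Ideal.span (Set.range x))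
    (t : ℕ) (η : E) (hη : ∀ i, x i ^ (t + 1) • η = 0) (hηs : (∏ i, x i ^ t) • η = s) (N : ℕ) :
    ∀ b : Fin n → ℕ, (∀ i, b i ≤ t) → ∑ i, b i = N → ∀ z : E, (∀ i, x i ^ (b i + 1) • z = 0) →
      ∃ r : R, z = (r * ∏ i, x i ^ (t - b i)) • η := by
  induction N using Nat.strong_induction_on with
  | _ N ih =>
  intro b hbt hb z hz
  by_cases h0 : ∀ i, b i = 0
  · obtain ⟨r, hr⟩ := soc_mem (R := R) hs0 hess z (by
      intro a ha
      refine smul_powIdeal x (fun i => b i + 1) z hz a ?_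
      rw [hm] at ha
      simpa [powIdeal, h0] using ha)
    refine ⟨r, ?_⟩
    simp only [h0, Nat.sub_zero]
    rw [mul_smul, hηs, hr]
  · push Not at h0
    obtain ⟨i, hi⟩ := h0
    obtain ⟨k, hk⟩ := Nat.exists_eq_add_one_of_ne_zero hi
    have hlt0 := sum_update_lt b i 0 (by omega)
    have hlt1 := sum_update_lt b i k (by omega)
    rw [hb] at hlt0 hlt1
    have hup : ∀ c ≤ t, ∏ j, x j ^ (t - Function.update b i c j) =
        x i ^ (t - c) * ∏ j ∈ Finset.univ.erase i, x j ^ (t - b j) := by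
      intro c _
      rw [← Finset.mul_prod_erase _ _ (Finset.mem_univ i), Function.update_self]
      congr 1
      refine Finset.prod_congr rfl fun j hj => ?_
      rw [Function.update_of_ne (Finset.ne_of_mem_erase hj)]
    have hsp : ∏ j, x j ^ (t - b j) =
        x i ^ (t - b i) * ∏ j ∈ Finset.univ.erase i, x j ^ (t - b j) :=
      (Finset.mul_prod_erase _ _ (Finset.mem_univ i)).symm
    set Pm := ∏ j ∈ Finset.univ.erase i, x j ^ (t - b j) with hPm
    obtain ⟨r, hr⟩ := ih _ hlt0 (Function.update b i 0) (by
      intro j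
      by_cases hj : j = i
      · subst hj; simp
      · simpa [hj] using hbt j) rfl (x i ^ b i • z) (by
      intro j
      by_cases hj : j = i
      · subst hj
        rw [smul_smul, ← pow_add, Function.update_self, add_comm]
        simpa using hz j
      · rw [Function.update_of_ne hj, smul_comm, hz j, smul_zero])
    rw [hup 0 (by omega)] at hr
    obtain ⟨q, hq⟩ := ih _ hlt1 (Function.update b i k) (by
      intro j
      by_cases hj : j = i
      · subst hj; have := hbt j; simp; omega
      · simpa [hj] using hbt j) rfl (z - (r * ∏ j, x j ^ (t - b j)) • η) (by
      intro j
      by_cases hj : j = i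
      · subst hj
        rw [Function.update_self, ← hk, smul_sub, hr, hsp, smul_smul, sub_eq_zero]
        congr 1
        have : x j ^ (t - 0) = x j ^ b j * x j ^ (t - b j) := by
          rw [← pow_add]; congr 1; have := hbt j; omega
        rw [this]; ring
      · rw [Function.update_of_ne hj, smul_sub, hz j, zero_sub, neg_eq_zero, smul_smul,
          prod_split x (fun j => t - b j) j]
        have : x j ^ (b j + 1) * (r * (x j ^ (t - b j) *
            ∏ l ∈ Finset.univ.erase j, x l ^ (t - b l))) =
            (r * ∏ l ∈ Finset.univ.erase j, x l ^ (t - b l)) * x j ^ (t + 1) := by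
          have h5 : x j ^ (t+1) = x j ^ (b j + 1) * x j ^ (t - b j) := by
            rw [← pow_add]; congr 1; have := hbt j; omega
          rw [h5]; ring
        rw [this, mul_smul, hη j, smul_zero])
    rw [hup k (by have := hbt i; omega)] at hq
    refine ⟨r + q * x i, ?_⟩
    rw [sub_eq_iff_eq_add] at hq
    rw [hq, ← add_smul]
    congr 1
    rw [hsp]
    have : x i ^ (t - k) = x i * x i ^ (t - b i) := by
      rw [← pow_succ']; congr 1; have := hbt i; omega
    rw [this]; ring

/-- A compatible sequence of generators. -/
lemma exists_eta {R : Type*} [CommRing R] [IsLocalRing R] {E : Type*} [AddCommGroup E] [Module R E]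
    (hB : Module.Baer R E) {s : E} (hs0 : s ≠ 0) (hms : ∀ a ∈ maximalIdeal R, a • s = 0)
    {n : ℕ} (x : Fin n → R) (hm : maximalIdeal R = Ideal.span (Set.range x))
    (hmono : ∀ a : Fin n → ℕ, ∏ i, x i ^ a i ∉ powIdeal x (fun i => a i + 1)) :
    ∃ η : ℕ → E, η 0 = s ∧ (∀ t, (∏ i, x i) • η (t + 1) = η t) ∧
      ∀ t c, c • η t = 0 ↔ c ∈ powIdeal x (fun _ => t + 1) := by
  let Good : ℕ → E → Prop := fun t η => (∀ c : R, c • η = 0 ↔ c ∈ powIdeal x (fun _ => t + 1)) ∧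
    (∏ i, x i ^ t) • η = s
  have h0 : Good 0 s := by
    refine ⟨fun c => ?_, by simp⟩
    have : powIdeal x (fun _ => 0 + 1) = maximalIdeal R := by rw [hm]; simp [powIdeal]
    rw [this]
    refine ⟨fun h => ?_, hms c⟩
    by_contra hc
    have hu : IsUnit c := by simpa using hc
    exact hs0 ((hu.smul_eq_zero).mp h)
  have hstep : ∀ t η, Good t η → ∃ η', (∏ i, x i) • η' = η ∧ Good (t + 1) η' := by
    rintro t η ⟨hη, hηs⟩
    obtain ⟨z, hz, hzb⟩ := baer_ext hB (powIdeal x (fun _ => t + 1 + 1)) (∏ i, x i) η (by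
      intro c hc
      rw [hη]
      by_contra hcn
      have h1 := mono_ess x hm _ (fun _ => t) rfl c hcn
      apply hmono (fun _ => t + 1)
      obtain ⟨w, hw, v, hv, hwv⟩ := Submodule.mem_sup.mp h1
      obtain ⟨r, rfl⟩ := Ideal.mem_span_singleton.mp hv
      have h2 : ∏ i, x i ^ (t + 1) = (∏ i, x i) * w + r * (c * ∏ i, x i) := by
        simp only [pow_succ]
        rw [Finset.prod_mul_distrib, ← hwv]; ring
      rw [h2]
      refine add_mem ?_ (Ideal.mul_mem_left _ _ hc)
      have : powIdeal x (fun _ => t + 1) ≤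
          Submodule.comap (LinearMap.mulLeft R (∏ i, x i)) (powIdeal x (fun _ => t + 1 + 1)) := by
        refine Ideal.span_le.mpr ?_
        rintro _ ⟨j, rfl⟩
        change (∏ i, x i) * x j ^ (t + 1) ∈ powIdeal x (fun _ => t + 1 + 1)
        rw [← Finset.mul_prod_erase _ _ (Finset.mem_univ j), mul_right_comm, ← pow_succ']
        exact Ideal.mul_mem_right _ _ (pow_mem_powIdeal x _ j le_rfl)
      exact this hw)
    have hzs : (∏ i, x i ^ (t + 1)) • z = s := by
      simp only [pow_succ]
      rw [Finset.prod_mul_distrib, mul_smul, hzb, hηs]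
    refine ⟨z, hzb, fun c => ⟨fun h => ?_, hz c⟩, hzs⟩
    by_contra hcn
    have h1 := mono_ess x hm _ (fun _ => t + 1) rfl c hcn
    obtain ⟨w, hw, v, hv, hwv⟩ := Submodule.mem_sup.mp h1
    obtain ⟨r, rfl⟩ := Ideal.mem_span_singleton.mp hv
    apply hs0
    rw [← hzs, ← hwv, add_smul, hz w hw, mul_comm, mul_smul, h, smul_zero, add_zero]
  choose! nxt hn1 hn2 using hstep
  let η : ℕ → E := fun t => Nat.rec s (fun t e => nxt t e) t
  have hG : ∀ t, Good t (η t) := by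
    intro t
    induction t with
    | zero => exact h0
    | succ t ih => exact hn2 t _ ih
  exact ⟨η, rfl, fun t => hn1 t _ (hG t), fun t => (hG t).1⟩

/-! Frobenius maps -/

lemma frob_zero {R : Type*} [CommRing R] {E : Type*} [AddCommGroup E] [Module R E] {q : ℕ}
    (θ : FrobeniusMap R E q) : θ.toFun 0 = 0 := by
  have := θ.map_add' 0 0
  rw [add_zero] at this
  exact left_eq_add.mp this

lemma frob_kill {R : Type*} [CommRing R] {E : Type*} [AddCommGroup E] [Module R E] (q : ℕ)
    (θ : FrobeniusMap R E q) (L : Ideal R) (z : E) (hz : z ∈ annIn L E) (c : R)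
    (hc : c ∈ Ideal.frobPow q L) : c • θ.toFun z = 0 := by
  have : Ideal.frobPow q L ≤ LinearMap.ker (LinearMap.toSpanSingleton R E (θ.toFun z)) := by
    refine Ideal.span_le.mpr ?_
    rintro _ ⟨b, hb, rfl⟩
    change b ^ q • θ.toFun z = 0
    rw [← θ.map_smul', hz b hb, frob_zero]
  exact this hc

lemma frobPow_sup_pow {R : Type*} [CommRing R] [IsLocalRing R] (p : ℕ) [Fact p.Prime] [CharP R p]
    (L : Ideal R) (N : ℕ) :
    Ideal.frobPow p (L ⊔ maximalIdeal R ^ N) ≤ Ideal.frobPow p L ⊔ maximalIdeal R ^ N := by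
  refine Ideal.span_le.mpr ?_
  rintro _ ⟨b, hb, rfl⟩
  obtain ⟨l, hl, c, hc, rfl⟩ := Submodule.mem_sup.mp hb
  change (l + c) ^ p ∈ _
  rw [add_pow_char]
  exact add_mem (Ideal.mem_sup_left (Ideal.subset_span ⟨l, hl, rfl⟩))
    (Ideal.mem_sup_right (Ideal.pow_mem_of_mem _ hc _ (Fact.out : p.Prime).pos))

lemma frobPow_sup_span {R : Type*} [CommRing R] (p : ℕ) [Fact p.Prime] [CharP R p]
    (L : Ideal R) (b : R) :
    Ideal.frobPow p (L ⊔ Ideal.span {b}) ≤ Ideal.frobPow p L ⊔ Ideal.span {b ^ p} := by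
  refine Ideal.span_le.mpr ?_
  rintro _ ⟨y, hy, rfl⟩
  obtain ⟨l, hl, c, hc, rfl⟩ := Submodule.mem_sup.mp hy
  obtain ⟨r, rfl⟩ := Ideal.mem_span_singleton.mp hc
  change (l + b * r) ^ p ∈ _
  rw [add_pow_char, mul_pow]
  exact add_mem (Ideal.mem_sup_left (Ideal.subset_span ⟨l, hl, rfl⟩))
    (Ideal.mem_sup_right (Ideal.mul_mem_right _ _ (Ideal.mem_span_singleton_self _)))

lemma good_ann {R : Type*} [CommRing R] [IsLocalRing R] [IsNoetherianRing R]
    (p : ℕ) [Fact p.Prime] [CharP R p] {E : Type*} [AddCommGroup E] [Module R E]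
    (hB : Module.Baer R E) {s : E} (hs0 : s ≠ 0) (hms : ∀ a ∈ maximalIdeal R, a • s = 0)
    (θ : FrobeniusMap R E p)
    (hθ : ∀ c : R, c • θ.toFun s = 0 → c ∈ Ideal.frobPow p (maximalIdeal R)) :
    ∀ (L : Ideal R) (N : ℕ), maximalIdeal R ^ N ≤ L → ∀ a : R,
      (∀ z ∈ annIn L E, a • θ.toFun z = 0) → a ∈ Ideal.frobPow p L := by
  intro L
  induction L using IsNoetherian.induction with
  | hgt L ih =>
  intro N hN a ha
  by_cases htop : L = ⊤
  · subst htop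
    have : (1 : R) ∈ Ideal.frobPow p (⊤ : Ideal R) := Ideal.subset_span ⟨1, trivial, one_pow _⟩
    rw [(Ideal.eq_top_iff_one _).mpr this]; trivial
  · have hex : ∃ b, b ∉ L ∧ ∀ c ∈ maximalIdeal R, c * b ∈ L := by
      classical
      have hE : ∃ N, maximalIdeal R ^ N ≤ L := ⟨N, hN⟩
      have hk := Nat.find_spec hE
      have hk0 : Nat.find hE ≠ 0 := by
        intro h0
        rw [h0, pow_zero, Ideal.one_eq_top, top_le_iff] at hk
        exact htop hk
      obtain ⟨k, hk1⟩ := Nat.exists_eq_add_one_of_ne_zero hk0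
      have hnot := Nat.find_min hE (m := k) (by omega)
      obtain ⟨b, hb, hbL⟩ := SetLike.not_le_iff_exists.mp hnot
      refine ⟨b, hbL, fun c hc => hk ?_⟩
      rw [hk1, pow_succ']
      exact Ideal.mul_mem_mul hc hb
    obtain ⟨b, hbL, hmb⟩ := hex
    have hlt : L < L ⊔ Ideal.span {b} := by
      refine lt_of_le_of_ne le_sup_left fun h => hbL ?_
      rw [h]; exact Ideal.mem_sup_right (Ideal.mem_span_singleton_self _)
    have h1 := ih _ hlt N (hN.trans le_sup_left) a (fun z hz =>
      ha z (fun c hc => hz c (Ideal.mem_sup_left hc)))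
    obtain ⟨l, hl, v, hv, rfl⟩ := Submodule.mem_sup.mp (frobPow_sup_span p L b h1)
    obtain ⟨c, rfl⟩ := Ideal.mem_span_singleton.mp hv
    refine add_mem hl ?_
    obtain ⟨z, hz, hbz⟩ := baer_ext hB L b s (by
      intro d hd
      refine hms d ?_
      rw [mem_maximalIdeal, mem_nonunits_iff]
      intro hu
      exact hbL ((Ideal.unit_mul_mem_iff_mem L hu).mp hd))
    have h2 := ha z hz
    rw [add_smul, frob_kill p θ L z hz l hl, zero_add, mul_comm, mul_smul, ← θ.map_smul', hbz] at h2
    have h3 := hθ c h2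
    have hle : Ideal.frobPow p (maximalIdeal R) ≤
        Submodule.comap (LinearMap.mulLeft R (b ^ p)) (Ideal.frobPow p L) := by
      refine Ideal.span_le.mpr ?_
      rintro _ ⟨y, hy, rfl⟩
      change b ^ p * y ^ p ∈ Ideal.frobPow p L
      rw [← mul_pow, mul_comm]
      exact Ideal.subset_span ⟨y * b, hmb y hy, rfl⟩
    exact hle h3

lemma exists_good_frob {R : Type*} [CommRing R] [IsLocalRing R] [IsNoetherianRing R]
    (p : ℕ) [Fact p.Prime] [CharP R p] {E : Type*} [AddCommGroup E] [Module R E]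
    (hB : Module.Baer R E) {s : E} (hs0 : s ≠ 0) (hms : ∀ a ∈ maximalIdeal R, a • s = 0)
    (hess : ∀ z : E, z ≠ 0 → ∃ r : R, r • z = s)
    {n : ℕ} (x : Fin n → R) (hm : maximalIdeal R = Ideal.span (Set.range x))
    (hmono : ∀ a : Fin n → ℕ, ∏ i, x i ^ a i ∉ powIdeal x (fun i => a i + 1)) :
    ∃ θ : FrobeniusMap R E p,
      ∀ c : R, c • θ.toFun s = 0 → c ∈ Ideal.frobPow p (maximalIdeal R) := by
  obtain ⟨η, h0, hstep, hann⟩ := exists_eta hB hs0 hms x hm hmono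
  have hp : 0 < p := (Fact.out : p.Prime).pos
  set X := ∏ i, x i with hX
  have hshift : ∀ d t, X ^ d • η (t + d) = η t := by
    intro d
    induction d with
    | zero => intro t; simp
    | succ d ih =>
      intro t
      rw [pow_succ, mul_smul, ← add_assoc, hstep, ih]
  have hgen : ∀ z : E, ∃ T, ∀ t ≥ T, ∃ r : R, z = r • η t := by
    intro z
    obtain ⟨T, hT⟩ := tors (R := R) hs0 hess z
    refine ⟨T, fun t ht => ?_⟩
    obtain ⟨r, hr⟩ := ann_cyclic hs0 hess x hm t (η t)
      (fun i => (hann t _).mpr (pow_mem_powIdeal x _ i le_rfl))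
      (by
        rw [Finset.prod_pow]
        have := hshift t 0
        rwa [zero_add, h0] at this) _ (fun _ => t) (fun _ => le_rfl) rfl z
      (fun i => hT _ (Ideal.pow_le_pow_right (by omega)
        (Ideal.pow_mem_pow (by rw [hm]; exact Ideal.subset_span ⟨i, rfl⟩) (t + 1))))
    exact ⟨_, hr⟩
  have hwd1 : ∀ t (r r' : R), r • η t = r' • η t →
      r ^ p • η (p * t + (p - 1)) = r' ^ p • η (p * t + (p - 1)) := by
    intro t r r' h
    rw [← sub_eq_zero, ← sub_smul, hann] at h
    rw [← sub_eq_zero, ← sub_smul, ← sub_pow_char, hann]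
    have hle : powIdeal x (fun _ => t + 1) ≤
        Ideal.comap (frobenius R p) (powIdeal x (fun _ => p * t + (p - 1) + 1)) := by
      refine Ideal.span_le.mpr ?_
      rintro _ ⟨i, rfl⟩
      change (x i ^ (t + 1)) ^ p ∈ powIdeal x (fun _ => p * t + (p - 1) + 1)
      rw [← pow_mul]
      refine pow_mem_powIdeal x _ i (le_of_eq ?_)
      rw [add_assoc, Nat.sub_add_cancel hp]; ring
    exact hle h
  have hup : ∀ t t' (r : R), t ≤ t' → (r • η t = (r * X ^ (t' - t)) • η t' ∧
      r ^ p • η (p * t + (p - 1)) = (r * X ^ (t' - t)) ^ p • η (p * t' + (p - 1))) := by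
    intro t t' r h
    obtain ⟨d, rfl⟩ := Nat.exists_eq_add_of_le h
    rw [Nat.add_sub_cancel_left]
    refine ⟨by rw [mul_smul, hshift], ?_⟩
    rw [mul_pow, mul_smul, ← pow_mul, mul_comm d p]
    have : p * (t + d) + (p - 1) = (p * t + (p - 1)) + p * d := by ring
    rw [this, hshift]
  have hwd : ∀ t t' (r r' : R), r • η t = r' • η t' →
      r ^ p • η (p * t + (p - 1)) = r' ^ p • η (p * t' + (p - 1)) := by
    intro t t' r r' h
    obtain ⟨h1, h2⟩ := hup t (max t t') r (le_max_left _ _)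
    obtain ⟨h3, h4⟩ := hup t' (max t t') r' (le_max_right _ _)
    rw [h2, h4]
    exact hwd1 _ _ _ (by rw [← h1, ← h3, h])
  have hgen' : ∀ z : E, ∃ (t : ℕ) (r : R), z = r • η t := fun z => by
    obtain ⟨T, hT⟩ := hgen z
    exact ⟨T, hT T le_rfl⟩
  choose τ ρ hτρ using hgen'
  have hval : ∀ (z : E) t (r : R), z = r • η t →
      ρ z ^ p • η (p * τ z + (p - 1)) = r ^ p • η (p * t + (p - 1)) :=
    fun z t r h => hwd _ _ _ _ ((hτρ z).symm.trans h)
  refine ⟨⟨fun z => ρ z ^ p • η (p * τ z + (p - 1)), ?_, ?_⟩, ?_⟩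
  · intro y z
    obtain ⟨T, hT⟩ := hgen y
    obtain ⟨T', hT'⟩ := hgen z
    obtain ⟨r, hr⟩ := hT (max T T') (le_max_left _ _)
    obtain ⟨r', hr'⟩ := hT' (max T T') (le_max_right _ _)
    rw [hval y _ r hr, hval z _ r' hr', hval (y + z) (max T T') (r + r')
      (by rw [add_smul, ← hr, ← hr']), add_pow_char, add_smul]
  · intro r z
    rw [hval (r • z) (τ z) (r * ρ z) (by rw [mul_smul, ← hτρ]), mul_pow, mul_smul]
  · intro c hc
    change c • (ρ s ^ p • η (p * τ s + (p - 1))) = 0 at hc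
    rw [hval s 0 1 (by rw [one_smul, h0]), one_pow, one_smul, mul_zero, zero_add, hann,
      Nat.sub_add_cancel hp] at hc
    have hle : powIdeal x (fun _ => p) ≤ Ideal.frobPow p (maximalIdeal R) := by
      refine Ideal.span_le.mpr ?_
      rintro _ ⟨i, rfl⟩
      exact Ideal.subset_span ⟨x i, by rw [hm]; exact Ideal.subset_span ⟨i, rfl⟩, rfl⟩
    exact hle hc

/-- With `E_S = Ann_E I` carrying the `S[T;f]`-structure in which `T` acts
as the restriction of `u • φ` (i.e. `Δ(E_S)` is multiplication by `u`), the `E_S`-ideals of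
`R` — ideals `L` such that `Ann_{E_S} L` is a `T`-stable submodule and `I ⊆ L` — are exactly
the ideals `L ⊇ I` with `u L ⊆ L^{[p]}`. -/
theorem stmt2 {R : Type*} [CommRing R] [IsLocalRing R] [IsNoetherianRing R]
    (p : ℕ) [Fact p.Prime] [CharP R p]
    (hreg : IsRegularLocal R) (hcomp : IsAdicComplete (maximalIdeal R) R)
    (E : Type*) [AddCommGroup E] [Module R E]
    (hE : IsInjectiveHullOfResidueField R E)
    (φ : FrobeniusMap R E p) (hφ : IsNaturalFrobenius p E φ)
    (I : Ideal R) (u : R) (hu : u ∈ Submodule.colon (Ideal.frobPow p I) I)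
    (L : Ideal R) :
    (I ≤ L ∧ ∀ x ∈ annIn L E, u • φ.toFun x ∈ annIn L E) ↔
      (I ≤ L ∧ ∀ a ∈ L, u * a ∈ Ideal.frobPow p L) := by
  obtain ⟨n, x, hm, hd⟩ := hreg
  have hp0 : p ≠ 0 := (Fact.out : p.Prime).ne_zero
  constructor
  · rintro ⟨hIL, hst⟩
    refine ⟨hIL, fun a ha => ?_⟩
    have hsmall : Small.{u_2} R := by
      have hinj : Function.Injective (fun (v : R) (y : E) => v • φ.toFun y) := by
        intro v w hvw
        let θ : FrobeniusMap R E (p ^ 1) :=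
          { toFun := fun y => v • φ.toFun y
            map_add' := fun y z => by rw [φ.map_add', smul_add]
            map_smul' := fun r y => by rw [φ.map_smul', pow_one, smul_comm] }
        exact (hφ 1 le_rfl θ).unique (fun y => rfl) (fun y => congrFun hvw y)
      exact small_of_injective hinj
    have hB : Module.Baer R E := Module.Baer.of_injective hE.1
    obtain ⟨s, hs0, hms, hess⟩ := soc_exists hE
    have hpr := reg_prime x hm hd
    obtain ⟨θ, hθ⟩ := exists_good_frob p hB hs0 hms hess x hm
      (fun a => mono_not_mem x hm hpr _ a rfl)
    let θ' : FrobeniusMap R E (p ^ 1) :=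
      { toFun := θ.toFun
        map_add' := θ.map_add'
        map_smul' := fun r y => by rw [θ.map_smul', pow_one] }
    obtain ⟨v, hv, -⟩ := hφ 1 le_rfl θ'
    have hv' : ∀ y, θ.toFun y = v • φ.toFun y := hv
    by_contra hcon
    obtain ⟨N, hN⟩ := krull_sep _ _ hcon
    apply hN
    refine frobPow_sup_pow p L N ?_
    refine good_ann p hB hs0 hms θ hθ (L ⊔ maximalIdeal R ^ N) N le_sup_right _ ?_
    intro z hz
    have h1 := hst z (fun b hb => hz b (Ideal.mem_sup_left hb)) a ha
    rw [hv', smul_comm, mul_comm, mul_smul, h1, smul_zero]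
  · rintro ⟨hIL, hst⟩
    refine ⟨hIL, fun z hz a ha => ?_⟩
    rw [smul_smul, mul_comm]
    exact frob_kill p φ L z hz _ (hst a ha)
end

section
/- Let u ∈ R be such that Δ(E_S) = (R/I → R/I^{[p]}) is given by multiplication by u. For each e ≥ 1 let J_e be the smallest ideal of R which contains I and satisfies u^{ν_e} ∈ J_e^{[p^e]} (such a smallest ideal exists). Then there exists α ≥ 1 with J_α = J_{α+1}, and for any such α the submodule Ann_{E_S}(J_α) coincides with the S[T;f]-submodule Nil(E_S) of nilpotent elements of E_S. Furthermore, the index of nilpotency of Nil(E_S), if not zero, equals the smallest such α. -/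
open IsLocalRing

namespace Stmt4Aux

lemma cancel_one (n : ℕ) (d : WithBot ℕ∞) (h : (n : WithBot ℕ∞) + 1 ≤ d + 1) :
    (n : WithBot ℕ∞) ≤ d := by
  induction d with
  | bot =>
    rw [WithBot.bot_add] at h
    have : ((n + 1 : ℕ) : WithBot ℕ∞) = ⊥ := by push_cast; exact le_bot_iff.1 h
    exact absurd this (by simpa using WithBot.coe_ne_bot (a := ((n + 1 : ℕ) : ℕ∞)))
  | coe d =>
    have h1 : ((n + 1 : ℕ∞) : WithBot ℕ∞) ≤ ((d + 1 : ℕ∞) : WithBot ℕ∞) := by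
      simpa using h
    have h2 := WithBot.coe_le_coe.1 h1
    have h3 : (n : ℕ∞) ≤ d := (ENat.add_le_add_iff_right (by simp)).1 h2
    exact WithBot.coe_le_coe.2 h3

lemma exists_exchange {R : Type*} [CommRing R] [IsLocalRing R] {n : ℕ} (x : Fin (n+1) → R)
    (hx : maximalIdeal R = Ideal.span (Set.range x)) (y : R) (hy : y ∈ maximalIdeal R)
    (hy2 : y ∉ maximalIdeal R ^ 2) :
    ∃ i, maximalIdeal R = Ideal.span {y} ⊔ Ideal.span (Set.range (x ∘ Fin.succAbove i)) := by
  have hy' := hy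
  rw [hx, Ideal.mem_span_range_iff_exists_fun] at hy'
  obtain ⟨c, hc⟩ := hy'
  have hxm : ∀ i, x i ∈ maximalIdeal R := fun i => hx ▸ Ideal.subset_span ⟨i, rfl⟩
  have : ∃ i, c i ∉ maximalIdeal R := by
    by_contra! h
    apply hy2
    rw [← hc, pow_two]
    exact Ideal.sum_mem _ fun i _ => Ideal.mul_mem_mul (h i) (hxm i)
  obtain ⟨i, hi⟩ := this
  have hu : IsUnit (c i) := by simpa using hi
  refine ⟨i, le_antisymm ?_ ?_⟩
  · rw [hx, Ideal.span_le]
    rintro _ ⟨j, rfl⟩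
    rcases Fin.eq_self_or_eq_succAbove i j with rfl | ⟨k, rfl⟩
    · obtain ⟨v, hv⟩ := hu.exists_left_inv
      rw [Fin.sum_univ_succAbove _ j] at hc
      have : x j = v * y - ∑ k, (v * c (j.succAbove k)) * x (j.succAbove k) := by
        rw [← hc, mul_add, ← mul_assoc, hv, Finset.mul_sum]
        simp [mul_assoc]
      rw [this]
      refine sub_mem (Ideal.mul_mem_left _ _ (Ideal.mem_sup_left (Ideal.mem_span_singleton_self y)))
        (Ideal.mem_sup_right (Ideal.sum_mem _ fun k _ => Ideal.mul_mem_left _ _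
          (Ideal.subset_span ⟨k, rfl⟩)))
    · exact Ideal.mem_sup_right (Ideal.subset_span ⟨k, rfl⟩)
  · refine sup_le ?_ ?_
    · simpa [Ideal.span_le] using hy
    · rw [Ideal.span_le]
      rintro _ ⟨k, rfl⟩
      exact hxm _

lemma dim_le_of_span {R : Type*} [CommRing R] [IsLocalRing R] [IsNoetherianRing R] (l : List R)
    (hx : maximalIdeal R = Ideal.span {r | r ∈ l}) : ringKrullDim R ≤ l.length := by
  classical
  refine (ringKrullDim_le_spanFinrank_maximalIdeal R).trans ?_
  have h1 : (maximalIdeal R).spanFinrank ≤ l.length := by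
    rw [hx]
    have e : {r | r ∈ l} = (l.toFinset : Set R) := by ext; simp
    refine (Submodule.spanFinrank_span_le_ncard_of_finite ?_).trans ?_
    · rw [e]; exact Finset.finite_toSet _
    · rw [e, Set.ncard_coe_finset]; exact List.toFinset_card_le l
  exact_mod_cast h1

lemma map_max {R : Type*} [CommRing R] [IsLocalRing R] (a : Ideal R) [Nontrivial (R ⧸ a)] :
    have : IsLocalRing (R ⧸ a) := IsLocalRing.of_surjective' _ Ideal.Quotient.mk_surjective
    maximalIdeal (R ⧸ a) = (maximalIdeal R).map (Ideal.Quotient.mk a) := by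
  have : IsLocalRing (R ⧸ a) := IsLocalRing.of_surjective' _ Ideal.Quotient.mk_surjective
  have := IsLocalRing.surjective_units_map_of_local_ringHom (Ideal.Quotient.mk a)
  exact (IsLocalRing.map_maximalIdeal_of_surjective _ Ideal.Quotient.mk_surjective).symm

theorem isDomain_aux (n : ℕ) : ∀ (R : Type*) [CommRing R] [IsLocalRing R] [IsNoetherianRing R]
    (x : Fin n → R), maximalIdeal R = Ideal.span (Set.range x) → (n : WithBot ℕ∞) ≤ ringKrullDim R →
    IsDomain R := by
  induction n with
  | zero =>
    intro R _ _ _ x hx _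
    have : maximalIdeal R = ⊥ := by rw [hx]; simp
    have := (IsLocalRing.isField_iff_maximalIdeal_eq).2 this
    exact this.isDomain
  | succ n ih =>
    intro R _ _ _ x hx hd
    have hdim : ¬ ringKrullDim R ≤ 0 := by
      intro h
      have := hd.trans h
      have h2 : n + 1 ≤ 0 := by exact_mod_cast this
      omega
    have hfin : (minimalPrimes R).Finite := minimalPrimes.finite_of_isNoetherianRing R
    have hav : ∃ y ∈ maximalIdeal R, y ∉ maximalIdeal R ^ 2 ∧ ∀ P ∈ minimalPrimes R, y ∉ P := by
      by_contra! h
      have hsub : ((maximalIdeal R : Ideal R) : Set R) ⊆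
          ⋃ i ∈ insert (maximalIdeal R ^ 2) (minimalPrimes R), ((id i : Ideal R) : Set R) := by
        intro y hy
        by_cases h2 : y ∈ maximalIdeal R ^ 2
        · simp [h2]
        · obtain ⟨P, hP, hyP⟩ := h y hy h2
          simp only [Set.mem_iUnion]
          exact ⟨P, Set.mem_insert_of_mem _ hP, hyP⟩
      rw [Ideal.subset_union_prime_finite (hfin.insert _) (maximalIdeal R ^ 2)
        (maximalIdeal R ^ 2)] at hsub
      · obtain ⟨P, hP, hle⟩ := hsub
        apply hdim
        rcases hP with rfl | hP
        · have : maximalIdeal R = ⊥ := by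
            apply Submodule.eq_bot_of_le_smul_of_le_jacobson_bot (maximalIdeal R) _
              (IsNoetherian.noetherian _)
            · simpa [pow_two] using hle
            · exact IsLocalRing.maximalIdeal_le_jacobson _
          have := (IsLocalRing.isField_iff_maximalIdeal_eq).2 this
          exact (ringKrullDim_eq_zero_of_isField this).le
        · have hPm : P.IsPrime := hP.1.1
          have he : maximalIdeal R = P := le_antisymm hle (IsLocalRing.le_maximalIdeal hPm.ne_top)
          have : Ring.KrullDimLE 0 R := Ring.krullDimLE_zero_iff.mpr fun Q hQ => by
            have : Q = P := le_antisymm (he ▸ IsLocalRing.le_maximalIdeal hQ.ne_top)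
              (hP.2 ⟨hQ, bot_le⟩ (he ▸ IsLocalRing.le_maximalIdeal hQ.ne_top))
            rw [this, ← he]; infer_instance
          exact (Order.krullDimLE_iff _ _).1 this
      · intro i hi h1 _
        rcases hi with rfl | hi
        · exact absurd rfl h1
        · exact hi.1.1
    obtain ⟨y, hy, hy2, hyP⟩ := hav
    obtain ⟨i, hi⟩ := exists_exchange x hx y hy hy2
    have hne : Ideal.span {y} ≠ ⊤ := by
      rw [Ne, Ideal.span_singleton_eq_top]; simpa using hy
    have : Nontrivial (R ⧸ Ideal.span {y}) := Ideal.Quotient.nontrivial_iff.2 hne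
    have : IsLocalRing (R ⧸ Ideal.span {y}) :=
      IsLocalRing.of_surjective' _ Ideal.Quotient.mk_surjective
    have hdom : IsDomain (R ⧸ Ideal.span {y}) := by
      refine ih _ (fun k => Ideal.Quotient.mk _ (x (i.succAbove k))) ?_ ?_
      · rw [map_max, hi, Ideal.map_sup, Ideal.map_quotient_self, bot_sup_eq, Ideal.map_span,
          ← Set.range_comp]
        rfl
      · have h1 := ringKrullDim_le_ringKrullDim_quotient_add_card ({y} : Finset R)
          (by simpa [IsLocalRing.ringJacobson_eq_maximalIdeal] using hy)
        rw [Finset.coe_singleton, Finset.card_singleton] at h1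
        have h2 := hd.trans h1
        push_cast at h2
        exact cancel_one _ _ h2
    have hprime : (Ideal.span {y}).IsPrime := (Ideal.Quotient.isDomain_iff_prime _).1 hdom
    obtain ⟨P, hP, hPy⟩ := Ideal.exists_minimalPrimes_le (I := (⊥ : Ideal R)) (J := Ideal.span {y}) bot_le
    have hPp : P.IsPrime := hP.1.1
    have : P = ⊥ := by
      apply Submodule.eq_bot_of_le_smul_of_le_jacobson_bot (maximalIdeal R) _
              (IsNoetherian.noetherian _)
      · intro z hz
        obtain ⟨r, rfl⟩ := Ideal.mem_span_singleton'.1 (hPy hz)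
        have hr := (hPp.mem_or_mem hz).resolve_right (hyP P hP)
        rw [mul_comm]
        exact Ideal.mul_mem_mul hy hr
      · exact IsLocalRing.maximalIdeal_le_jacobson _
    rw [this] at hPp
    exact (IsDomain.of_bot_isPrime R)

/-- Elementwise weakly regular sequences modulo an ideal. -/
def RegMod {R : Type*} [CommRing R] : Ideal R → List R → Prop
  | _, [] => True
  | a, (x :: l) => (∀ r, x * r ∈ a → r ∈ a) ∧ RegMod (a ⊔ Ideal.span {x}) l

theorem regMod_of {R : Type*} [CommRing R] [IsLocalRing R] [IsNoetherianRing R] (l : List R) :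
    ∀ (a : Ideal R), maximalIdeal R = a ⊔ Ideal.span {r | r ∈ l} →
      (l.length : WithBot ℕ∞) ≤ ringKrullDim (R ⧸ a) → RegMod a l := by
  induction l with
  | nil => intros; trivial
  | cons x l ih =>
    intro a hm hd
    have hne : a ≠ ⊤ := by
      rintro rfl
      simp at hm
      exact (IsLocalRing.maximalIdeal.isMaximal R).ne_top hm
    have : Nontrivial (R ⧸ a) := Ideal.Quotient.nontrivial_iff.2 hne
    have : IsLocalRing (R ⧸ a) := IsLocalRing.of_surjective' _ Ideal.Quotient.mk_surjective
    have hmax : ∀ l' : List R, maximalIdeal R = a ⊔ Ideal.span {r | r ∈ l'} →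
        maximalIdeal (R ⧸ a) = Ideal.span {r | r ∈ l'.map (Ideal.Quotient.mk a)} := by
      intro l' h
      rw [map_max, h, Ideal.map_sup, Ideal.map_quotient_self, bot_sup_eq, Ideal.map_span]
      congr 1
      ext; simp
    have hdom : IsDomain (R ⧸ a) := by
      refine isDomain_aux (((x :: l).map (Ideal.Quotient.mk a)).length) _
        ((x :: l).map (Ideal.Quotient.mk a)).get ?_ ?_
      · rw [hmax _ hm]
        congr 1
        ext r
        exact List.mem_iff_get
      · simpa using hd
    have hprime : a.IsPrime := (Ideal.Quotient.isDomain_iff_prime _).1 hdom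
    have hxm : x ∈ maximalIdeal R := by
      rw [hm]; exact Ideal.mem_sup_right (Ideal.subset_span (by simp))
    have hspan : Ideal.span {r | r ∈ x :: l} = Ideal.span {x} ⊔ Ideal.span {r | r ∈ l} := by
      rw [← Ideal.span_union]; congr 1; ext; simp
    have hxa : x ∉ a := by
      intro h
      have h1 : maximalIdeal R = a ⊔ Ideal.span {r | r ∈ l} := by
        rw [hm, hspan, ← sup_assoc, sup_eq_left.2 ((Ideal.span_singleton_le_iff_mem a).2 h)]
      have h2 := hd.trans (dim_le_of_span _ (hmax l h1))
      have h3 : (x :: l).length ≤ (l.map (Ideal.Quotient.mk a)).length := by exact_mod_cast h2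
      simp at h3
    refine ⟨fun r hr => (hprime.mem_or_mem hr).resolve_left hxa, ih _ ?_ ?_⟩
    · rw [hm, hspan, sup_assoc]
    · have h1 := ringKrullDim_le_ringKrullDim_quotient_add_card ({Ideal.Quotient.mk a x} : Finset (R ⧸ a))
          (by
            rw [IsLocalRing.ringJacobson_eq_maximalIdeal, map_max]
            simpa using Ideal.mem_map_of_mem (Ideal.Quotient.mk a) hxm)
      rw [Finset.coe_singleton, Finset.card_singleton] at h1
      have e : (R ⧸ a) ⧸ Ideal.span {Ideal.Quotient.mk a x} ≃+* R ⧸ (a ⊔ Ideal.span {x}) :=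
        (Ideal.quotEquivOfEq (by rw [Ideal.map_span, Set.image_singleton])).trans
          (DoubleQuot.quotQuotEquivQuotSup a (Ideal.span {x}))
      rw [ringKrullDim_eq_of_ringEquiv e] at h1
      have h2 := hd.trans h1
      rw [List.length_cons] at h2
      push_cast at h2
      exact cancel_one _ _ h2

end Stmt4Aux
namespace Stmt4Aux

section coreg
variable {R : Type*} [CommRing R] {E : Type*} [AddCommGroup E] [Module R E]

/-- Elementwise coregular sequences on a submodule. -/
def Coreg : List R → Submodule R E → Prop
  | [], _ => True
  | (x :: l), M => (∀ z ∈ M, ∃ w ∈ M, x • w = z) ∧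
      Coreg l (M ⊓ LinearMap.ker (LinearMap.lsmul R E x))

lemma coreg_bot (l : List R) : Coreg l (⊥ : Submodule R E) := by
  induction l with
  | nil => trivial
  | cons x l ih =>
    refine ⟨?_, by simpa using ih⟩
    intro z hz
    refine ⟨0, by simp, ?_⟩
    rw [smul_zero, (Submodule.mem_bot R).1 hz]

lemma coreg_ext (c : R) (l : List R) : ∀ B : Submodule R E,
    Coreg l (B ⊓ LinearMap.ker (LinearMap.lsmul R E c)) → Coreg l (B.map (LinearMap.lsmul R E c)) →
    Coreg l B := by
  induction l with
  | nil => intros; trivial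
  | cons x l ih =>
    rintro B ⟨hA1, hA2⟩ ⟨hC1, hC2⟩
    refine ⟨?_, ih _ ?_ ?_⟩
    · intro z hz
      obtain ⟨w, hw, hxw⟩ := hC1 (c • z) ⟨z, hz, rfl⟩
      obtain ⟨w', hw', rfl⟩ := hw
      simp only [LinearMap.lsmul_apply] at hxw
      obtain ⟨w'', hw'', h2⟩ := hA1 (z - x • w') ⟨sub_mem hz (B.smul_mem _ hw'), by
        show c • (z - x • w') = 0
        rw [smul_sub, smul_comm c x, hxw, sub_self]⟩
      refine ⟨w' + w'', add_mem hw' hw''.1, ?_⟩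
      rw [smul_add, h2]; abel
    · rwa [inf_right_comm]
    · convert hC2 using 1
      ext w
      constructor
      · rintro ⟨b, ⟨hb, hxb⟩, rfl⟩
        refine ⟨⟨b, hb, rfl⟩, ?_⟩
        simp only [LinearMap.mem_ker, LinearMap.lsmul_apply, SetLike.mem_coe] at hxb ⊢
        rw [smul_comm, hxb, smul_zero]
      · rintro ⟨⟨b, hb, rfl⟩, hw⟩
        simp only [LinearMap.mem_ker, LinearMap.lsmul_apply, SetLike.mem_coe] at hw
        obtain ⟨a, ha, h2⟩ := hA1 (x • b) ⟨B.smul_mem _ hb, by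
          show c • (x • b) = 0
          rw [smul_comm, hw]⟩
        have hca : c • a = 0 := ha.2
        refine ⟨b - a, ⟨sub_mem hb ha.1, ?_⟩, ?_⟩
        · simp only [LinearMap.mem_ker, LinearMap.lsmul_apply, SetLike.mem_coe]
          rw [smul_sub, h2, sub_self]
        · simp only [LinearMap.lsmul_apply]
          rw [smul_sub, hca, sub_zero]

lemma div_pow (x : R) (M : Submodule R E) (h : ∀ z ∈ M, ∃ w ∈ M, x • w = z) (a : ℕ) :
    ∀ z ∈ M, ∃ w ∈ M, x ^ a • w = z := by
  induction a with
  | zero => intro z hz; exact ⟨z, hz, by simp⟩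
  | succ a ih =>
    intro z hz
    obtain ⟨w, hw, rfl⟩ := h z hz
    obtain ⟨w', hw', rfl⟩ := ih w hw
    exact ⟨w', hw', by rw [smul_smul, pow_succ']⟩

lemma coreg_ker_pow (x : R) (l : List R) (M : Submodule R E) (h : Coreg (x :: l) M) (a : ℕ) :
    Coreg l (M ⊓ LinearMap.ker (LinearMap.lsmul R E (x ^ a))) := by
  induction a with
  | zero =>
    convert coreg_bot (E := E) l
    ext z; simp +contextual [LinearMap.mem_ker]
  | succ a ih =>
    apply coreg_ext (x ^ a)
    · convert ih using 1
      ext z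
      simp only [Submodule.mem_inf, LinearMap.mem_ker, LinearMap.lsmul_apply]
      constructor
      · rintro ⟨⟨h1, -⟩, h2⟩; exact ⟨h1, h2⟩
      · rintro ⟨h1, h2⟩; refine ⟨⟨h1, ?_⟩, h2⟩
        rw [pow_succ', mul_smul, h2, smul_zero]
    · convert h.2 using 1
      ext z
      simp only [Submodule.mem_map, Submodule.mem_inf, LinearMap.mem_ker, LinearMap.lsmul_apply]
      constructor
      · rintro ⟨y, ⟨hy, hy2⟩, rfl⟩
        exact ⟨M.smul_mem _ hy, by rw [smul_smul, ← pow_succ', hy2]⟩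
      · rintro ⟨hz, hz2⟩
        obtain ⟨w, hw, rfl⟩ := div_pow x M h.1 a z hz
        exact ⟨w, ⟨hw, by rw [pow_succ', mul_smul, hz2]⟩, rfl⟩

lemma coreg_solve (q : ℕ) (l : List R) : ∀ (M : Submodule R E), Coreg l M →
    ∀ e : R → E, (∀ x ∈ l, e x ∈ M) → (∀ x ∈ l, ∀ x' ∈ l, x ^ q • e x' = x' ^ q • e x) →
    ∃ t ∈ M, ∀ x ∈ l, x ^ q • t = e x := by
  induction l with
  | nil => intro M _ e _ _; exact ⟨0, zero_mem _, by simp⟩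
  | cons x l ih =>
    intro M h e he hc
    obtain ⟨t0, ht0, h0⟩ := div_pow x M h.1 q (e x) (he x (by simp))
    obtain ⟨t1, ht1, h1⟩ := ih _ (coreg_ker_pow x l M h q) (fun r => e r - r ^ q • t0) (by
      intro r hr
      refine ⟨sub_mem (he r (by simp [hr])) (M.smul_mem _ ht0), ?_⟩
      show x ^ q • (e r - r ^ q • t0) = 0
      rw [smul_sub, smul_comm, h0, hc x (by simp) r (by simp [hr]), sub_self]) (by
      intro r hr s hs
      rw [smul_sub, smul_sub, hc r (by simp [hr]) s (by simp [hs]), smul_comm])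
    refine ⟨t0 + t1, add_mem ht0 ht1.1, ?_⟩
    intro r hr
    rcases List.mem_cons.1 hr with rfl | hr
    · have : r ^ q • t1 = 0 := ht1.2
      rw [smul_add, h0, this, add_zero]
    · rw [smul_add, h1 r hr]; abel

lemma coreg_of_regMod (hB : Module.Baer R E) (l : List R) : ∀ a : Ideal R, RegMod a l →
    Coreg l (annIn a E) := by
  induction l with
  | nil => intros; trivial
  | cons x l ih =>
    rintro a ⟨h1, h2⟩
    refine ⟨?_, ?_⟩
    · intro z hz
      let f : (R ⧸ a) →ₗ[R] (R ⧸ a) := LinearMap.lsmul R (R ⧸ a) x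
      have hf : Function.Injective f := by
        rw [injective_iff_map_eq_zero]
        intro r hr
        obtain ⟨r, rfl⟩ := Ideal.Quotient.mk_surjective r
        have : Ideal.Quotient.mk a (x * r) = 0 := hr
        exact Ideal.Quotient.eq_zero_iff_mem.2 (h1 r (Ideal.Quotient.eq_zero_iff_mem.1 this))
      let g : (R ⧸ a) →ₗ[R] E := Submodule.liftQ a (LinearMap.toSpanSingleton R E z) (by
        intro r hr; exact hz r hr)
      obtain ⟨h, hh⟩ := hB.extension_property f hf g
      have e1 : ∀ r : R, h (Submodule.Quotient.mk r) = r • h (Submodule.Quotient.mk 1) := by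
        intro r
        rw [← map_smul, ← Submodule.Quotient.mk_smul, smul_eq_mul, mul_one]
      refine ⟨h (Submodule.Quotient.mk 1), ?_, ?_⟩
      · intro r hr
        rw [← e1, (Submodule.Quotient.mk_eq_zero a).2 hr, map_zero]
      · have := LinearMap.congr_fun hh (Submodule.Quotient.mk 1)
        have h3 : g (Submodule.Quotient.mk 1) = z := by
          change (1 : R) • z = z
          exact one_smul _ _
        rw [h3] at this
        rw [← this, ← map_smul]; rfl
    · convert ih _ h2 using 1
      ext z
      constructor
      · rintro ⟨hz, hx⟩ r hr
        obtain ⟨b, hb, c, hc, rfl⟩ := Submodule.mem_sup.1 hr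
        obtain ⟨d, rfl⟩ := Ideal.mem_span_singleton'.1 hc
        have hx : x • z = 0 := hx
        rw [add_smul, hz b hb, mul_smul, hx]; simp
      · intro hz
        exact ⟨fun b hb => hz b (Ideal.mem_sup_left hb),
          hz x (Ideal.mem_sup_right (Ideal.mem_span_singleton_self x))⟩

end coreg

section hull
variable {R : Type*} [CommRing R] [IsLocalRing R] {E : Type*} [AddCommGroup E] [Module R E]

lemma cogen (hB : Module.Baer R E) (hE : IsInjectiveHullOfResidueField R E) (a : Ideal R) (v : R)
    (hv : v ∉ a) : ∃ y : E, (∀ b ∈ a, b • y = 0) ∧ v • y ≠ 0 := by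
  obtain ⟨-, ι, hι, -⟩ := hE
  let f0 : R →ₗ[R] (R ⧸ a) := LinearMap.toSpanSingleton R (R ⧸ a) (Submodule.Quotient.mk v)
  let C : Ideal R := LinearMap.ker f0
  have hC : C ≠ ⊤ := by
    intro h
    have h1 : (1 : R) ∈ C := by rw [h]; trivial
    have h2 : (1 : R) • (Submodule.Quotient.mk v : R ⧸ a) = 0 := h1
    rw [one_smul] at h2
    exact hv ((Submodule.Quotient.mk_eq_zero a).1 h2)
  let f : (R ⧸ C) →ₗ[R] (R ⧸ a) := Submodule.liftQ C f0 le_rfl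
  have hf : Function.Injective f := by
    rw [← LinearMap.ker_eq_bot]
    exact Submodule.ker_liftQ_eq_bot _ _ _ le_rfl
  let g : (R ⧸ C) →ₗ[R] E := Submodule.liftQ C (LinearMap.toSpanSingleton R E (ι 1)) (by
    intro r hr
    have hr' : r ∈ maximalIdeal R := IsLocalRing.le_maximalIdeal hC hr
    change r • ι 1 = 0
    rw [← map_smul]
    have : r • (1 : ResidueField R) = 0 := by
      rw [Algebra.smul_def, mul_one]
      exact Ideal.Quotient.eq_zero_iff_mem.2 hr'
    rw [this, map_zero])
  obtain ⟨h, hh⟩ := hB.extension_property f hf g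
  have e1 : ∀ r : R, h (Submodule.Quotient.mk r) = r • h (Submodule.Quotient.mk 1) := by
    intro r
    rw [← map_smul, ← Submodule.Quotient.mk_smul, smul_eq_mul, mul_one]
  refine ⟨h (Submodule.Quotient.mk 1), ?_, ?_⟩
  · intro r hr
    rw [← e1, (Submodule.Quotient.mk_eq_zero a).2 hr, map_zero]
  · rw [← e1]
    have := LinearMap.congr_fun hh (Submodule.Quotient.mk 1)
    have h3 : g (Submodule.Quotient.mk 1) = ι 1 := by
      change (1 : R) • ι 1 = ι 1
      exact one_smul _ _
    have h4 : f (Submodule.Quotient.mk 1) = Submodule.Quotient.mk v := by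
      change (1 : R) • (Submodule.Quotient.mk v : R ⧸ a) = _
      exact one_smul _ _
    rw [h3, LinearMap.comp_apply, h4] at this
    rw [this]
    intro h0
    exact one_ne_zero (hι (h0.trans (map_zero ι).symm))

lemma pow_kill [IsNoetherianRing R] (hE : IsInjectiveHullOfResidueField R E) (x : E) (a : R)
    (ha : a ∈ maximalIdeal R) : ∃ i : ℕ, a ^ i • x = 0 := by
  obtain ⟨-, ι, hι, hess⟩ := hE
  let A : ℕ →o Ideal R := ⟨fun i => LinearMap.ker (LinearMap.toSpanSingleton R E (a ^ i • x)), by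
    refine monotone_nat_of_le_succ fun i r hr => ?_
    have hr : r • a ^ i • x = 0 := hr
    change r • a ^ (i+1) • x = 0
    rw [pow_succ', mul_smul, smul_comm, hr, smul_zero]⟩
  obtain ⟨i, hi⟩ := monotone_stabilizes_iff_noetherian.2 (inferInstance : IsNoetherian R R) A
  refine ⟨i, ?_⟩
  by_contra hne
  obtain ⟨z, hz, hz1, w, rfl⟩ := hess (R ∙ (a ^ i • x)) (by simpa using hne)
  obtain ⟨r, hr⟩ := Submodule.mem_span_singleton.1 hz1
  have h0 : a • ι w = 0 := by
    rw [← map_smul]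
    have : a • w = 0 := by
      rw [Algebra.smul_def]
      have : algebraMap R (ResidueField R) a = 0 := Ideal.Quotient.eq_zero_iff_mem.2 ha
      rw [this, zero_mul]
    rw [this, map_zero]
  have h1 : r ∈ A (i+1) := by
    change r • a ^ (i+1) • x = 0
    rw [pow_succ', mul_smul, smul_comm, hr, h0]
  rw [← hi (i+1) (by omega)] at h1
  have h1 : r • a ^ i • x = 0 := h1
  exact hz (hr.symm.trans h1)

lemma torsion [IsNoetherianRing R] (hE : IsInjectiveHullOfResidueField R E) (x : E) :
    ∃ k : ℕ, ∀ a ∈ maximalIdeal R ^ k, a • x = 0 := by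
  let L : Ideal R := LinearMap.ker (LinearMap.toSpanSingleton R E x)
  have h : maximalIdeal R ≤ L.radical := by
    intro a ha
    obtain ⟨i, hi⟩ := pow_kill hE x a ha
    exact ⟨i, hi⟩
  obtain ⟨k, hk⟩ := Ideal.exists_pow_le_of_le_radical_of_fg h (IsNoetherian.noetherian _)
  exact ⟨k, fun a ha => hk ha⟩

lemma exists_socle [IsNoetherianRing R] (hE : IsInjectiveHullOfResidueField R E)
    (M : Submodule R E) (hM : M ≠ ⊤) : ∃ y ∉ M, ∀ a ∈ maximalIdeal R, a • y ∈ M := by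
  classical
  obtain ⟨z, -, hz⟩ := SetLike.exists_of_lt (lt_top_iff_ne_top.2 hM)
  have hex : ∃ k : ℕ, ∀ a ∈ maximalIdeal R ^ k, a • z ∈ M := by
    obtain ⟨k, hk⟩ := torsion hE z
    exact ⟨k, fun a ha => by rw [hk a ha]; exact zero_mem _⟩
  have hs := Nat.find_spec hex
  have hm := @Nat.find_min _ _ hex
  generalize Nat.find hex = k at hs hm
  cases k with
  | zero =>
    exact absurd (hs 1 (by simp)) (by simpa using hz)
  | succ k =>
    have := hm (Nat.lt_succ_self k)
    push Not at this
    obtain ⟨b, hb, hbz⟩ := this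
    refine ⟨b • z, hbz, fun a ha => ?_⟩
    rw [smul_smul]
    apply hs
    rw [pow_succ']
    exact Ideal.mul_mem_mul ha hb

/-- Extension of partial Frobenius maps. -/
lemma extend [IsNoetherianRing R] (hE : IsInjectiveHullOfResidueField R E)
    (σ : R →+* R) (q : ℕ) (hσ : ∀ r, σ r = r ^ q) (l : List R)
    (hl : maximalIdeal R = Ideal.span {r | r ∈ l}) (hco : Coreg l (⊤ : Submodule R E))
    (f : E →ₛₗ.[σ] E) : ∃ g : E →ₛₗ.[σ] E, f ≤ g ∧ g.domain = ⊤ := by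
  obtain ⟨g, hfg, hg⟩ := zorn_le_nonempty_Ici₀ f (by
    intro c _ hc y hy
    exact ⟨LinearPMap.sSup c hc.directedOn, fun z hz => LinearPMap.le_sSup hc.directedOn hz⟩) f le_rfl
  refine ⟨g, hfg, ?_⟩
  by_contra hne
  obtain ⟨y, hyM, hym⟩ := exists_socle hE _ hne
  have hlm : ∀ r ∈ l, r ∈ maximalIdeal R := fun r hr => hl ▸ Ideal.subset_span hr
  classical
  let e : R → E := fun r => if h : r • y ∈ g.domain then g ⟨r • y, h⟩ else 0
  have he : ∀ r (h : r • y ∈ g.domain), e r = g ⟨r • y, h⟩ := fun r h => dif_pos h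
  have hmul : ∀ r s, s • y ∈ g.domain → e (r * s) = r ^ q • e s := by
    intro r s hs
    have hrs : (r * s) • y ∈ g.domain := by rw [mul_smul]; exact g.domain.smul_mem _ hs
    rw [he _ hs, he _ hrs, ← hσ]
    refine Eq.trans ?_ (g.toFun.map_smulₛₗ r ⟨s • y, hs⟩)
    change g.toFun _ = _
    congr 1
    ext
    simp [mul_smul]
  obtain ⟨t, -, ht⟩ := coreg_solve q l ⊤ hco e (by simp) (by
    intro x hx x' hx'
    rw [← hmul _ _ (hym _ (hlm _ hx')), ← hmul _ _ (hym _ (hlm _ hx)), mul_comm])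
  have hall : ∀ r ∈ maximalIdeal R, e r = σ r • t := by
    intro r hr
    rw [hl] at hr
    induction hr using Submodule.span_induction with
    | mem x hx => rw [hσ, ht x hx]
    | zero => 
      rw [he 0 (by simp)]
      simp only [map_zero, zero_smul]
      exact g.toFun.map_zero
    | add a b ha hb iha ihb =>
      change a ∈ Ideal.span _ at ha
      change b ∈ Ideal.span _ at hb
      rw [← hl] at ha hb
      rw [map_add, add_smul, ← iha, ← ihb, he _ (hym _ ha), he _ (hym _ hb),
        he _ (hym _ (add_mem ha hb)), ← LinearPMap.map_add]
      congr 1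
      ext
      simp [add_smul]
    | smul a b hb ihb =>
      change b ∈ Ideal.span _ at hb
      rw [← hl] at hb
      rw [smul_eq_mul, hmul _ _ (hym _ hb), ihb, map_mul, mul_smul, hσ a]
  have hmem : ∀ c : R, c • y ∈ g.domain → c ∈ maximalIdeal R := by
    intro c hc
    by_contra h
    have hu : IsUnit c := by simpa using h
    obtain ⟨v, hv⟩ := hu.exists_left_inv
    apply hyM
    have := g.domain.smul_mem v hc
    rwa [smul_smul, hv, one_smul] at this
  let k : E →ₛₗ.[σ] E := LinearPMap.mkSpanSingleton' y t (by
    intro c hc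
    have hc0 : c • y ∈ g.domain := by rw [hc]; exact zero_mem _
    rw [← hall c (hmem c hc0), he c hc0]
    have hz : (⟨c • y, hc0⟩ : g.domain) = 0 := Subtype.ext hc
    rw [hz]
    exact g.toFun.map_zero)
  have hcompat : ∀ (x : g.domain) (z : k.domain), (x : E) = z → g x = k z := by
    rintro ⟨x, hx⟩ ⟨z, hz⟩ h
    simp only at h
    subst h
    obtain ⟨c, rfl⟩ := Submodule.mem_span_singleton.1 hz
    rw [LinearPMap.mkSpanSingleton'_apply, ← hall c (hmem c hx), he c hx]
  have hle := hg (LinearPMap.left_le_sup g k hcompat)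
  apply hyM
  apply hle.1
  rw [LinearPMap.domain_sup]
  exact Submodule.mem_sup_right (Submodule.mem_span_singleton_self y)

end hull

lemma iter_smul {R : Type*} [CommRing R] {E : Type*} [AddCommGroup E] [Module R E] {p : ℕ}
    (φ : FrobeniusMap R E p) (e : ℕ) (r : R) (x : E) :
    φ.toFun^[e] (r • x) = r ^ p ^ e • φ.toFun^[e] x := by
  induction e generalizing r x with
  | zero => simp
  | succ e ih =>
    rw [Function.iterate_succ_apply, φ.map_smul', ih, Function.iterate_succ_apply, ← pow_mul,
      pow_succ']

theorem key {R : Type*} [CommRing R] [IsLocalRing R] [IsNoetherianRing R]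
    (p : ℕ) [Fact p.Prime] [CharP R p] (hreg : IsRegularLocal R)
    (E : Type*) [AddCommGroup E] [Module R E] (hB : Module.Baer R E)
    (hE : IsInjectiveHullOfResidueField R E)
    (φ : FrobeniusMap R E p) (hφ : IsNaturalFrobenius p E φ) (e : ℕ) (he : 1 ≤ e) (x : E) (v : R)
    (hv : v • φ.toFun^[e] x = 0) :
    v ∈ Ideal.frobPow (p ^ e) (LinearMap.ker (LinearMap.toSpanSingleton R E x)) := by
  by_contra hnot
  obtain ⟨y, hy1, hy2⟩ := cogen hB hE _ v hnot
  obtain ⟨n, xs, hxs, hdim⟩ := hreg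
  have hrange : Set.range xs = {r | r ∈ List.ofFn xs} := by ext; simp
  have hreg' : RegMod (⊥ : Ideal R) (List.ofFn xs) := by
    apply regMod_of
    · rw [bot_sup_eq, hxs, hrange]
    · rw [ringKrullDim_eq_of_ringEquiv (RingEquiv.quotientBot R), hdim]; simp
  have hco : Coreg (List.ofFn xs) (⊤ : Submodule R E) := by
    convert coreg_of_regMod hB _ _ hreg'
    symm
    rw [eq_top_iff]
    rintro z - a ha
    rw [Ideal.mem_bot.1 ha, zero_smul]
  let σ := iterateFrobenius R p e
  have hσ : ∀ r, σ r = r ^ p ^ e := fun r => iterateFrobenius_def p e r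
  obtain ⟨g, hg, hgt⟩ := extend hE σ (p ^ e) hσ _ (hxs.trans (by rw [hrange])) hco
    (LinearPMap.mkSpanSingleton' x y (by
      intro c hc
      rw [hσ]
      exact hy1 _ (Ideal.subset_span ⟨c, hc, rfl⟩)))
  have hmt : ∀ z, z ∈ g.domain := fun z => by rw [hgt]; exact Submodule.mem_top
  let θ : FrobeniusMap R E (p ^ e) :=
    { toFun := fun z => g.toFun ⟨z, hmt z⟩
      map_add' := fun a b => g.toFun.map_add ⟨a, hmt a⟩ ⟨b, hmt b⟩
      map_smul' := fun r a => by
        rw [← hσ]; exact g.toFun.map_smulₛₗ r ⟨a, hmt a⟩ }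
  obtain ⟨w, hw, -⟩ := hφ e he θ
  have h1 : θ.toFun x = y := by
    refine Eq.trans (hg.2 (x := ⟨x, Submodule.mem_span_singleton_self x⟩) (y := ⟨x, hmt x⟩) rfl).symm ?_
    exact LinearPMap.mkSpanSingleton'_apply_self _ _ _ _
  apply hy2
  rw [← h1, hw, smul_comm, hv, smul_zero]

end Stmt4Aux
namespace Stmt4Aux

lemma chain_artinian {A : Type*} [CommRing A] [IsNoetherianRing A] (C : Ideal A)
    [IsArtinianRing (A ⧸ C)] (K : ℕ → Ideal A) (hK : Antitone K)
    (hC : ∀ j, C * K 0 ≤ K j) : ∃ j, K j ≤ K (j + 1) := by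
  let Y := ↥(K 0) ⧸ (C • ⊤ : Submodule A ↥(K 0))
  have : Module.Finite A Y := inferInstance
  have : Module.Finite (A ⧸ C) Y := Module.Finite.of_restrictScalars_finite A (A ⧸ C) Y
  have h1 : IsArtinian (A ⧸ C) Y := inferInstance
  have h2 : IsArtinian A Y := by
    refine (LinearMap.isArtinian_iff_of_bijective (σ := Ideal.Quotient.mk C)
      (⟨⟨id, fun _ _ => rfl⟩, fun _ _ => rfl⟩ : Y →ₛₗ[Ideal.Quotient.mk C] Y)
      Function.bijective_id).2 h1
  let f : ℕ →o (Submodule A Y)ᵒᵈ :=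
    ⟨fun j => OrderDual.toDual (Submodule.map (Submodule.mkQ _) (Submodule.comap (K 0).subtype (K j))), by
      intro i j hij
      exact Submodule.map_mono (Submodule.comap_mono (hK hij))⟩
  obtain ⟨n, hn⟩ := IsArtinian.monotone_stabilizes f
  refine ⟨n, fun a ha => ?_⟩
  have h := hn (n+1) (by omega)
  have ha0 : a ∈ K 0 := hK (Nat.zero_le n) ha
  have hm : Submodule.Quotient.mk (p := (C • ⊤ : Submodule A ↥(K 0))) ⟨a, ha0⟩ ∈
      Submodule.map (Submodule.mkQ (C • ⊤ : Submodule A ↥(K 0)))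
        (Submodule.comap (K 0).subtype (K n)) := ⟨⟨a, ha0⟩, ha, rfl⟩
  have h' : Submodule.map (Submodule.mkQ (C • ⊤ : Submodule A ↥(K 0)))
        (Submodule.comap (K 0).subtype (K n)) = Submodule.map (Submodule.mkQ (C • ⊤ : Submodule A ↥(K 0)))
        (Submodule.comap (K 0).subtype (K (n+1))) := h
  rw [h'] at hm
  obtain ⟨⟨b, hb0⟩, hb, hab⟩ := hm
  have hab' := (Submodule.Quotient.eq _).1 hab
  have h4 : b - a ∈ Submodule.map (K 0).subtype (C • ⊤ : Submodule A ↥(K 0)) := ⟨_, hab', rfl⟩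
  rw [Submodule.map_smul'', Submodule.map_top, Submodule.range_subtype] at h4
  have h5 : b - a ∈ K (n+1) := hC (n+1) h4
  have h6 : b ∈ K (n+1) := hb
  have := sub_mem h6 h5
  simpa using this

lemma loc_step {R : Type*} [CommRing R] [IsNoetherianRing R] (C : Ideal R) (hCt : C ≠ ⊤)
    (J : ℕ → Ideal R) (hJ : Antitone J) (hC : ∀ j, C * J 0 ≤ J j) :
    ∃ P : Ideal R, P.IsPrime ∧ C ≤ P ∧ ∃ j, ∃ s ∉ P, ∀ a ∈ J j, s * a ∈ J (j + 1) := by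
  obtain ⟨P, hP⟩ := Ideal.nonempty_minimalPrimes hCt
  have hPp : P.IsPrime := hP.1.1
  refine ⟨P, hPp, hP.1.2, ?_⟩
  let A := Localization.AtPrime P
  have : IsNoetherianRing A := IsLocalization.isNoetherianRing P.primeCompl A inferInstance
  have hmin : maximalIdeal A ∈ (C.map (algebraMap R A)).minimalPrimes := by
    rw [IsLocalization.minimalPrimes_map P.primeCompl A]
    change Ideal.under R (maximalIdeal (Localization.AtPrime P)) ∈ C.minimalPrimes
    rw [Localization.AtPrime.under_maximalIdeal]
    exact hP
  have := IsLocalRing.quotient_artinian_of_mem_minimalPrimes_of_isLocalRing _ hmin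
  obtain ⟨j, hj⟩ := chain_artinian (C.map (algebraMap R A)) (fun j => (J j).map (algebraMap R A))
    (fun i j hij => Ideal.map_mono (hJ hij)) (fun j => by
      rw [← Ideal.map_mul]; exact Ideal.map_mono (hC j))
  refine ⟨j, ?_⟩
  have hfg : (J j).FG := IsNoetherian.noetherian _
  obtain ⟨S, hS⟩ := hfg
  have hel : ∀ a ∈ J j, ∃ s : R, s ∉ P ∧ s * a ∈ J (j + 1) := by
    intro a ha
    have h1 := hj (Ideal.mem_map_of_mem _ ha)
    rw [← IsLocalization.mk'_one (M := P.primeCompl),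
      IsLocalization.mk'_mem_map_algebraMap_iff] at h1
    obtain ⟨s, hs, h⟩ := h1
    exact ⟨s, hs, h⟩
  choose! t ht1 ht2 using hel
  refine ⟨∏ a ∈ S, t a, ?_, ?_⟩
  · intro h
    obtain ⟨a, ha, h2⟩ := hPp.prod_mem_iff.1 h
    exact ht1 a (hS ▸ Submodule.subset_span ha) h2
  · intro a ha
    rw [← hS] at ha
    induction ha using Submodule.span_induction with
    | mem x hx =>
      obtain ⟨c, hc⟩ := Finset.dvd_prod_of_mem t hx
      rw [hc, mul_right_comm]
      exact Ideal.mul_mem_right _ _ (ht2 x (hS ▸ Submodule.subset_span hx))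
    | zero => simp
    | add x y _ _ hx hy => rw [mul_add]; exact add_mem hx hy
    | smul r x _ hx => rw [smul_eq_mul, mul_left_comm]; exact Ideal.mul_mem_left _ _ hx

/-- Hartshorne, Speiser and Lyubeznik, ideal form. -/
lemma hsl {R : Type*} [CommRing R] [IsNoetherianRing R] {E : Type*} [AddCommGroup E] [Module R E]
    (p : ℕ) (hp : 2 ≤ p) (T : E → E) (hT : ∀ (b : R) x, T (b • x) = b ^ p • T x)
    (J : ℕ → Ideal R) (hJ : Antitone J)
    (hdbl : ∀ i v, (∀ x : E, (∀ a ∈ J i, a • x = 0) → v • x = 0) → v ∈ J i)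
    (hdown : ∀ i x, x ∈ annIn (J (i+1)) E → T x ∈ annIn (J i) E)
    (hup : ∀ i j x, x ∈ annIn (J j) E → T x ∈ annIn (J i) E → x ∈ annIn (J (i+1)) E) :
    ∃ i, J i = J (i + 1) := by
  let B : ℕ → Ideal R := fun i =>
    { carrier := {b | ∀ a ∈ J i, b * a ∈ J (i+1)}
      add_mem' := fun h1 h2 a ha => by rw [add_mul]; exact add_mem (h1 a ha) (h2 a ha)
      zero_mem' := fun a _ => by simp
      smul_mem' := fun c b h a ha => by
        rw [smul_eq_mul, mul_assoc]; exact Ideal.mul_mem_left _ _ (h a ha) }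
  have hB : ∀ i b, b ∈ B i ↔ ∀ x ∈ annIn (J (i+1)) E, b • x ∈ annIn (J i) E := by
    intro i b
    constructor
    · intro h x hx a ha
      rw [smul_smul, mul_comm]
      exact hx _ (h a ha)
    · intro h a ha
      apply hdbl
      intro x hx
      have := h x hx a ha
      rwa [smul_smul, mul_comm] at this
  have hmono : Monotone B := by
    refine monotone_nat_of_le_succ fun i b hb => ?_
    rw [hB] at hb ⊢
    intro x hx
    refine hup i (i+2) _ (Submodule.smul_mem _ _ hx) ?_
    rw [hT]
    have : b ^ p = b ^ (p - 1) * b := by rw [← pow_succ]; congr 1; omega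
    rw [this, mul_smul]
    exact Submodule.smul_mem _ _ (hb _ (hdown _ _ hx))
  obtain ⟨i0, hi0⟩ := monotone_stabilizes_iff_noetherian.2 (inferInstance : IsNoetherian R R)
    ⟨B, hmono⟩
  have hi0 : ∀ m, i0 ≤ m → B i0 = B m := hi0
  by_cases htop : B i0 = ⊤
  · refine ⟨i0, le_antisymm ?_ (hJ (Nat.le_succ _))⟩
    intro a ha
    have h1 : (1 : R) ∈ B i0 := by rw [htop]; trivial
    simpa using h1 a ha
  have hkey : ∀ b ∈ B i0, ∀ j, ∀ x ∈ annIn (J (i0 + 1 + j)) E, b • x ∈ annIn (J (i0 + 1)) E := by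
    intro b hb j
    induction j with
    | zero => intro x hx; exact Submodule.smul_mem _ _ hx
    | succ j ih =>
      intro x hx
      refine hup i0 _ _ (Submodule.smul_mem _ _ hx) ?_
      rw [hT]
      have : b ^ p = b ^ (p - 2) * (b * b) := by
        rw [← pow_two, ← pow_add]; congr 1; omega
      rw [this, mul_smul, mul_smul]
      exact Submodule.smul_mem _ _ ((hB _ _).1 hb _ (ih _ (hdown _ _ hx)))
  have hBB : ∀ j, (B i0 * B i0) * J i0 ≤ J (i0 + j) := by
    intro j
    have h2 : (B i0 * B i0) * J i0 ≤ J (i0 + 1 + j) := by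
      rw [Ideal.mul_le]
      intro c hc a ha
      apply hdbl
      intro x hx
      induction hc using Submodule.mul_induction_on' with
      | mem_mul_mem m hm n hn =>
        have := (hB _ _).1 hm _ (hkey n hn j x hx) a ha
        rw [smul_smul, smul_smul] at this
        convert this using 2
        ring
      | add y _ z _ hy hz => rw [add_mul, add_smul, hy, hz, add_zero]
    exact h2.trans (hJ (by omega))
  have hne : B i0 * B i0 ≠ ⊤ := fun h => htop (by
    rw [eq_top_iff, ← h]; exact Ideal.mul_le_right)
  obtain ⟨P, hP, hCP, j, s, hs, hsj⟩ := loc_step _ hne (fun j => J (i0 + j))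
    (fun a b hab => hJ (by omega)) (fun j => hBB j)
  exfalso
  apply hs
  have h1 : s ∈ B (i0 + j) := hsj
  rw [← hi0 _ (by omega)] at h1
  rcases hP.mul_le.1 hCP with h | h <;> exact h h1

end Stmt4Aux
namespace Stmt4Aux

lemma small_aux {R : Type*} [CommRing R] (p : ℕ) {E : Type*} [AddCommGroup E] [Module R E]
    (φ : FrobeniusMap R E p) (hφ : IsNaturalFrobenius p E φ) :
    Function.Injective (fun (c : R) (x : E) => c • φ.toFun x) := by
  intro a b hab
  let θ : FrobeniusMap R E (p ^ 1) :=
    { toFun := fun x => a • φ.toFun x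
      map_add' := fun x y => by rw [φ.map_add', smul_add]
      map_smul' := fun r x => by rw [φ.map_smul', pow_one, smul_comm] }
  obtain ⟨w, -, hw⟩ := hφ 1 le_rfl θ
  rw [hw a (fun x => rfl), hw b (fun x => congrFun hab x)]

lemma baer_aux.{u, v} {R : Type u} [CommRing R] [IsLocalRing R] (p : ℕ) {E : Type v}
    [AddCommGroup E] [Module R E] (hE : IsInjectiveHullOfResidueField R E)
    (φ : FrobeniusMap R E p) (hφ : IsNaturalFrobenius p E φ) : Module.Baer R E := by
  have : Small.{v} R := small_of_injective (small_aux p φ hφ)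
  exact Module.Baer.of_injective hE.1

lemma iter_kill {R : Type*} [CommRing R] {p : ℕ} {E : Type*} [AddCommGroup E] [Module R E]
    (φ : FrobeniusMap R E p) (e : ℕ) (L : Ideal R) (x : E) (hx : ∀ a ∈ L, a • x = 0) (r : R)
    (hr : r ∈ Ideal.frobPow (p ^ e) L) : r • φ.toFun^[e] x = 0 := by
  have h0 : ∀ k, φ.toFun^[k] 0 = 0 := by
    have h1 : φ.toFun 0 = 0 := by
      have := φ.map_add' 0 0
      simpa using this
    intro k
    induction k with
    | zero => rfl
    | succ k ih => rw [Function.iterate_succ_apply, h1, ih]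
  unfold Ideal.frobPow at hr
  induction hr using Submodule.span_induction with
  | mem z hz =>
    obtain ⟨a, ha, rfl⟩ := hz
    change a ^ p ^ e • _ = _
    rw [← iter_smul, hx a ha, h0]
  | zero => exact zero_smul _ _
  | add a b _ _ ha hb => rw [add_smul, ha, hb, add_zero]
  | smul a b _ hb => rw [smul_eq_mul, mul_smul, hb, smul_zero]

lemma iter_T {R : Type*} [CommRing R] {p : ℕ} {E : Type*} [AddCommGroup E] [Module R E]
    (φ : FrobeniusMap R E p) (u : R) (e : ℕ) (x : E) :
    (fun y => u • φ.toFun y)^[e] x = u ^ nuExp p e • φ.toFun^[e] x := by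
  induction e generalizing x with
  | zero => simp [nuExp]
  | succ e ih =>
    rw [Function.iterate_succ_apply, ih, iter_smul, Function.iterate_succ_apply, smul_smul,
      ← pow_add]
    congr 2
    rw [nuExp, nuExp, Finset.sum_range_succ]

end Stmt4Aux

open Stmt4Aux
theorem stmt4 {R : Type*} [CommRing R] [IsLocalRing R] [IsNoetherianRing R]
    (p : ℕ) [Fact p.Prime] [CharP R p]
    (hreg : IsRegularLocal R) (hcomp : IsAdicComplete (maximalIdeal R) R)
    (E : Type*) [AddCommGroup E] [Module R E]
    (hE : IsInjectiveHullOfResidueField R E)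
    (φ : FrobeniusMap R E p) (hφ : IsNaturalFrobenius p E φ)
    (I : Ideal R) (u : R) (hu : u ∈ Submodule.colon (Ideal.frobPow p I) I)
    (J : ℕ → Ideal R)
    (hJ : ∀ e, 1 ≤ e →
      IsLeast { L : Ideal R | I ≤ L ∧ u ^ nuExp p e ∈ Ideal.frobPow (p ^ e) L } (J e)) :
    (∃ α, 1 ≤ α ∧ J α = J (α + 1)) ∧
    (∀ α, 1 ≤ α → J α = J (α + 1) →
      { x : E | x ∈ annIn I E ∧ ∀ a ∈ J α, a • x = 0 } =
        { x : E | x ∈ annIn I E ∧ ∃ m, (fun y => u • φ.toFun y)^[m] x = 0 }) ∧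
    ((∃ x ∈ annIn I E, (∃ m, (fun y => u • φ.toFun y)^[m] x = 0) ∧ x ≠ 0) →
      ∀ η : ℕ,
        (IsLeast { α | 1 ≤ α ∧ J α = J (α + 1) } η ↔
          IsLeast { m : ℕ |
            ∀ x ∈ annIn I E, (∃ k, (fun y => u • φ.toFun y)^[k] x = 0) →
              (fun y => u • φ.toFun y)^[m] x = 0 } η)) := by
  have hB := baer_aux p hE φ hφ
  have hp2 : 2 ≤ p := (Fact.out : p.Prime).two_le
  obtain ⟨T, hTdef⟩ : ∃ T : E → E, T = fun y => u • φ.toFun y := ⟨_, rfl⟩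
  simp only [← hTdef]
  have hTi : ∀ e x, T^[e] x = u ^ nuExp p e • φ.toFun^[e] x := by
    rw [hTdef]; exact iter_T φ u
  have hTs : ∀ (b : R) x, T (b • x) = b ^ p • T x := by
    intro b x; rw [hTdef]; simp only; rw [φ.map_smul', smul_comm]
  have hT0 : T 0 = 0 := by
    have := hTs 0 0
    rwa [smul_zero, zero_pow (by omega), zero_smul] at this
  have hT0i : ∀ k, T^[k] 0 = 0 := fun k => Function.iterate_fixed hT0 k
  have hTI : ∀ x ∈ annIn I E, T x ∈ annIn I E := by
    intro x hx a ha
    have h1 : u * a ∈ Ideal.frobPow (p ^ 1) I := by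
      rw [pow_one]
      exact Submodule.mem_colon.1 hu a ha
    have h2 := iter_kill φ 1 I x hx _ h1
    rw [hTdef]
    simp only
    rw [smul_smul, mul_comm]
    exact h2
  have hTIk : ∀ k, ∀ x ∈ annIn I E, T^[k] x ∈ annIn I E := by
    intro k
    induction k with
    | zero => intro x hx; exact hx
    | succ k ih => intro x hx; rw [Function.iterate_succ_apply]; exact ih _ (hTI x hx)
  -- the main correspondence
  have hN : ∀ e, 1 ≤ e → ∀ x, x ∈ annIn (J e) E ↔ (x ∈ annIn I E ∧ T^[e] x = 0) := by
    intro e he x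
    obtain ⟨⟨h1, h2⟩, h3⟩ := hJ e he
    constructor
    · intro hx
      refine ⟨fun a ha => hx a (h1 ha), ?_⟩
      rw [hTi]
      exact iter_kill φ e _ x hx _ h2
    · rintro ⟨hI, hT⟩ a ha
      rw [hTi] at hT
      have hk := key p hreg E hB hE φ hφ e he x _ hT
      have h4 := @h3 (LinearMap.ker (LinearMap.toSpanSingleton R E x)) ⟨fun b hb => hI b hb, hk⟩
      exact h4 ha
  have hdbl : ∀ i v, (∀ x : E, (∀ a ∈ J i, a • x = 0) → v • x = 0) → v ∈ J i := by
    intro i v h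
    by_contra hv
    obtain ⟨y, hy1, hy2⟩ := cogen hB hE _ v hv
    exact hy2 (h y hy1)
  have hsucc : ∀ m x, T^[m] x = 0 → T^[m + 1] x = 0 := by
    intro m x hx
    rw [Function.iterate_succ_apply', hx, hT0]
  have hmono : ∀ m k x, m ≤ k → T^[m] x = 0 → T^[k] x = 0 := by
    intro m k x hmk hx
    obtain ⟨c, rfl⟩ := Nat.exists_eq_add_of_le' hmk
    rw [Function.iterate_add_apply, hx, hT0i]
  have hanti : ∀ e, 1 ≤ e → J (e + 1) ≤ J e := by
    intro e he a ha
    apply hdbl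
    intro x hx
    have h1 := (hN e he x).1 hx
    exact (hN (e+1) (by omega) x).2 ⟨h1.1, hsucc _ _ h1.2⟩ a ha
  -- stability criterion
  have hstab : ∀ α, 1 ≤ α → (J α = J (α + 1) ↔
      ∀ x ∈ annIn I E, (∃ k, T^[k] x = 0) → T^[α] x = 0) := by
    intro α hα
    constructor
    · intro h
      have hone : ∀ x ∈ annIn I E, T^[α + 1] x = 0 → T^[α] x = 0 := by
        intro x hx hx2
        have := (hN (α+1) (by omega) x).2 ⟨hx, hx2⟩
        rw [← h] at this
        exact ((hN α hα x).1 this).2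
      have hall : ∀ k, ∀ x ∈ annIn I E, T^[α + k] x = 0 → T^[α] x = 0 := by
        intro k
        induction k with
        | zero => intro x _ hx; exact hx
        | succ k ih =>
          intro x hx hx2
          apply ih x hx
          rw [Function.iterate_add_apply]
          apply hone _ (hTIk k x hx)
          rw [← Function.iterate_add_apply]
          convert hx2 using 2
          omega
      rintro x hx ⟨k, hk⟩
      exact hall k x hx (hmono k _ x (by omega) hk)
    · intro h
      refine le_antisymm ?_ (hanti α hα)
      intro a ha
      apply hdbl
      intro x hx
      have h1 := (hN (α+1) (by omega) x).1 hx
      exact (hN α hα x).2 ⟨h1.1, h x h1.1 ⟨_, h1.2⟩⟩ a ha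
  refine ⟨?_, ?_, ?_⟩
  · obtain ⟨i, hi⟩ := hsl (E := E) p hp2 T hTs (fun i => J (i + 1))
      (antitone_nat_of_succ_le fun i => hanti (i+1) (by omega))
      (fun i v h => hdbl (i+1) v h)
      (by
        intro i x hx
        have h1 := (hN (i+1+1) (by omega) x).1 hx
        refine (hN (i+1) (by omega) _).2 ⟨hTI x h1.1, ?_⟩
        rw [← Function.iterate_succ_apply]
        exact h1.2)
      (by
        intro i j x hx hx2
        have h1 := (hN (j+1) (by omega) x).1 hx
        have h2 := (hN (i+1) (by omega) _).1 hx2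
        refine (hN (i+1+1) (by omega) _).2 ⟨h1.1, ?_⟩
        rw [Function.iterate_succ_apply]
        exact h2.2)
    exact ⟨i + 1, by omega, hi⟩
  · intro α hα h
    ext x
    constructor
    · rintro ⟨h1, h2⟩
      exact ⟨h1, α, ((hN α hα x).1 h2).2⟩
    · rintro ⟨h1, h2⟩
      exact ⟨h1, (hN α hα x).2 ⟨h1, (hstab α hα).1 h x h1 h2⟩⟩
  · rintro ⟨x0, hx0, hn0, hne⟩ η
    have hset : {α | 1 ≤ α ∧ J α = J (α + 1)} =
        {m : ℕ | ∀ x ∈ annIn I E, (∃ k, T^[k] x = 0) → T^[m] x = 0} := by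
      ext α
      constructor
      · rintro ⟨h1, h2⟩
        exact (hstab α h1).1 h2
      · intro h
        have hα : 1 ≤ α := by
          rcases Nat.eq_zero_or_pos α with rfl | h0
          · exact absurd (h x0 hx0 hn0) hne
          · exact h0
        exact ⟨hα, (hstab α hα).2 h⟩
    rw [hset]
end

section
/- Let u ∈ R with uI ⊆ I^{[p]}, and for α ≥ 1 set L_α = (I^{[p^α]} :_R u^{ν_α}). If L_A = L_{A+1} for some A ≥ 1, then L_α = L_A for all α ≥ A, and moreover u L_A ⊆ L_A^{[p]} (so that, together with I ⊆ L_A, the ideal L_A is an E_S-ideal). -/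
open IsLocalRing

namespace FrobAux
open RingTheory.Sequence
open scoped Pointwise

/-- A list generating the maximal ideal with length at most the dimension. -/
def Reg (R : Type*) [CommRing R] [IsLocalRing R] (rs : List R) : Prop :=
  maximalIdeal R = Ideal.ofList rs ∧ (rs.length : WithBot ℕ∞) ≤ ringKrullDim R

lemma exchange {R : Type*} [CommRing R] [IsLocalRing R] (rs : List R) :
    ∀ x ∈ Ideal.ofList rs, x ∈ maximalIdeal R * Ideal.ofList rs ∨
      ∃ t : List R, t.length + 1 = rs.length ∧ Ideal.ofList (x :: t) = Ideal.ofList rs := by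
  induction rs with
  | nil => intro x hx; left; simp at hx; simp [hx]
  | cons y t ih =>
    intro x hx
    rw [Ideal.ofList_cons, Submodule.mem_sup] at hx
    obtain ⟨w, hw, z, hz, rfl⟩ := hx
    obtain ⟨a, rfl⟩ := Ideal.mem_span_singleton'.1 hw
    by_cases ha : IsUnit a
    · right
      refine ⟨t, rfl, ?_⟩
      rw [Ideal.ofList_cons, Ideal.ofList_cons]
      apply le_antisymm
      · refine sup_le ?_ le_sup_right
        rw [Ideal.span_singleton_le_iff_mem]
        exact add_mem (Ideal.mem_sup_left hw) (Ideal.mem_sup_right hz)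
      · refine sup_le ?_ le_sup_right
        rw [Ideal.span_singleton_le_iff_mem]
        obtain ⟨b, hb⟩ := ha.exists_left_inv
        have : b * (a * y + z) + (-b) * z = y := by linear_combination y * hb
        have h := add_mem (S := Ideal R) (a := b * (a * y + z)) (b := -b * z)
          (s := Ideal.span {a * y + z} ⊔ Ideal.ofList t) (Ideal.mem_sup_left (Ideal.mul_mem_left _ _ (Ideal.mem_span_singleton_self _)))
          (Ideal.mem_sup_right (Ideal.mul_mem_left _ _ hz))
        rwa [this] at h
    · have ha' : a ∈ maximalIdeal R := ha
      have hay : a * y ∈ maximalIdeal R * Ideal.ofList (y :: t) :=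
        Ideal.mul_mem_mul ha' (by rw [Ideal.ofList_cons]; exact Ideal.mem_sup_left (Ideal.mem_span_singleton_self _))
      rcases ih z hz with h | ⟨t', ht', h⟩
      · left
        refine add_mem hay (Ideal.mul_mono_right ?_ h)
        rw [Ideal.ofList_cons]; exact le_sup_right
      · right
        refine ⟨y :: t', by simp [ht'], ?_⟩
        rw [Ideal.ofList_cons, Ideal.ofList_cons, Ideal.ofList_cons, ← h, Ideal.ofList_cons]
        apply le_antisymm
        · refine sup_le ?_ (sup_le le_sup_left (le_sup_right.trans le_sup_right))
          rw [Ideal.span_singleton_le_iff_mem]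
          exact add_mem (Ideal.mem_sup_left hw)
            (Ideal.mem_sup_right (Ideal.mem_sup_left (Ideal.mem_span_singleton_self _)))
        · refine sup_le (le_sup_left.trans le_sup_right) (sup_le ?_ (le_sup_right.trans le_sup_right))
          rw [Ideal.span_singleton_le_iff_mem]
          have : (a * y + z) + (-a) * y = z := by ring
          have h := add_mem (S := Ideal R) (a := a * y + z) (b := -a * y)
            (s := Ideal.span {a * y + z} ⊔ (Ideal.span {y} ⊔ Ideal.ofList t')) (Ideal.mem_sup_left (Ideal.mem_span_singleton_self _))
            (Ideal.mem_sup_right (Ideal.mem_sup_left (Ideal.mul_mem_left _ _ (Ideal.mem_span_singleton_self _))))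
          rwa [this] at h

lemma local_quot {R : Type*} [CommRing R] [IsLocalRing R] {x : R} (hx : x ∈ maximalIdeal R) :
    IsLocalRing (R ⧸ Ideal.span {x}) := by
  have : Nontrivial (R ⧸ Ideal.span {x}) := Ideal.Quotient.nontrivial_iff.2 (by
    intro h
    rw [Ideal.span_singleton_eq_top] at h
    exact hx h)
  exact IsLocalRing.of_surjective' (Ideal.Quotient.mk _) Ideal.Quotient.mk_surjective

lemma Reg.quot {R : Type*} [CommRing R] [IsLocalRing R] [IsNoetherianRing R] {x : R} {rs : List R}
    (h : Reg R (x :: rs)) [IsLocalRing (R ⧸ Ideal.span {x})] :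
    Reg (R ⧸ Ideal.span {x}) (rs.map (Ideal.Quotient.mk (Ideal.span {x}))) := by
  obtain ⟨h1, h2⟩ := h
  have hx : x ∈ maximalIdeal R := by
    rw [h1, Ideal.ofList_cons]; exact Ideal.mem_sup_left (Ideal.mem_span_singleton_self _)
  constructor
  · have := IsLocalRing.map_maximalIdeal_of_surjective (Ideal.Quotient.mk (Ideal.span {x}))
      Ideal.Quotient.mk_surjective
    rw [← this, h1, Ideal.map_ofList, List.map_cons, Ideal.ofList_cons]
    simp
  · have h := ringKrullDim_le_ringKrullDim_quotSMulTop_succ hx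
    have e : Ideal.span {x} = x • (⊤ : Ideal R) := by simp [← Submodule.ideal_span_singleton_smul]
    rw [← e] at h
    have := h2.trans h
    simp only [List.length_cons, List.length_map, Nat.cast_add, Nat.cast_one] at this ⊢
    exact ENat.WithBot.add_le_add_one_right_iff.1 this

theorem Reg.isDomain : ∀ (n : ℕ) {R : Type*} [CommRing R] [IsLocalRing R] [IsNoetherianRing R]
    (rs : List R), rs.length = n → Reg R rs → IsDomain R := by
  intro n
  induction n with
  | zero =>
    intro R _ _ _ rs hn h
    rw [List.length_eq_zero_iff] at hn
    subst hn
    have := h.1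
    rw [Ideal.ofList_nil, ← isField_iff_maximalIdeal_eq] at this
    exact this.isDomain
  | succ n ih =>
    intro R _ _ _ rs hn h
    have hne : maximalIdeal R ≠ ⊥ := by
      intro hb
      have hf : IsField R := isField_iff_maximalIdeal_eq.2 hb
      have h2 := h.2
      rw [ringKrullDim_eq_zero_of_isField hf, hn] at h2
      have : n + 1 ≤ 0 := by exact_mod_cast h2
      omega
    have hsq : ¬ maximalIdeal R ≤ maximalIdeal R * maximalIdeal R := by
      intro hle
      exact hne (Submodule.eq_bot_of_le_smul_of_le_jacobson_bot (maximalIdeal R) (maximalIdeal R)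
        (IsNoetherian.noetherian _) hle (maximalIdeal_le_jacobson _))
    by_cases hmm : ∃ q ∈ minimalPrimes R, maximalIdeal R ≤ q
    · exfalso
      obtain ⟨q, hq, hle⟩ := hmm
      have hqp : q.IsPrime := hq.1.1
      have : maximalIdeal R = q := le_antisymm hle (le_maximalIdeal hqp.ne_top)
      have h0 : (maximalIdeal R).height = 0 := by
        rw [Ideal.height_eq_zero_iff]
        rw [this]; exact hq
      have h2 := h.2
      rw [← maximalIdeal_height_eq_ringKrullDim, h0, hn] at h2
      have : n + 1 ≤ 0 := by exact_mod_cast h2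
      omega
    · push Not at hmm
      have hfin := minimalPrimes.finite_of_isNoetherianRing R
      have hav : ¬ ((maximalIdeal R : Set R) ⊆
          ⋃ i ∈ ((insert (maximalIdeal R * maximalIdeal R) hfin.toFinset : Finset (Ideal R)) : Set (Ideal R)), (i : Set R)) := by
        rw [Ideal.subset_union_prime (f := fun i : Ideal R => i) (maximalIdeal R * maximalIdeal R)
          (maximalIdeal R * maximalIdeal R)]
        · rintro ⟨i, hi, hle⟩
          rw [Finset.mem_insert] at hi
          rcases hi with rfl | hi
          · exact hsq hle
          · exact hmm i (by simpa using hi) hle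
        · intro i hi hi1 _
          rw [Finset.mem_insert] at hi
          rcases hi with rfl | hi
          · exact absurd rfl hi1
          · have : i ∈ minimalPrimes R := by simpa using hi
            exact this.1.1
      obtain ⟨x, hx, hx'⟩ := Set.not_subset.1 hav
      simp only [Set.mem_iUnion, not_exists] at hx'
      have hx2 : x ∉ maximalIdeal R * maximalIdeal R := hx' _ (by simp)
      have hxq : ∀ q ∈ minimalPrimes R, x ∉ q := fun q hq => hx' q (by simp [hq])
      have hx1 : x ∈ Ideal.ofList rs := h.1 ▸ hx
      rcases exchange rs x hx1 with hc | ⟨t, ht, hxt⟩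
      · rw [← h.1] at hc; exact absurd hc hx2
      have hreg : Reg R (x :: t) := ⟨h.1.trans hxt.symm, by
        have := h.2
        rwa [← ht] at this⟩
      have := local_quot hx
      have hdom := ih _ (by simp; omega) hreg.quot
      have hpr : (Ideal.span {x}).IsPrime := (Ideal.Quotient.isDomain_iff_prime _).1 hdom
      obtain ⟨q, hq, hqx⟩ := Ideal.exists_minimalPrimes_le (I := ⊥) (J := Ideal.span {x}) bot_le
      have hqp : q.IsPrime := hq.1.1
      have hxnq : x ∉ q := hxq q hq
      have hq0 : q = ⊥ := by
        refine Submodule.eq_bot_of_le_smul_of_le_jacobson_bot (maximalIdeal R) q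
          (IsNoetherian.noetherian _) ?_ (maximalIdeal_le_jacobson _)
        intro y hy
        obtain ⟨a, rfl⟩ := Ideal.mem_span_singleton'.1 (hqx hy)
        have ha : a ∈ q := (hqp.mem_or_mem hy).resolve_right hxnq
        rw [mul_comm]
        exact Ideal.mul_mem_mul hx ha
      rw [hq0] at hqp
      exact (IsDomain.of_bot_isPrime R)

theorem Reg.isWeaklyRegular : ∀ (n : ℕ) {R : Type*} [CommRing R] [IsLocalRing R]
    [IsNoetherianRing R] (rs : List R), rs.length = n → Reg R rs → IsWeaklyRegular R rs := by
  intro n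
  induction n with
  | zero =>
    intro R _ _ _ rs hn h
    rw [List.length_eq_zero_iff] at hn
    subst hn
    exact .nil R R
  | succ n ih =>
    intro R _ _ _ rs hn h
    obtain ⟨x, t, rfl⟩ : ∃ x t, rs = x :: t := by
      cases rs with
      | nil => simp at hn
      | cons x t => exact ⟨x, t, rfl⟩
    have hx : x ∈ maximalIdeal R := by
      rw [h.1, Ideal.ofList_cons]; exact Ideal.mem_sup_left (Ideal.mem_span_singleton_self _)
    have hD := h.isDomain _ _ rfl
    have hx0 : x ≠ 0 := by
      rintro rfl
      have h1 := h.1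
      rw [Ideal.ofList_cons] at h1
      have hb : maximalIdeal R = Ideal.ofList t := by rw [h1]; simp
      have h3 := ringKrullDim_le_spanFinrank_maximalIdeal R
      have h4 : (maximalIdeal R).spanFinrank ≤ t.length := by
        rw [hb]
        refine (Submodule.spanFinrank_span_le_ncard_of_finite (List.finite_toSet t)).trans ?_
        classical
        have : {r | r ∈ t} = (t.toFinset : Set R) := by ext; simp
        rw [this, Set.ncard_coe_finset]
        exact List.toFinset_card_le t
      have h4' : ((maximalIdeal R).spanFinrank : WithBot ℕ∞) ≤ t.length := by exact_mod_cast h4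
      have h5 := h.2.trans (h3.trans h4')
      have h6 : t.length + 1 ≤ t.length := by exact_mod_cast h5
      omega
    have := local_quot hx
    have ih' := ih _ (by simpa using hn) h.quot
    have e : x • (⊤ : Ideal R) = Ideal.span {x} := by simp [← Submodule.ideal_span_singleton_smul]
    refine .cons ?_ ?_
    · exact fun y z hyz => mul_left_cancel₀ hx0 hyz
    · have e2 := isWeaklyRegular_map_algebraMap_iff (R := R) (S := R ⧸ Ideal.span {x})
        (M := R ⧸ Ideal.span {x}) t
      have h7 := e2.1 ih'
      exact ((Submodule.quotEquivOfEq _ _ e).isWeaklyRegular_congr t).2 h7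

end FrobAux
namespace FrobAux
open RingTheory.Sequence
open scoped Pointwise

lemma length_quot_pow {R N : Type*} [CommRing R] [AddCommGroup N] [Module R N] (x : R)
    (hx : IsSMulRegular N x) (a : ℕ) :
    Module.length R (QuotSMulTop (x ^ a) N) = a * Module.length R (QuotSMulTop x N) := by
  induction a with
  | zero =>
    have : Subsingleton (QuotSMulTop (x ^ 0) N) := by
      rw [Submodule.Quotient.subsingleton_iff]; simp
    simp
  | succ a ih =>
    have h1 : (x ^ a • (⊤ : Submodule R N)) ≤
        (x ^ (a + 1) • (⊤ : Submodule R N)).comap (x • LinearMap.id) := by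
      intro y hy
      obtain ⟨z, -, rfl⟩ := hy
      exact ⟨z, trivial, by simp [pow_succ', mul_smul]; exact smul_comm _ _ _⟩
    have h2 : (x ^ (a + 1) • (⊤ : Submodule R N)) ≤
        (x • (⊤ : Submodule R N)).comap LinearMap.id := by
      intro y hy
      obtain ⟨z, -, rfl⟩ := hy
      exact ⟨x ^ a • z, trivial, by simp [pow_succ', mul_smul]; exact smul_comm _ _ _⟩
    have := Module.length_eq_add_of_exact (Submodule.mapQ _ _ _ h1) (Submodule.mapQ _ _ _ h2) ?_ ?_ ?_
    · rw [this, ih]; push_cast; ring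
    · rw [← LinearMap.ker_eq_bot, LinearMap.ker_eq_bot']
      intro m hm
      obtain ⟨y, rfl⟩ := Submodule.Quotient.mk_surjective _ m
      rw [Submodule.mapQ_apply, Submodule.Quotient.mk_eq_zero] at hm
      obtain ⟨z, -, hz⟩ := hm
      rw [Submodule.Quotient.mk_eq_zero]
      refine ⟨z, trivial, ?_⟩
      apply hx
      simpa [pow_succ', mul_smul] using hz
    · intro m
      obtain ⟨y, rfl⟩ := Submodule.Quotient.mk_surjective _ m
      exact ⟨Submodule.Quotient.mk y, rfl⟩
    · intro m
      obtain ⟨y, rfl⟩ := Submodule.Quotient.mk_surjective _ m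
      rw [Submodule.mapQ_apply, Submodule.Quotient.mk_eq_zero]
      constructor
      · rintro ⟨z, -, hz⟩
        exact ⟨Submodule.Quotient.mk z, by rw [Submodule.mapQ_apply]; exact congrArg _ hz⟩
      · rintro ⟨m, hm⟩
        obtain ⟨z, rfl⟩ := Submodule.Quotient.mk_surjective _ m
        rw [Submodule.mapQ_apply, Submodule.Quotient.eq] at hm
        obtain ⟨w, -, hw⟩ := hm
        refine ⟨z - x ^ a • w, trivial, ?_⟩
        simp only [DistribSMul.toLinearMap_apply, LinearMap.smul_apply, LinearMap.id_apply] at hw ⊢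
        rw [smul_sub, smul_smul, ← pow_succ', hw]
        simp

theorem length_pow {R : Type*} [CommRing R] [IsLocalRing R] (a : ℕ)
    (rs : List R) (hrs : ∀ r ∈ rs, r ∈ maximalIdeal R) (ha : a ≠ 0) :
    ∀ (M : Type _) [AddCommGroup M] [Module R M] [IsNoetherian R M], IsWeaklyRegular M rs →
    IsWeaklyRegular M (rs.map (· ^ a)) ∧
    Module.length R (M ⧸ (Ideal.ofList (rs.map (· ^ a)) • ⊤ : Submodule R M)) =
      a ^ rs.length * Module.length R (M ⧸ (Ideal.ofList rs • ⊤ : Submodule R M)) := by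
  induction rs with
  | nil => intro M _ _ _ h; exact ⟨h, by rw [List.map_nil, List.length_nil, pow_zero, one_mul]⟩
  | cons x t ih =>
    intro M _ _ _ h
    rw [isWeaklyRegular_cons_iff] at h
    obtain ⟨i1, i2⟩ := ih (fun r hr => hrs r (by simp [hr])) (QuotSMulTop x M) h.2
    have hmem : ∀ r ∈ t.map (· ^ a), r ∈ maximalIdeal R := by
      intro r hr
      simp only [List.mem_map] at hr
      obtain ⟨s, hs, rfl⟩ := hr
      exact Ideal.pow_mem_of_mem _ (hrs s (by simp [hs])) _ (Nat.pos_of_ne_zero ha)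
    have h1 : IsWeaklyRegular M (x :: t.map (· ^ a)) := .cons h.1 i1
    have hxm : x ∈ maximalIdeal R := hrs x (by simp)
    have h2 : IsWeaklyRegular M (t.map (· ^ a) ++ [x]) :=
      IsLocalRing.isWeaklyRegular_of_perm_of_subset_maximalIdeal h1
        (List.perm_append_singleton _ _).symm (by
          intro r hr
          rcases List.mem_cons.1 hr with rfl | hr
          · exact hxm
          · exact hmem r hr)
    rw [isWeaklyRegular_append_iff, isWeaklyRegular_singleton_iff] at h2
    have h3 : IsWeaklyRegular M (t.map (· ^ a) ++ [x ^ a]) := by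
      rw [isWeaklyRegular_append_iff, isWeaklyRegular_singleton_iff]
      exact ⟨h2.1, h2.2.pow a⟩
    have h4 : IsWeaklyRegular M (x ^ a :: t.map (· ^ a)) :=
      IsLocalRing.isWeaklyRegular_of_perm_of_subset_maximalIdeal h3
        (List.perm_append_singleton _ _) (by
          intro r hr
          rcases List.mem_append.1 hr with hr | hr
          · exact hmem r hr
          · rw [List.mem_singleton] at hr
            subst hr
            exact Ideal.pow_mem_of_mem _ hxm _ (Nat.pos_of_ne_zero ha))
    refine ⟨h4, ?_⟩
    rw [List.map_cons,
      (Submodule.quotOfListConsSMulTopEquivQuotSMulTopOuter M (x ^ a) (t.map (· ^ a))).length_eq,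
      length_quot_pow _ h2.2,
      ← (Submodule.quotOfListConsSMulTopEquivQuotSMulTopOuter M x (t.map (· ^ a))).length_eq,
      (Submodule.quotOfListConsSMulTopEquivQuotSMulTopInner M x (t.map (· ^ a))).length_eq, i2,
      ← (Submodule.quotOfListConsSMulTopEquivQuotSMulTopInner M x t).length_eq, List.length_cons,
      pow_succ]
    ring

/-- The length of `R ⧸ A`. -/
noncomputable def lam {R : Type*} [CommRing R] (A : Ideal R) : ℕ∞ := Module.length R (R ⧸ A)

lemma lam_top {R : Type*} [CommRing R] : lam (⊤ : Ideal R) = 0 := by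
  unfold lam
  have : Subsingleton (R ⧸ (⊤ : Ideal R)) := Ideal.Quotient.subsingleton_iff.2 rfl
  simp

lemma lam_anti {R : Type*} [CommRing R] {A B : Ideal R} (h : A ≤ B) : lam B ≤ lam A :=
  Module.length_le_of_surjective (Submodule.factor h) (Submodule.factor_surjective h)

lemma eq_of_lam_le {R : Type*} [CommRing R] {A B : Ideal R} (h : A ≤ B) (hf : lam A ≠ ⊤)
    (hl : lam A ≤ lam B) : A = B := by
  have hfl : IsFiniteLength R (R ⧸ A) := Module.length_ne_top_iff.1 hf
  have e := Module.length_eq_add_of_exact (LinearMap.ker (Submodule.factor h)).subtype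
    (Submodule.factor h) (Submodule.subtype_injective _) (Submodule.factor_surjective h)
    (LinearMap.exact_subtype_ker_map _)
  unfold lam at hf hl
  have hB : Module.length R (R ⧸ B) ≠ ⊤ := ne_top_of_le_ne_top hf (lam_anti h)
  have h0 : Module.length R (LinearMap.ker (Submodule.factor h)) = 0 := by
    rw [e] at hl
    rw [add_comm] at hl
    have : Module.length R (R ⧸ B) + Module.length R (LinearMap.ker (Submodule.factor h))
      ≤ Module.length R (R ⧸ B) + 0 := by simpa using hl
    exact le_antisymm ((ENat.add_le_add_iff_left hB).1 this) bot_le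
  rw [Module.length_eq_zero_iff, Submodule.subsingleton_iff_eq_bot] at h0
  refine le_antisymm h fun b hb => ?_
  have : (Submodule.Quotient.mk b : R ⧸ A) ∈ LinearMap.ker (Submodule.factor h) := by
    rw [LinearMap.mem_ker]
    exact (Submodule.Quotient.mk_eq_zero B).2 hb
  rw [h0, Submodule.mem_bot, Submodule.Quotient.mk_eq_zero] at this
  exact this

lemma lam_add {R : Type*} [CommRing R] (A : Ideal R) (b : R) :
    lam A = lam (Submodule.colon A {b}) + lam (A ⊔ Ideal.span {b}) := by
  have h1 : (Submodule.colon A {b} : Submodule R R) ≤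
      Submodule.comap (LinearMap.mulRight R b) (A : Submodule R R) := by
    intro y hy
    rw [Submodule.mem_colon_singleton] at hy
    simpa using hy
  have h2 : A ≤ A ⊔ Ideal.span {b} := le_sup_left
  refine Module.length_eq_add_of_exact (Submodule.mapQ _ _ _ h1) (Submodule.factor h2) ?_
    (Submodule.factor_surjective h2) ?_
  · rw [← LinearMap.ker_eq_bot, LinearMap.ker_eq_bot']
    intro m hm
    obtain ⟨y, rfl⟩ := Submodule.Quotient.mk_surjective _ m
    rw [Submodule.mapQ_apply, Submodule.Quotient.mk_eq_zero] at hm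
    rw [Submodule.Quotient.mk_eq_zero, Submodule.mem_colon_singleton]
    simpa using hm
  · intro m
    obtain ⟨y, rfl⟩ := Submodule.Quotient.mk_surjective _ m
    have : Submodule.factor h2 (Submodule.Quotient.mk y) = Submodule.Quotient.mk y := rfl
    rw [this, Submodule.Quotient.mk_eq_zero]
    constructor
    · intro hy
      obtain ⟨a, ha, w, hw, rfl⟩ := Submodule.mem_sup.1 hy
      obtain ⟨c, rfl⟩ := Ideal.mem_span_singleton'.1 hw
      refine ⟨Submodule.Quotient.mk c, ?_⟩
      rw [Submodule.mapQ_apply, Submodule.Quotient.eq]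
      simpa using ha
    · rintro ⟨m, hm⟩
      obtain ⟨z, rfl⟩ := Submodule.Quotient.mk_surjective _ m
      rw [Submodule.mapQ_apply, Submodule.Quotient.eq] at hm
      have : y = -(z * b - y) + z * b := by ring
      rw [this]
      exact add_mem (Ideal.mem_sup_left (neg_mem hm))
        (Ideal.mem_sup_right (Ideal.mul_mem_left _ _ (Ideal.mem_span_singleton_self _)))

lemma lam_max {R : Type*} [CommRing R] [IsLocalRing R] : lam (maximalIdeal R) = 1 := by
  unfold lam
  rw [Module.length_eq_one_iff]
  exact isSimpleModule_iff_isCoatom.2 (maximalIdeal.isMaximal R).out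

theorem lam_pow {R : Type*} [CommRing R] [IsLocalRing R] [IsNoetherianRing R] (rs : List R)
    (h : Reg R rs) (a : ℕ) (ha : a ≠ 0) :
    lam (Ideal.ofList (rs.map (· ^ a))) = (a : ℕ∞) ^ rs.length := by
  have h1 := h.isWeaklyRegular _ _ rfl
  have h2 := (length_pow a rs (fun r hr => by rw [h.1]; exact Ideal.subset_span hr) ha R h1).2
  rw [smul_eq_mul, smul_eq_mul, Ideal.mul_top, Ideal.mul_top, ← h.1] at h2
  have h3 := lam_max (R := R)
  unfold lam at h3 ⊢
  rw [h2, h3, mul_one]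

end FrobAux
namespace FrobAux

lemma frobPow_eq_map {R : Type*} [CommRing R] (p : ℕ) [Fact p.Prime] [CharP R p] (e : ℕ)
    (A : Ideal R) : Ideal.frobPow (p ^ e) A = Ideal.map (iterateFrobenius R p e) A := rfl

lemma frobPow_eq_map_one {R : Type*} [CommRing R] (p : ℕ) [Fact p.Prime] [CharP R p]
    (A : Ideal R) : Ideal.frobPow p A = Ideal.map (frobenius R p) A := rfl

lemma frobPow_succ {R : Type*} [CommRing R] (p : ℕ) [Fact p.Prime] [CharP R p] (e : ℕ)
    (A : Ideal R) : Ideal.frobPow (p ^ (e + 1)) A = Ideal.frobPow p (Ideal.frobPow (p ^ e) A) := by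
  rw [frobPow_eq_map, frobPow_eq_map, frobPow_eq_map_one, Ideal.map_map]
  congr 1
  ext x
  simp [iterateFrobenius_def, frobenius_def, pow_succ, pow_mul]

lemma map_sup_span {R : Type*} [CommRing R] (p : ℕ) [Fact p.Prime] [CharP R p]
    (A : Ideal R) (b : R) : Ideal.map (frobenius R p) (A ⊔ Ideal.span {b}) =
      Ideal.map (frobenius R p) A ⊔ Ideal.span {b ^ p} := by
  rw [Ideal.map_sup, Ideal.map_span, Set.image_singleton, frobenius_def]

lemma map_colon_le {R : Type*} [CommRing R] (p : ℕ) [Fact p.Prime] [CharP R p]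
    (A : Ideal R) (b : R) : Ideal.map (frobenius R p) (Submodule.colon A {b}) ≤
      Submodule.colon (Ideal.map (frobenius R p) A) {b ^ p} := by
  rw [Ideal.map_le_iff_le_comap]
  intro y hy
  rw [Submodule.mem_colon_singleton] at hy
  rw [Ideal.mem_comap, Submodule.mem_colon_singleton, smul_eq_mul, frobenius_def, ← mul_pow]
  exact Ideal.mem_map_of_mem (frobenius R p) hy

lemma exists_socle {R : Type*} [CommRing R] (m A B : Ideal R) (hAB : A < B) (k : ℕ)
    (hk : m ^ k ≤ A) : ∃ b ∈ B, b ∉ A ∧ ∀ y ∈ m, y * b ∈ A := by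
  classical
  have hex : ∃ j, m ^ j * B ≤ A := ⟨k, Ideal.mul_le_left.trans hk⟩
  have hs := Nat.find_spec hex
  have h0 : Nat.find hex ≠ 0 := by
    intro h0
    rw [h0, pow_zero, one_mul] at hs
    exact hAB.not_ge hs
  obtain ⟨j, hj⟩ := Nat.exists_eq_succ_of_ne_zero h0
  have hn := Nat.find_min hex (m := j) (by omega)
  obtain ⟨b, hb, hbA⟩ := SetLike.not_le_iff_exists.1 hn
  refine ⟨b, Ideal.mul_le_right hb, hbA, fun y hy => hs ?_⟩
  rw [hj, Nat.succ_eq_add_one, pow_succ', mul_assoc]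
  exact Ideal.mul_mem_mul hy hb

theorem claim2 {R : Type*} [CommRing R] [IsLocalRing R] [IsNoetherianRing R] (p : ℕ)
    [Fact p.Prime] [CharP R p] (B : Ideal R) (A : Ideal R) :
    A ≤ B → ∀ k : ℕ, maximalIdeal R ^ k ≤ A →
    lam (Ideal.map (frobenius R p) A) + lam (Ideal.map (frobenius R p) (maximalIdeal R)) * lam B ≤
    lam (Ideal.map (frobenius R p) (maximalIdeal R)) * lam A + lam (Ideal.map (frobenius R p) B) := by
  induction A using IsNoetherian.induction with
  | hgt A ih =>
    intro hAB k hk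
    rcases hAB.eq_or_lt with rfl | hlt
    · rw [add_comm]
    obtain ⟨b, hbB, hbA, hb⟩ := exists_socle (maximalIdeal R) A B hlt k hk
    have hcol : Submodule.colon A {b} = maximalIdeal R := by
      apply le_antisymm
      · apply le_maximalIdeal
        intro h
        have : (1 : R) ∈ Submodule.colon A {b} := h ▸ trivial
        rw [Submodule.mem_colon_singleton, one_smul] at this
        exact hbA this
      · intro y hy
        rw [Submodule.mem_colon_singleton]
        exact hb y hy
    have hlt' : A < A ⊔ Ideal.span {b} := by
      refine lt_of_le_of_ne le_sup_left fun h => hbA ?_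
      rw [h]
      exact Ideal.mem_sup_right (Ideal.mem_span_singleton_self _)
    have ih' := ih _ hlt' (sup_le hAB ((Ideal.span_singleton_le_iff_mem _).2 hbB)) k
      (hk.trans le_sup_left)
    have e1 := lam_add A b
    rw [hcol, lam_max] at e1
    have e2 := lam_add (Ideal.map (frobenius R p) A) (b ^ p)
    rw [← map_sup_span] at e2
    have e3 : lam (Submodule.colon (Ideal.map (frobenius R p) A) {b ^ p}) ≤
        lam (Ideal.map (frobenius R p) (maximalIdeal R)) := by
      apply lam_anti
      have := map_colon_le p A b
      rwa [hcol] at this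
    rw [e1, e2, mul_add, mul_one, add_assoc, add_assoc]
    exact add_le_add e3 ih'

lemma ofList_pow_le {R : Type*} [CommRing R] [IsLocalRing R] (rs : List R)
    (h : Reg R rs) (q : ℕ) : Ideal.ofList (rs.map (· ^ q)) ≤ maximalIdeal R ^ q := by
  refine Ideal.span_le.2 ?_
  intro r hr
  obtain ⟨s, hs, rfl⟩ := List.mem_map.1 hr
  refine Ideal.pow_mem_pow ?_ q
  rw [h.1]
  exact Ideal.subset_span hs

lemma pow_le_ofList {R : Type*} [CommRing R] (q : ℕ) (rs : List R) :
    ∃ k, Ideal.ofList rs ^ k ≤ Ideal.ofList (rs.map (· ^ q)) := by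
  apply Ideal.exists_pow_le_of_le_radical_of_fg
  · refine Ideal.span_le.2 fun r hr => ⟨q, Ideal.subset_span ?_⟩
    exact List.mem_map.2 ⟨r, hr, rfl⟩
  · exact ⟨(List.finite_toSet rs).toFinset, by simp [Ideal.ofList]⟩

theorem lam_map {R : Type*} [CommRing R] [IsLocalRing R] [IsNoetherianRing R] (p : ℕ)
    [Fact p.Prime] [CharP R p] (rs : List R) (h : Reg R rs) (A : Ideal R) (k : ℕ)
    (hk : maximalIdeal R ^ k ≤ A) :
    lam (Ideal.map (frobenius R p) A) = (p : ℕ∞) ^ rs.length * lam A ∧ lam A ≠ ⊤ := by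
  have hp : p ≠ 0 := (Fact.out : p.Prime).ne_zero
  have hmapL : ∀ a : ℕ, Ideal.map (frobenius R p) (Ideal.ofList (rs.map (· ^ a))) =
      Ideal.ofList (rs.map (· ^ (a * p))) := by
    intro a
    rw [Ideal.map_ofList, List.map_map]
    congr 1
    apply List.map_congr_left
    intro r _
    simp [frobenius_def, pow_mul]
  have hm : lam (Ideal.map (frobenius R p) (maximalIdeal R)) = (p : ℕ∞) ^ rs.length := by
    have := hmapL 1
    simp only [pow_one, List.map_id', one_mul] at this
    rw [h.1, this, lam_pow rs h p hp]
  set J := Ideal.ofList (rs.map (· ^ (k + 1))) with hJ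
  have hJA : J ≤ A := (ofList_pow_le rs h (k + 1)).trans ((Ideal.pow_le_pow_right (by omega)).trans hk)
  obtain ⟨l, hl⟩ := pow_le_ofList (k + 1) rs
  rw [← h.1] at hl
  have lJ : lam J = ((k + 1 : ℕ) : ℕ∞) ^ rs.length := lam_pow rs h (k + 1) (by omega)
  have lFJ : lam (Ideal.map (frobenius R p) J) = (p : ℕ∞) ^ rs.length * lam J := by
    rw [hJ, hmapL, lam_pow rs h _ (by positivity), ← hJ, lJ, ← mul_pow]
    push_cast
    rw [mul_comm]
  have lJt : lam J ≠ ⊤ := by rw [lJ]; exact_mod_cast ENat.natCast_ne_top _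
  have lAt : lam A ≠ ⊤ := ne_top_of_le_ne_top lJt (lam_anti hJA)
  refine ⟨le_antisymm ?_ ?_, lAt⟩
  · have := claim2 p ⊤ A le_top k hk
    rw [Ideal.map_top, lam_top, hm] at this
    simpa using this
  · have := claim2 p A J hJA l hl
    rw [hm, lFJ] at this
    refine (ENat.add_le_add_iff_left ?_).1 this
    rw [lJ]; exact_mod_cast ENat.natCast_ne_top _

theorem colon_primary {R : Type*} [CommRing R] [IsLocalRing R] [IsNoetherianRing R] (p : ℕ)
    [Fact p.Prime] [CharP R p] (rs : List R) (h : Reg R rs) (A : Ideal R) (b : R) (k : ℕ)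
    (hk : maximalIdeal R ^ k ≤ A) :
    Ideal.map (frobenius R p) (Submodule.colon A {b}) =
      Submodule.colon (Ideal.map (frobenius R p) A) {b ^ p} := by
  obtain ⟨h1, f1⟩ := lam_map p rs h A k hk
  obtain ⟨h2, f2⟩ := lam_map p rs h (A ⊔ Ideal.span {b}) k (hk.trans le_sup_left)
  obtain ⟨h3, f3⟩ := lam_map p rs h (Submodule.colon A {b}) k (hk.trans Ideal.le_colon)
  have hpt : (p : ℕ∞) ^ rs.length ≠ ⊤ := by exact_mod_cast ENat.natCast_ne_top _
  refine eq_of_lam_le (map_colon_le p A b) ?_ ?_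
  · rw [h3]; exact WithTop.mul_ne_top hpt f3
  · have e1 := lam_add A b
    have e2 := lam_add (Ideal.map (frobenius R p) A) (b ^ p)
    rw [← map_sup_span, h1, h2, e1, mul_add, ← h3] at e2
    exact (ENat.add_le_add_iff_right (WithTop.mul_ne_top hpt f2)).1 e2.le

lemma krull {R : Type*} [CommRing R] [IsLocalRing R] [IsNoetherianRing R] (A : Ideal R) (r : R)
    (h : ∀ k, r ∈ A ⊔ maximalIdeal R ^ k) : r ∈ A := by
  have h1 := Ideal.iInf_pow_smul_eq_bot_of_isLocalRing (M := R ⧸ A) (maximalIdeal R)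
    Ideal.IsPrime.ne_top'
  rw [← Submodule.Quotient.mk_eq_zero A, ← Submodule.mem_bot R, ← h1, Submodule.mem_iInf]
  intro k
  obtain ⟨a, ha, z, hz, rfl⟩ := Submodule.mem_sup.1 (h k)
  rw [Submodule.Quotient.mk_add, (Submodule.Quotient.mk_eq_zero A).2 ha, zero_add]
  have : (Submodule.Quotient.mk z : R ⧸ A) = z • Submodule.Quotient.mk 1 := by
    rw [← Submodule.Quotient.mk_smul, smul_eq_mul, mul_one]
  rw [this]
  exact Submodule.smul_mem_smul hz trivial

lemma artin_rees {R : Type*} [CommRing R] [IsNoetherianRing R] (m A : Ideal R) (b : R) :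
    ∃ c, ∀ k, Submodule.colon (A ⊔ m ^ (k + c)) {b} ≤ Submodule.colon A {b} ⊔ m ^ k := by
  obtain ⟨c, hc⟩ := Ideal.exists_pow_inf_eq_pow_smul (M := R ⧸ A) m
    (Submodule.span R {(Submodule.Quotient.mk b : R ⧸ A)})
  refine ⟨c, fun k y hy => ?_⟩
  rw [Submodule.mem_colon_singleton] at hy
  have h1 : (Submodule.Quotient.mk (y • b) : R ⧸ A) ∈
      m ^ (k + c) • ⊤ ⊓ (Submodule.span R {(Submodule.Quotient.mk b : R ⧸ A)}) := by
    refine ⟨?_, ?_⟩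
    · obtain ⟨a, ha, z, hz, e⟩ := Submodule.mem_sup.1 hy
      rw [← e, Submodule.Quotient.mk_add, (Submodule.Quotient.mk_eq_zero A).2 ha, zero_add]
      have : (Submodule.Quotient.mk z : R ⧸ A) = z • Submodule.Quotient.mk 1 := by
        rw [← Submodule.Quotient.mk_smul, smul_eq_mul, mul_one]
      rw [this]
      exact Submodule.smul_mem_smul hz trivial
    · rw [Submodule.Quotient.mk_smul]
      exact Submodule.smul_mem _ _ (Submodule.mem_span_singleton_self _)
  rw [hc _ (by omega), Nat.add_sub_cancel] at h1
  have h2 := Submodule.smul_mono (le_refl (m ^ k)) inf_le_right h1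
  obtain ⟨z, hz, e⟩ := Submodule.mem_smul_span_singleton.1 h2
  rw [← Submodule.Quotient.mk_smul, Submodule.Quotient.eq] at e
  have : y = -(z - y) + z := by ring
  rw [this]
  refine add_mem (Ideal.mem_sup_left (neg_mem ?_)) (Ideal.mem_sup_right hz)
  rw [Submodule.mem_colon_singleton, sub_smul]
  exact e

theorem colon_map {R : Type*} [CommRing R] [IsLocalRing R] [IsNoetherianRing R] (p : ℕ)
    [Fact p.Prime] [CharP R p] (rs : List R) (h : Reg R rs) (A : Ideal R) (b : R) :
    Ideal.map (frobenius R p) (Submodule.colon A {b}) =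
      Submodule.colon (Ideal.map (frobenius R p) A) {b ^ p} := by
  refine le_antisymm (map_colon_le p A b) fun r hr => krull _ _ fun k => ?_
  obtain ⟨c, hc⟩ := artin_rees (maximalIdeal R) A b
  have h1 : r ∈ Submodule.colon
      (Ideal.map (frobenius R p) (A ⊔ maximalIdeal R ^ (k + c))) {b ^ p} :=
    Submodule.colon_mono (Ideal.map_mono le_sup_left) subset_rfl hr
  rw [← colon_primary p rs h _ b (k + c) le_sup_right] at h1
  have h2 := Ideal.map_mono (f := frobenius R p) (hc k) h1
  rw [Ideal.map_sup] at h2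
  have h3 : Ideal.map (frobenius R p) (maximalIdeal R ^ k) ≤ maximalIdeal R ^ k := ?_
  · exact (sup_le_sup_left h3 _) h2
  rw [Ideal.map_le_iff_le_comap]
  intro y hy
  rw [Ideal.mem_comap, frobenius_def]
  exact Ideal.pow_mem_of_mem _ hy _ (Fact.out : p.Prime).pos

end FrobAux

/-- Let `(R,m)` be a complete regular local ring of characteristic `p`,
`I ⊆ R` an ideal and `u ∈ R` with `u I ⊆ I^{[p]}`; set `L_α = (I^{[p^α]} :_R u^{ν_α})`.
If `L_A = L_{A+1}` for some `A ≥ 1`, then `L_α = L_A` for all `α ≥ A`, and moreover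
`u L_A ⊆ L_A^{[p]}` and `I ⊆ L_A` (so `L_A` is an `E_S`-ideal). -/
theorem stmt6 {R : Type*} [CommRing R] [IsLocalRing R] [IsNoetherianRing R]
    (p : ℕ) [Fact p.Prime] [CharP R p]
    (hreg : IsRegularLocal R) (hcomp : IsAdicComplete (maximalIdeal R) R)
    (I : Ideal R) (u : R) (hu : ∀ a ∈ I, u * a ∈ Ideal.frobPow p I)
    (L : ℕ → Ideal R)
    (hL : ∀ α, L α = Submodule.colon (Ideal.frobPow (p ^ α) I) (Ideal.span {u ^ nuExp p α}))
    (A : ℕ) (hA : 1 ≤ A) (hstab : L A = L (A + 1)) :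
    (∀ α, A ≤ α → L α = L A) ∧
    (∀ a ∈ L A, u * a ∈ Ideal.frobPow p (L A)) ∧ I ≤ L A := by
  obtain ⟨n, x, hx, hdim⟩ := hreg
  have hR : FrobAux.Reg R (List.ofFn x) := by
    refine ⟨?_, by simp [hdim]⟩
    rw [hx]
    unfold Ideal.ofList
    congr 1
    ext y
    simp [List.mem_ofFn]
  have hL' : ∀ α, L α = Submodule.colon (Ideal.frobPow (p ^ α) I) {u ^ nuExp p α} := by
    intro α; rw [hL, Ideal.colon_span]
  have hmemL : ∀ α y, y ∈ L α ↔ y * u ^ nuExp p α ∈ Ideal.frobPow (p ^ α) I := by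
    intro α y
    rw [hL', Submodule.mem_colon_singleton, smul_eq_mul]
  have hnu : ∀ α, nuExp p (α + 1) = 1 + nuExp p α * p := by
    intro α
    unfold nuExp
    rw [Finset.sum_range_succ', pow_zero, add_comm, Finset.sum_mul]
    simp [pow_succ]
  -- the recursion `L (α + 1) = ((L α)^{[p]} : u)`
  have hrec : ∀ α y, y ∈ L (α + 1) ↔ y * u ∈ Ideal.frobPow p (L α) := by
    intro α y
    rw [hmemL, hnu, FrobAux.frobPow_succ, FrobAux.frobPow_eq_map_one p (L α), hL',
      FrobAux.colon_map p _ hR, Submodule.mem_colon_singleton, smul_eq_mul,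
      FrobAux.frobPow_eq_map_one, pow_add, pow_one, pow_mul, mul_assoc]
  have hI : ∀ α, I ≤ L α := by
    intro α
    induction α with
    | zero =>
      intro y hy
      rw [hmemL]
      apply Ideal.mul_mem_right
      exact Ideal.subset_span ⟨y, hy, by simp⟩
    | succ α ih =>
      intro y hy
      rw [hrec, mul_comm]
      have := hu y hy
      rw [FrobAux.frobPow_eq_map_one] at this ⊢
      exact Ideal.map_mono ih this
  refine ⟨?_, ?_, hI A⟩
  · intro α hα
    induction α, hα using Nat.le_induction with
    | base => rfl
    | succ α hα ih =>
      rw [hstab]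
      ext y
      rw [hrec, hrec, ih]
  · intro a ha
    rw [hstab, hrec] at ha
    rwa [mul_comm]
end

section
/- Let u ∈ R be such that Δ(E_S) = (R/I → R/I^{[p]}) is given by multiplication by u, for α ≥ 1 set L_α = (I^{[p^α]} :_R u^{ν_α}), and let L be the stable value of the ascending chain {L_α}_{α ≥ 1}. Then the quotient E_S/Ann_{E_S}(L) is nilpotent (annihilated by a power of T), and for any E_S-ideal K ⊆ R, the quotient E_S/Ann_{E_S}(K) is nilpotent if and only if K ⊆ L. -/
open IsLocalRing

section helpers
open TensorProduct
section flat
variable {R S : Type*} [CommRing R] [CommRing S] [Algebra R S]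

/-- multiplication map `S ⊗ J → S`. -/
noncomputable def muMap (S : Type*) [CommRing S] [Algebra R S] (J : Ideal R) :
    S ⊗[R] J →ₗ[S] S :=
  (TensorProduct.AlgebraTensorModule.rid R S S).toLinearMap ∘ₗ J.subtype.baseChange S

lemma muMap_tmul (J : Ideal R) (s : S) (x : J) : muMap S J (s ⊗ₜ x) = (x : R) • s := by
  simp [muMap]

lemma muMap_eq (J : Ideal R) (z : S ⊗[R] J) :
    muMap S J z = TensorProduct.AlgebraTensorModule.rid R S S (J.subtype.lTensor S z) := by
  rfl

lemma muMap_eq_zero_iff (J : Ideal R) (z : S ⊗[R] J) :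
    muMap S J z = 0 ↔ J.subtype.lTensor S z = 0 := by
  rw [muMap_eq, LinearEquiv.map_eq_zero_iff]

/-- Koszul-type lemma. -/
lemma koszul_aux (𝔪 : Ideal R) (l : List R) (hreg : RingTheory.Sequence.IsWeaklyRegular S l)
    (hl : ∀ a ∈ l, a ∈ 𝔪) (z : S ⊗[R] 𝔪)
    (hz : z ∈ Submodule.span S {t : S ⊗[R] 𝔪 | ∃ x : 𝔪, (x : R) ∈ Ideal.ofList l ∧
      t = 1 ⊗ₜ[R] x})
    (h0 : muMap S 𝔪 z = 0) : z = 0 := by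
  induction l using List.reverseRecOn generalizing z with
  | nil =>
    have : Submodule.span S {t : S ⊗[R] 𝔪 | ∃ x : 𝔪, (x : R) ∈ Ideal.ofList ([] : List R) ∧
        t = 1 ⊗ₜ[R] x} ≤ ⊥ := by
      rw [Submodule.span_le]
      rintro t ⟨x, hx, rfl⟩
      have : x = 0 := by ext; simpa using hx
      simp [this]
    exact this hz
  | append_singleton l a ih =>
    rw [RingTheory.Sequence.isWeaklyRegular_append_iff,
      RingTheory.Sequence.isWeaklyRegular_singleton_iff] at hreg
    obtain ⟨hreg, ha⟩ := hreg
    have ham : a ∈ 𝔪 := hl a (by simp)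
    have hl' : ∀ a ∈ l, a ∈ 𝔪 := fun b hb => hl b (by simp [hb])
    have hlm : Ideal.ofList l ≤ 𝔪 := Ideal.span_le.2 fun b hb => hl' b hb
    set W := Submodule.span S {t : S ⊗[R] 𝔪 | ∃ x : 𝔪, (x : R) ∈ Ideal.ofList l ∧
      t = 1 ⊗ₜ[R] x} with hW
    have key : ∀ x (hx : x ∈ Ideal.ofList l) (s : S), s ⊗ₜ[R] (⟨x, hlm hx⟩ : 𝔪) ∈ W := by
      intro x hx s
      have : s ⊗ₜ[R] (⟨x, hlm hx⟩ : 𝔪) = s • ((1 : S) ⊗ₜ[R] (⟨x, hlm hx⟩ : 𝔪)) := by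
        simp [TensorProduct.smul_tmul']
      rw [this]
      exact W.smul_mem _ (Submodule.subset_span ⟨_, hx, rfl⟩)
    have hWmu : ∀ z ∈ W, muMap S 𝔪 z ∈ (Ideal.ofList l • ⊤ : Submodule R S) := by
      intro z hz
      have : ∀ s : S, s • muMap S 𝔪 z ∈ (Ideal.ofList l • ⊤ : Submodule R S) := by
        induction hz using Submodule.span_induction with
        | mem t ht =>
          obtain ⟨x, hx, rfl⟩ := ht
          intro s
          rw [muMap_tmul, smul_comm]
          exact Submodule.smul_mem_smul hx trivial
        | zero => simp
        | add x y _ _ hx hy =>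
          intro s
          rw [map_add, smul_add]
          exact Submodule.add_mem _ (hx s) (hy s)
        | smul c x _ hx =>
          intro s
          rw [map_smul, smul_smul]
          exact hx _
      simpa using this 1
    have hdec : ∃ z1 ∈ W, ∃ s : S, z = z1 + s ⊗ₜ[R] (⟨a, ham⟩ : 𝔪) := by
      clear h0
      induction hz using Submodule.span_induction with
      | mem t ht =>
        obtain ⟨x, hx, rfl⟩ := ht
        rw [Ideal.ofList_append, Ideal.ofList_singleton, Submodule.mem_sup] at hx
        obtain ⟨y, hy, w, hw, hyw⟩ := hx
        obtain ⟨c, rfl⟩ := Ideal.mem_span_singleton'.1 hw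
        refine ⟨_, key y hy 1, c • 1, ?_⟩
        rw [TensorProduct.smul_tmul, ← TensorProduct.tmul_add]
        congr 1
        ext
        simp [← hyw]
      | zero => exact ⟨0, W.zero_mem, 0, by simp⟩
      | add x y _ _ hx hy =>
        obtain ⟨z1, h1, s1, rfl⟩ := hx
        obtain ⟨z2, h2, s2, rfl⟩ := hy
        exact ⟨z1 + z2, W.add_mem h1 h2, s1 + s2, by rw [TensorProduct.add_tmul]; abel⟩
      | smul c x _ hx =>
        obtain ⟨z1, h1, s1, rfl⟩ := hx
        exact ⟨c • z1, W.smul_mem _ h1, c * s1, by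
          rw [smul_add, TensorProduct.smul_tmul', smul_eq_mul]⟩
    obtain ⟨z1, hz1, s, rfl⟩ := hdec
    rw [map_add, muMap_tmul] at h0
    have hs : s ∈ (Ideal.ofList l • ⊤ : Submodule R S) := by
      refine mem_of_isSMulRegular_quotient_of_smul_mem ha ?_
      have : a • s = - muMap S 𝔪 z1 := by linear_combination h0
      rw [this]
      exact Submodule.neg_mem _ (hWmu _ hz1)
    have hs2 : s ⊗ₜ[R] (⟨a, ham⟩ : 𝔪) ∈ W := by
      refine Submodule.smul_induction_on hs ?_ ?_
      · intro r hr n _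
        have : (r • n) ⊗ₜ[R] (⟨a, ham⟩ : 𝔪) = (a • n) ⊗ₜ[R] (⟨r, hlm hr⟩ : 𝔪) := by
          rw [TensorProduct.smul_tmul, TensorProduct.smul_tmul]
          congr 1
          ext
          simp [mul_comm]
        rw [this]
        exact key r hr _
      · intro x y hx hy
        rw [TensorProduct.add_tmul]
        exact W.add_mem hx hy
    refine ih hreg hl' _ (W.add_mem hz1 hs2) ?_
    rw [map_add, muMap_tmul]; exact h0

lemma koszul_inj (l : List R) (hreg : RingTheory.Sequence.IsWeaklyRegular S l) :
    Function.Injective (muMap S (Ideal.ofList l)) := by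
  rw [injective_iff_map_eq_zero]
  intro z hz
  refine koszul_aux _ l hreg (fun a ha => Ideal.subset_span ha) z ?_ hz
  clear hz
  induction z with
  | zero => exact Submodule.zero_mem _
  | add x y hx hy => exact Submodule.add_mem _ hx hy
  | tmul s x =>
    have : s ⊗ₜ[R] x = s • ((1 : S) ⊗ₜ[R] x) := by simp [TensorProduct.smul_tmul']
    rw [this]
    exact Submodule.smul_mem _ _ (Submodule.subset_span ⟨x, x.2, rfl⟩)

lemma step_inj (𝔪 J : Ideal R) [𝔪.IsMaximal] (hm : Function.Injective (muMap S 𝔪)) (w : R)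
    (hw : w ∉ J) (hmw : ∀ a ∈ 𝔪, a * w ∈ J)
    (h2 : Function.Injective (muMap S (J ⊔ Ideal.span {w}))) :
    Function.Injective (muMap S J) := by
  rw [injective_iff_map_eq_zero]
  intro Z hZ
  have hw2 : w ∈ J ⊔ Ideal.span {w} := Ideal.mem_sup_right (Ideal.mem_span_singleton_self w)
  let inc : J →ₗ[R] (J ⊔ Ideal.span {w} : Ideal R) := Submodule.inclusion le_sup_left
  let β : J × R →ₗ[R] (J ⊔ Ideal.span {w} : Ideal R) :=
    inc.coprod (LinearMap.toSpanSingleton R _ ⟨w, hw2⟩)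
  let α1 : 𝔪 →ₗ[R] J :=
    LinearMap.codRestrict J ((LinearMap.toSpanSingleton R R w) ∘ₗ 𝔪.subtype) (fun c => hmw c c.2)
  let α : 𝔪 →ₗ[R] J × R := α1.prod (- 𝔪.subtype)
  have hα1 : ∀ m : 𝔪, (α1 m : R) = m * w := fun _ => rfl
  have hβ : Function.Surjective β := by
    rintro ⟨x, hx⟩
    obtain ⟨y, hy, v, hv, rfl⟩ := Submodule.mem_sup.1 hx
    obtain ⟨c, rfl⟩ := Ideal.mem_span_singleton'.1 hv
    exact ⟨(⟨y, hy⟩, c), by ext; simp [β, inc]⟩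
  have hex : Function.Exact α β := by
    rintro ⟨⟨j, hj⟩, r⟩
    constructor
    · intro h
      have h' : j + r * w = 0 := by simpa [β, inc] using congrArg Subtype.val h
      have hr : r ∈ 𝔪 := by
        by_contra hr
        obtain ⟨c, m, hm, hc⟩ := Ideal.IsMaximal.exists_inv ‹_› hr
        apply hw
        have : w = c * (r * w) + m * w := by linear_combination (-w) * hc
        rw [this]
        refine J.add_mem (J.mul_mem_left _ ?_) (hmw _ hm)
        rw [eq_neg_of_add_eq_zero_right h']
        exact J.neg_mem hj
      refine ⟨-⟨r, hr⟩, ?_⟩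
      ext
      · simp [α, hα1]; linear_combination -h'
      · simp [α]
    · rintro ⟨m, hm⟩
      rw [← hm]
      ext
      simp [α, β, hα1, inc]
  have hZ2 : inc.lTensor S Z = 0 := by
    apply h2
    rw [map_zero, muMap_eq_zero_iff, ← LinearMap.lTensor_comp_apply]
    exact (muMap_eq_zero_iff _ _).1 hZ
  have hY : β.lTensor S ((LinearMap.inl R J R).lTensor S Z) = 0 := by
    rw [← LinearMap.lTensor_comp_apply, LinearMap.coprod_inl, hZ2]
  obtain ⟨t, ht⟩ := (lTensor_exact S hex hβ _).1 hY
  have ht0 : t = 0 := by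
    apply hm
    rw [map_zero, muMap_eq_zero_iff]
    have := congrArg ((LinearMap.snd R J R).lTensor S) ht
    rw [← LinearMap.lTensor_comp_apply, ← LinearMap.lTensor_comp_apply, LinearMap.snd_comp_inl,
      LinearMap.snd_prod] at this
    simpa using this
  rw [ht0, map_zero] at ht
  have := congrArg ((LinearMap.fst R J R).lTensor S) ht
  rw [← LinearMap.lTensor_comp_apply, LinearMap.fst_comp_inl] at this
  simpa using this.symm

lemma exists_socle (𝔪 J : Ideal R) (t : ℕ) (ht : 𝔪 ^ t ≤ J) (hJ : J ≠ ⊤) :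
    ∃ w, w ∉ J ∧ ∀ a ∈ 𝔪, a * w ∈ J := by
  induction t with
  | zero => exact absurd (by simpa using ht) hJ
  | succ t ih =>
    by_cases h : 𝔪 ^ t ≤ J
    · exact ih h
    · obtain ⟨w, hw, hwJ⟩ := SetLike.not_le_iff_exists.1 h
      exact ⟨w, hwJ, fun a ha => ht (by rw [pow_succ']; exact Ideal.mul_mem_mul ha hw)⟩

lemma primary_inj [IsNoetherianRing R] (𝔪 : Ideal R) [𝔪.IsMaximal]
    (hm : Function.Injective (muMap S 𝔪)) (t : ℕ) (J : Ideal R) (ht : 𝔪 ^ t ≤ J) :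
    Function.Injective (muMap S J) := by
  induction J using WellFoundedGT.induction with
  | ind J ih =>
    by_cases hJ : J = ⊤
    · subst hJ
      have : Function.Bijective (Submodule.subtype (⊤ : Ideal R)) :=
        ⟨Subtype.val_injective, fun x => ⟨⟨x, trivial⟩, rfl⟩⟩
      let e := LinearEquiv.ofBijective _ this
      rw [injective_iff_map_eq_zero]
      intro z hz
      rw [muMap_eq_zero_iff] at hz
      exact (LinearEquiv.map_eq_zero_iff (e.lTensor S)).1 hz
    · obtain ⟨w, hw, hmw⟩ := exists_socle 𝔪 J t ht hJ
      refine step_inj 𝔪 J hm w hw hmw (ih _ ?_ (ht.trans le_sup_left))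
      refine lt_of_le_of_ne le_sup_left fun h => hw ?_
      rw [h]
      exact Ideal.mem_sup_right (Ideal.mem_span_singleton_self w)

lemma general_inj [IsNoetherianRing R] [IsNoetherianRing S] [IsLocalRing S]
    (𝔪 : Ideal R) [𝔪.IsMaximal] (hloc : 𝔪.map (algebraMap R S) ≠ ⊤)
    (hm : Function.Injective (muMap S 𝔪)) (J : Ideal R) :
    Function.Injective (muMap S J) := by
  rw [injective_iff_map_eq_zero]
  intro z hz
  have hfin : Module.Finite S (S ⊗[R] J) := inferInstance
  have hkrull := Ideal.iInf_pow_smul_eq_bot_of_isLocalRing (M := S ⊗[R] J) _ hloc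
  rw [← Submodule.mem_bot S, ← hkrull, Submodule.mem_iInf]
  intro n
  obtain ⟨k, hk⟩ := Ideal.exists_pow_inf_eq_pow_smul 𝔪 J
  have hk1 := hk (n + k) (by lia)
  let J' := J ⊔ 𝔪 ^ (n + k)
  have hJ' := primary_inj 𝔪 hm (n + k) J' le_sup_right
  let inc : J →ₗ[R] J' := Submodule.inclusion le_sup_left
  let K : Submodule R J := Submodule.comap J.subtype (𝔪 ^ (n + k))
  let K' : Submodule R J' := Submodule.comap J'.subtype (𝔪 ^ (n + k))
  have hinc : inc.lTensor S z = 0 := by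
    apply hJ'
    rw [map_zero, muMap_eq_zero_iff, ← LinearMap.lTensor_comp_apply]
    exact (muMap_eq_zero_iff _ _).1 hz
  let g : J →ₗ[R] J' ⧸ K' := K'.mkQ ∘ₗ inc
  have hg : Function.Surjective g := by
    intro y
    obtain ⟨⟨x, hx⟩, rfl⟩ := K'.mkQ_surjective y
    obtain ⟨j, hj, v, hv, rfl⟩ := Submodule.mem_sup.1 hx
    refine ⟨⟨j, hj⟩, ?_⟩
    simp only [g, LinearMap.comp_apply, Submodule.mkQ_apply]
    rw [Submodule.Quotient.eq]
    simpa [K', inc] using (𝔪 ^ (n + k)).neg_mem hv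
  have hex : Function.Exact K.subtype g := by
    rw [LinearMap.exact_iff, Submodule.range_subtype]
    ext x
    simp [g, K, K', inc]
  have hgz : g.lTensor S z = 0 := by
    rw [LinearMap.lTensor_comp_apply, hinc, map_zero]
  obtain ⟨t, rfl⟩ := (lTensor_exact S hex hg _).1 hgz
  clear hgz hinc hz
  induction t with
  | zero => simp
  | add x y hx hy => rw [map_add]; exact Submodule.add_mem _ hx hy
  | tmul s x =>
    rw [LinearMap.lTensor_tmul]
    have hx : (x : J) ∈ (𝔪 ^ n • ⊤ : Submodule R J) := by
      have h1 : ((x : J) : R) ∈ 𝔪 ^ n • J := by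
        have : ((x : J) : R) ∈ 𝔪 ^ (n + k) • (⊤ : Ideal R) ⊓ J :=
          ⟨by simpa using (show ((x : J) : R) ∈ 𝔪 ^ (n + k) from x.2), x.1.2⟩
        rw [hk1, Nat.add_sub_cancel] at this
        exact Submodule.smul_mono le_rfl inf_le_right this
      have h2 : Submodule.map J.subtype (𝔪 ^ n • ⊤ : Submodule R J) = 𝔪 ^ n • J := by
        rw [Submodule.map_smul'', Submodule.map_top, Submodule.range_subtype]
      rw [← h2] at h1
      obtain ⟨y, hy, hyx⟩ := h1
      rwa [← Subtype.ext hyx]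
    change s ⊗ₜ[R] (x : J) ∈ _
    refine Submodule.smul_induction_on hx ?_ ?_
    · intro r hr j _
      have : s ⊗ₜ[R] (r • j) = algebraMap R S r • (s ⊗ₜ[R] j) := by
        rw [algebraMap_smul, TensorProduct.tmul_smul]
      rw [this]
      refine Submodule.smul_mem_smul ?_ trivial
      rw [← Ideal.map_pow]
      exact Ideal.mem_map_of_mem _ hr
    · intro a b ha hb
      rw [TensorProduct.tmul_add]
      exact Submodule.add_mem _ ha hb

theorem flat_of_list [IsNoetherianRing R] [IsNoetherianRing S] [IsLocalRing S]
    (l : List R) (hreg : RingTheory.Sequence.IsWeaklyRegular S l)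
    (hmax : (Ideal.ofList l).IsMaximal)
    (hloc : (Ideal.ofList l).map (algebraMap R S) ≠ ⊤) : Module.Flat R S := by
  rw [Module.Flat.iff_lTensor_injective']
  intro J
  have := general_inj _ hloc (koszul_inj l hreg) J
  rw [injective_iff_map_eq_zero] at this ⊢
  intro z hz
  exact this z ((muMap_eq_zero_iff _ _).2 hz)

end flat
open RingTheory.Sequence
open scoped Pointwise

lemma pow_reg_aux {R : Type*} [CommRing R] [IsLocalRing R] [IsNoetherianRing R] (q : ℕ)
    (hq : q ≠ 0)
    (l : List R) : ∀ (l' : List R) (_ : ∀ a ∈ l ++ l', a ∈ maximalIdeal R)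
    (_ : IsWeaklyRegular R (l ++ l')),
    IsWeaklyRegular R (l.map (· ^ q) ++ l') := by
  induction l with
  | nil => intro l' _ h; simpa using h
  | cons a l ih =>
    intro l' hm h
    have h1 : IsWeaklyRegular R ((l ++ l') ++ [a]) := by
      refine IsLocalRing.isWeaklyRegular_of_perm_of_subset_maximalIdeal h ?_ hm
      exact (List.perm_append_singleton a (l ++ l')).symm
    have h2 : IsWeaklyRegular R ((l ++ l') ++ [a ^ q]) := by
      rw [isWeaklyRegular_append_iff, isWeaklyRegular_singleton_iff] at h1 ⊢
      exact ⟨h1.1, h1.2.pow q⟩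
    have hm2 : ∀ b ∈ (l ++ l') ++ [a ^ q], b ∈ maximalIdeal R := by
      intro b hb
      simp only [List.mem_append, List.mem_singleton] at hb
      rcases hb with hb | rfl
      · exact hm b (by simpa using Or.inr hb)
      · exact Ideal.pow_mem_of_mem _ (hm a (by simp)) _ (Nat.pos_of_ne_zero hq)
    have h3 : IsWeaklyRegular R (l ++ (l' ++ [a ^ q])) := by simpa using h2
    have h4 := ih _ (by simpa using hm2) h3
    refine IsLocalRing.isWeaklyRegular_of_perm_of_subset_maximalIdeal h4 ?_ ?_
    · rw [← List.append_assoc]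
      simpa using List.perm_append_singleton (a ^ q) (l.map (· ^ q) ++ l')
    · intro b hb
      simp only [List.mem_append, List.mem_singleton, List.mem_map] at hb
      rcases hb with ⟨c, hc, rfl⟩ | hb | rfl
      · exact Ideal.pow_mem_of_mem _ (hm c (by simp [hc])) _ (Nat.pos_of_ne_zero hq)
      · exact hm b (by simp [hb])
      · exact hm2 _ (by simp)

lemma pow_reg {R : Type*} [CommRing R] [IsLocalRing R] [IsNoetherianRing R] (q : ℕ)
    (hq : q ≠ 0) (l : List R) (hm : ∀ a ∈ l, a ∈ maximalIdeal R)
    (h : IsWeaklyRegular R l) : IsWeaklyRegular R (l.map (· ^ q)) := by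
  simpa using pow_reg_aux q hq l [] (by simpa using hm) (by simpa using h)

lemma exists_param {R : Type*} [CommRing R] [IsLocalRing R] [IsNoetherianRing R]
    (hd : 1 ≤ ringKrullDim R) :
    ∃ y ∈ maximalIdeal R, y ∉ maximalIdeal R ^ 2 ∧ ∀ P ∈ minimalPrimes R, y ∉ P := by
  classical
  by_contra! hcon
  have hfin := minimalPrimes.finite_of_isNoetherianRing R
  let s : Finset (Ideal R) := insert (maximalIdeal R ^ 2) hfin.toFinset
  have hsub : ((maximalIdeal R : Ideal R) : Set R) ⊆ ⋃ i ∈ (↑s : Set (Ideal R)), (id i : Ideal R) := by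
    intro y hy
    simp only [Set.mem_iUnion]
    by_cases h2 : y ∈ maximalIdeal R ^ 2
    · exact ⟨_, by simp [s], h2⟩
    · obtain ⟨P, hP, hyP⟩ := hcon y hy h2
      exact ⟨P, by simp [s, hP], hyP⟩
  rw [Ideal.subset_union_prime (maximalIdeal R ^ 2) (maximalIdeal R ^ 2)] at hsub
  swap
  · intro P hP hne _
    have : P ∈ minimalPrimes R := by simpa [s, hne] using hP
    exact this.1.1
  have hnot : ¬ (maximalIdeal R).height = 0 := by
    intro h
    rw [← IsLocalRing.maximalIdeal_height_eq_ringKrullDim, h] at hd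
    norm_num at hd
  obtain ⟨P, hP, hle⟩ := hsub
  simp only [s, Finset.mem_insert, Set.Finite.mem_toFinset] at hP
  rcases hP with rfl | hP
  · have : maximalIdeal R = ⊥ := by
      refine Submodule.eq_bot_of_le_smul_of_le_jacobson_bot (maximalIdeal R) _
        (IsNoetherian.noetherian _) ?_ (maximalIdeal_le_jacobson _)
      simpa [pow_two] using hle
    apply hnot
    rw [this, Ideal.height_bot]
  · apply hnot
    have : maximalIdeal R = P := le_antisymm hle (le_maximalIdeal hP.1.1.ne_top)
    rw [Ideal.height_eq_zero_iff, this]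
    exact hP

universe uu vv
theorem regular_aux (n : ℕ) : ∀ (R : Type uu) [CommRing R] [IsLocalRing R] [IsNoetherianRing R]
    (x : Fin n → R), maximalIdeal R = Ideal.span (Set.range x) →
    (n : WithBot ℕ∞) ≤ ringKrullDim R →
    IsDomain R ∧ ∃ l : List R, IsWeaklyRegular R l ∧ Ideal.ofList l = maximalIdeal R := by
  induction n with
  | zero =>
    intro R _ _ _ x hx _
    have h0 : maximalIdeal R = ⊥ := by rw [hx]; simp
    have : IsField R := by rwa [IsLocalRing.isField_iff_maximalIdeal_eq]
    exact ⟨this.isDomain, [], by simp, by simp [h0]⟩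
  | succ n ih =>
    intro R _ _ _ x hx hd
    obtain ⟨y, hym, hy2, hymin⟩ := exists_param (R := R) (le_trans (by norm_cast; lia) hd)
    have hym' := hym
    rw [hx, Ideal.mem_span_range_iff_exists_fun] at hym'
    obtain ⟨a, ha⟩ := hym'
    have hxm : ∀ i, x i ∈ maximalIdeal R := fun i => by
      rw [hx]; exact Ideal.subset_span ⟨i, rfl⟩
    have : ∃ i, a i ∉ maximalIdeal R := by
      by_contra! hcon
      apply hy2
      rw [← ha, pow_two]
      exact Ideal.sum_mem _ fun i _ => Ideal.mul_mem_mul (hcon i) (hxm i)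
    obtain ⟨i, hi⟩ := this
    have hiu : IsUnit (a i) := by simpa using hi
    have hspan_le : Ideal.span {y} ≤ maximalIdeal R := by
      rw [Ideal.span_singleton_le_iff_mem]; exact hym
    have hnt : Nontrivial (R ⧸ Ideal.span {y}) :=
      Ideal.Quotient.nontrivial_iff.2 (ne_top_of_le_ne_top (maximalIdeal.isMaximal R).ne_top hspan_le)
    have hsurj : Function.Surjective (Ideal.Quotient.mk (Ideal.span {y})) :=
      Ideal.Quotient.mk_surjective
    have hloc : IsLocalRing (R ⧸ Ideal.span {y}) := IsLocalRing.of_surjective' _ hsurj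
    have hmap : maximalIdeal (R ⧸ Ideal.span {y}) =
        (maximalIdeal R).map (Ideal.Quotient.mk (Ideal.span {y})) :=
      (IsLocalRing.map_maximalIdeal_of_surjective _ hsurj).symm
    obtain ⟨hdom, l', hl', hl'm⟩ := ih (R ⧸ Ideal.span {y})
      (fun j => Ideal.Quotient.mk _ (x (i.succAbove j))) (by
        rw [hmap, hx, Ideal.map_span]
        apply le_antisymm
        · rw [Ideal.span_le]
          rintro _ ⟨_, ⟨j, rfl⟩, rfl⟩
          by_cases hj : j = i
          · subst hj
            obtain ⟨v, hv⟩ := hiu.exists_left_inv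
            have hy0 : Ideal.Quotient.mk (Ideal.span {y})
                (a j * x j + ∑ k, a (j.succAbove k) * x (j.succAbove k)) = 0 := by
              rw [← Fin.sum_univ_succAbove (fun k => a k * x k) j, ha,
                Ideal.Quotient.eq_zero_iff_mem]; exact Ideal.mem_span_singleton_self y
            have : Ideal.Quotient.mk (Ideal.span {y}) (x j) = 
              ∑ k, (Ideal.Quotient.mk (Ideal.span {y}) (- v * a (j.succAbove k))) *
                Ideal.Quotient.mk (Ideal.span {y}) (x (j.succAbove k)) := by
              have h3 := congrArg (fun t => Ideal.Quotient.mk (Ideal.span {y}) v * t) hy0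
              simp only [← map_mul, mul_add, mul_zero, ← mul_assoc, hv, one_mul, map_add, Finset.mul_sum] at h3
              rw [eq_neg_of_add_eq_zero_left h3, map_sum, ← Finset.sum_neg_distrib]
              refine Finset.sum_congr rfl fun k _ => ?_
              simp [mul_assoc]
            rw [SetLike.mem_coe, this]
            exact Ideal.sum_mem _ fun k _ => Ideal.mul_mem_left _ _ (Ideal.subset_span ⟨k, rfl⟩)
          · obtain ⟨k, rfl⟩ := Fin.exists_succAbove_eq hj
            exact Ideal.subset_span ⟨k, rfl⟩
        · apply Ideal.span_mono
          rintro _ ⟨k, rfl⟩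
          exact ⟨_, ⟨_, rfl⟩, rfl⟩) (by
        have h1 := Ideal.height_le_ringKrullDim_quotient_add_one hym
        rw [IsLocalRing.maximalIdeal_height_eq_ringKrullDim] at h1
        have h2 := hd.trans h1
        push_cast at h2
        obtain ⟨d, hd⟩ := WithBot.ne_bot_iff_exists.1
          (ringKrullDim_ne_bot (R := R ⧸ Ideal.span {y}))
        rw [← hd] at h2 ⊢
        norm_cast at h2 ⊢
        exact (ENat.add_le_add_iff_right (by simp)).1 h2)
    have hprime : (Ideal.span {y}).IsPrime := (Ideal.Quotient.isDomain_iff_prime _).1 hdom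
    obtain ⟨P, hP, hPy⟩ := Ideal.exists_minimalPrimes_le (I := (⊥ : Ideal R)) (J := Ideal.span {y}) bot_le
    have hPp : P.IsPrime := hP.1.1
    have hyP : y ∉ P := hymin P hP
    have hP0 : P = ⊥ := by
      refine Submodule.eq_bot_of_le_smul_of_le_jacobson_bot (Ideal.span {y}) _
        (IsNoetherian.noetherian _) ?_ (hspan_le.trans (maximalIdeal_le_jacobson _))
      intro b hb
      obtain ⟨c, rfl⟩ := Ideal.mem_span_singleton'.1 (hPy hb)
      have hc : c ∈ P := (hPp.mem_or_mem hb).resolve_right hyP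
      rw [mul_comm]
      exact Submodule.smul_mem_smul (Ideal.mem_span_singleton_self y) hc
    have hdomR : IsDomain R := by
      rw [hP0] at hPp
      exact (IsDomain.of_bot_isPrime R)
    refine ⟨hdomR, ?_⟩
    obtain ⟨l, rfl⟩ := (List.map_surjective_iff.2 hsurj) l'
    refine ⟨y :: l, IsWeaklyRegular.cons ?_ ?_, ?_⟩
    · intro b c hbc
      refine mul_left_cancel₀ ?_ hbc
      rintro rfl
      exact hyP P.zero_mem
    · have h1 : IsWeaklyRegular (R ⧸ Ideal.span {y}) l :=
        (isWeaklyRegular_map_algebraMap_iff (R ⧸ Ideal.span {y}) (R ⧸ Ideal.span {y}) l).1 hl'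
      have he : (y • ⊤ : Submodule R R) = Ideal.span {y} := by
        rw [← Submodule.ideal_span_singleton_smul]; simp
      exact (LinearEquiv.isWeaklyRegular_congr (Submodule.quotEquivOfEq _ _ he) l).2 h1
    · rw [hmap, ← Ideal.map_ofList] at hl'm
      have h1 := congrArg (Ideal.comap (Ideal.Quotient.mk (Ideal.span {y}))) hl'm
      rw [Ideal.comap_map_of_surjective _ hsurj, Ideal.comap_map_of_surjective _ hsurj,
        ← RingHom.ker_eq_comap_bot, Ideal.mk_ker, sup_eq_left.2 hspan_le] at h1
      rw [Ideal.ofList_cons, sup_comm, h1]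
section main

theorem flat_ringHom {R S : Type*} [CommRing R] [CommRing S] [IsNoetherianRing R]
    [IsNoetherianRing S] [IsLocalRing S] (f : R →+* S)
    (l : List R) (hreg : IsWeaklyRegular S (l.map f))
    (hmax : (Ideal.ofList l).IsMaximal)
    (hloc : (Ideal.ofList l).map f ≠ ⊤) : f.Flat := by
  letI := f.toAlgebra
  exact flat_of_list l ((isWeaklyRegular_map_algebraMap_iff S S l).1 hreg) hmax hloc

lemma map_ne_top_of_pow {R : Type*} [CommRing R] [IsLocalRing R] (f : R →+* R) (q : ℕ)
    (hq : q ≠ 0) (hf : ∀ x, f x = x ^ q) : (maximalIdeal R).map f ≠ ⊤ := by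
  refine ne_top_of_le_ne_top (maximalIdeal.isMaximal R).ne_top (Ideal.map_le_iff_le_comap.2 ?_)
  intro a ha
  rw [Ideal.mem_comap, hf]
  exact Ideal.pow_mem_of_mem _ ha _ (Nat.pos_of_ne_zero hq)

theorem frob_flat {R : Type*} [CommRing R] [IsLocalRing R] [IsNoetherianRing R]
    (hreg : IsRegularLocal R) (f : R →+* R) (q : ℕ) (hq : q ≠ 0) (hf : ∀ x, f x = x ^ q) :
    f.Flat := by
  obtain ⟨n, x, hx, hd⟩ := hreg
  obtain ⟨-, l, hl, hlm⟩ := regular_aux n R x hx hd.ge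
  have hff : (f : R → R) = (· ^ q) := funext hf
  refine flat_ringHom f l ?_ ?_ ?_
  · rw [hff]
    exact pow_reg q hq l (fun a ha => by rw [← hlm]; exact Ideal.subset_span ha) hl
  · rw [hlm]; exact maximalIdeal.isMaximal R
  · rw [hlm]; exact map_ne_top_of_pow f q hq hf

lemma colon_flat_alg {R S : Type*} [CommRing R] [CommRing S] [Algebra R S] [Module.Flat R S]
    (J J' : Ideal R) (r : R) (hJ' : ∀ a, a * r ∈ J → a ∈ J') (s : S) (n : ℕ)
    (F : Fin (n + 1) → R) (hF0 : F 0 = r) (hF : ∀ i : Fin n, F i.succ ∈ J)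
    (X : Fin (n + 1) → S) (hX0 : X 0 = s) (hrel : ∑ i, F i • X i = 0) :
    s ∈ J'.map (algebraMap R S) := by
  obtain ⟨k, a, y, h1, h2⟩ := Module.Flat.isTrivialRelation_of_sum_smul_eq_zero
    (R := R) (M := S) (f := F) (x := X) hrel
  have hs' : s = ∑ t, a 0 t • y t := hX0.symm.trans (h1 0)
  rw [hs']
  refine Ideal.sum_mem _ fun t _ => ?_
  rw [Algebra.smul_def]
  refine Ideal.mul_mem_right _ _ (Ideal.mem_map_of_mem _ (hJ' _ ?_))
  have h3 := h2 t
  rw [Fin.sum_univ_succ, hF0] at h3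
  rw [mul_comm, eq_neg_of_add_eq_zero_left h3]
  exact J.neg_mem (Ideal.sum_mem _ fun i _ => Ideal.mul_mem_right _ _ (hF i))

lemma colon_flat_alg' {R S : Type*} [CommRing R] [CommRing S] [Algebra R S] [Module.Flat R S]
    (J J' : Ideal R) (r : R) (hJ' : ∀ a, a * r ∈ J → a ∈ J') (s : S)
    (hs : s * algebraMap R S r ∈ J.map (algebraMap R S)) :
    s ∈ J'.map (algebraMap R S) := by
  rw [Ideal.map, Submodule.mem_span_set'] at hs
  obtain ⟨n, c, g, hsum⟩ := hs
  have hg : ∀ i, ∃ j, j ∈ J ∧ algebraMap R S j = g i := fun i => (g i).2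
  choose j hjJ hj using hg
  have hsum' : s * algebraMap R S r = ∑ i, j i • c i := by
    rw [← hsum]
    exact Finset.sum_congr rfl fun i _ => by
      rw [smul_eq_mul, Algebra.smul_def, hj, mul_comm]
  refine colon_flat_alg J J' r hJ' s n (Fin.cons r (fun i => - j i)) (Fin.cons_zero _ _) ?_
    (Fin.cons s c) (Fin.cons_zero _ _) ?_
  · intro i
    rw [Fin.cons_succ]
    exact J.neg_mem (hjJ i)
  · rw [Fin.sum_univ_succ]
    simp only [Fin.cons_zero, Fin.cons_succ, neg_smul, Finset.sum_neg_distrib]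
    rw [← hsum', Algebra.smul_def, mul_comm, add_neg_cancel]

lemma colon_flat {R S : Type*} [CommRing R] [CommRing S] (f : R →+* S) (hf : f.Flat)
    (J J' : Ideal R) (r : R) (hJ' : ∀ a, a * r ∈ J → a ∈ J') (s : S) (hs : s * f r ∈ J.map f) :
    s ∈ J'.map f :=
  @colon_flat_alg' R S _ _ f.toAlgebra hf J J' r hJ' s hs

lemma socle_flat {R : Type*} {S : Type uu} [CommRing R] [CommRing S] (f : R →+* S) (hf : f.Flat)
    {E : Type vv} {E' : Type*} [AddCommGroup E] [Module R E] [AddCommGroup E'] [Module S E']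
    (φ : E → E')
    (hcog : ∀ (M : Type (max uu vv)) [AddCommGroup M] [Module S M] (x : M), x ≠ 0 →
      ∃ g : M →ₗ[S] E', g x ≠ 0)
    (hex : ∀ θ : E → E', (∀ x y, θ (x + y) = θ x + θ y) → (∀ r x, θ (r • x) = f r • θ x) →
      ∃ u : S, ∀ x, θ x = u • φ x)
    (y : E) (J : Ideal R) (hJ : ∀ a : R, a • y = 0 → a ∈ J) (b : S) (hb : b • φ y = 0) :
    b ∈ J.map f := by
  letI := f.toAlgebra
  haveI : Module.Flat R S := hf
  have h0 : b ⊗ₜ[R] y = 0 := by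
    by_contra hne
    obtain ⟨g, hg⟩ := hcog (S ⊗[R] E) _ hne
    obtain ⟨u, hu⟩ := hex (fun x => g (1 ⊗ₜ x)) (fun x y => by rw [tmul_add, map_add])
      (fun r x => by
        rw [tmul_smul, ← algebraMap_smul S r, map_smul, RingHom.algebraMap_toAlgebra])
    apply hg
    have : b ⊗ₜ[R] y = b • ((1 : S) ⊗ₜ[R] y) := by simp [TensorProduct.smul_tmul']
    rw [this, map_smul, hu, smul_comm, hb, smul_zero]
  have h1 : ∑ i : Fin 1, y ⊗ₜ[R] b = (0 : E ⊗[R] S) := by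
    have := congrArg (TensorProduct.comm R S E) h0
    simpa using this
  obtain ⟨k, a, z, h2, h3⟩ := vanishesTrivially_of_sum_tmul_eq_zero_of_rTensor_injective R
    (m := fun _ : Fin 1 => y) (n := fun _ => b)
    (Module.Flat.rTensor_preserves_injective_linearMap _ Subtype.val_injective) h1
  have h20 : b = _ := h2 0
  rw [h20]
  refine Ideal.sum_mem _ fun t _ => ?_
  rw [Algebra.smul_def, RingHom.algebraMap_toAlgebra]
  refine Ideal.mul_mem_right _ _ (Ideal.mem_map_of_mem f (hJ _ ?_))
  simpa using h3 t

lemma exists_cog {R : Type*} [CommRing R] [IsLocalRing R] {E : Type*} [AddCommGroup E]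
    [Module R E] (hB : Module.Baer R E) (ι : ResidueField R →ₗ[R] E) (hι : Function.Injective ι)
    (M : Type*) [AddCommGroup M] [Module R M] (x : M) (hx : x ≠ 0) :
    ∃ g : M →ₗ[R] E, g x ≠ 0 := by
  let K := LinearMap.ker (LinearMap.toSpanSingleton R M x)
  let h1 : (R ⧸ K) →ₗ[R] M := K.liftQ (LinearMap.toSpanSingleton R M x) le_rfl
  have hinj : Function.Injective h1 := by
    rw [← LinearMap.ker_eq_bot]
    exact Submodule.ker_liftQ_eq_bot _ _ _ le_rfl
  let h2 : (R ⧸ K) →ₗ[R] ResidueField R := K.liftQ (Algebra.linearMap R (ResidueField R)) (by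
    intro a ha
    have ha' : a • x = 0 := by simpa [K] using ha
    rw [LinearMap.mem_ker, Algebra.linearMap_apply]
    change residue R a = 0
    rw [residue_eq_zero_iff, mem_maximalIdeal, mem_nonunits_iff]
    intro hu
    exact hx ((hu.smul_eq_zero).1 ha'))
  obtain ⟨g, hg⟩ := hB.extension_property h1 hinj (ι ∘ₗ h2)
  refine ⟨g, ?_⟩
  have h3 := LinearMap.congr_fun hg (K.mkQ 1)
  have h4 : h1 (K.mkQ 1) = x := by
    change (1 : R) • x = x
    exact one_smul R x
  have h5 : h2 (K.mkQ 1) = 1 := by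
    change algebraMap R (ResidueField R) 1 = 1
    exact map_one _
  rw [LinearMap.comp_apply, LinearMap.comp_apply, h4, h5] at h3
  rw [h3]
  intro h
  exact one_ne_zero (hι (h.trans (map_zero ι).symm))

lemma kill_of_mem_map {R S : Type*} [CommRing R] [CommRing S] (f : R →+* S)
    {E E' : Type*} [AddCommGroup E] [Module R E] [AddCommGroup E'] [Module S E']
    (φ : E → E') (h0 : φ 0 = 0) (hφ : ∀ (r : R) x, φ (r • x) = f r • φ x) (J : Ideal R)
    (z : E) (hz : ∀ a ∈ J, a • z = 0) (s : S) (hs : s ∈ J.map f) : s • φ z = 0 := by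
  induction hs using Submodule.span_induction with
  | mem x hx =>
    obtain ⟨a, ha, rfl⟩ := hx
    rw [← hφ, hz a ha, h0]
  | zero => simp
  | add x y _ _ hx hy => rw [add_smul, hx, hy, add_zero]
  | smul c x _ hx => rw [smul_eq_mul, mul_smul, hx, smul_zero]

lemma hard_primary {R S : Type*} [CommRing R] [CommRing S] [IsLocalRing R] [IsNoetherianRing R]
    (f : R →+* S)
    {E E' : Type*} [AddCommGroup E] [Module R E] [AddCommGroup E'] [Module S E']
    (φ : E → E') (h0 : φ 0 = 0) (hφ : ∀ (r : R) x, φ (r • x) = f r • φ x)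
    (hcog : ∀ (J : Ideal R) (w : R), w ∉ J → ∃ z : E, (∀ a ∈ J, a • z = 0) ∧ w • z ≠ 0)
    (hsoc : ∀ (y : E) (J : Ideal R), (∀ a : R, a • y = 0 → a ∈ J) → ∀ b : S, b • φ y = 0 →
      b ∈ J.map f) (t : ℕ) (s : S) (J : Ideal R) (ht : maximalIdeal R ^ t ≤ J)
    (hs : ∀ z : E, (∀ a ∈ J, a • z = 0) → s • φ z = 0) : s ∈ J.map f := by
  induction J using WellFoundedGT.induction with
  | ind J ih =>
    by_cases hJ : J = ⊤
    · subst hJ; rw [Ideal.map_top]; trivial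
    obtain ⟨w, hw, hmw⟩ := exists_socle _ J t ht hJ
    have hlt : J < J ⊔ Ideal.span {w} := by
      refine lt_of_le_of_ne le_sup_left fun h => hw ?_
      rw [h]
      exact Ideal.mem_sup_right (Ideal.mem_span_singleton_self w)
    have h1 := ih _ hlt (ht.trans le_sup_left) (fun z hz => hs z fun a ha =>
      hz a (Ideal.mem_sup_left ha))
    rw [Ideal.map_sup, Ideal.map_span, Set.image_singleton, Submodule.mem_sup] at h1
    obtain ⟨j, hj, v, hv, rfl⟩ := h1
    obtain ⟨b, rfl⟩ := Ideal.mem_span_singleton'.1 hv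
    obtain ⟨z, hz, hwz⟩ := hcog J w hw
    have h2 := hs z hz
    rw [add_smul, kill_of_mem_map f φ h0 hφ J z hz j hj, zero_add, mul_smul, ← hφ] at h2
    have hb : b ∈ (maximalIdeal R).map f := by
      refine hsoc _ _ (fun a ha => ?_) b h2
      rw [mem_maximalIdeal, mem_nonunits_iff]
      intro hu
      exact hwz ((hu.smul_eq_zero).1 ha)
    refine Ideal.add_mem _ hj ?_
    have h3 : b * f w ∈ (maximalIdeal R * Ideal.span {w}).map f := by
      rw [Ideal.map_mul]
      exact Ideal.mul_mem_mul hb (Ideal.mem_map_of_mem f (Ideal.mem_span_singleton_self w))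
    refine Ideal.map_mono ?_ h3
    rw [Ideal.mul_le]
    intro a ha c hc
    obtain ⟨d, rfl⟩ := Ideal.mem_span_singleton'.1 hc
    rw [mul_left_comm]
    exact J.mul_mem_left _ (hmw a ha)

lemma hard {R S : Type*} [CommRing R] [CommRing S] [IsLocalRing R] [IsNoetherianRing R]
    [IsLocalRing S] [IsNoetherianRing S]
    (f : R →+* S) (hf : (maximalIdeal R).map f ≠ ⊤)
    {E E' : Type*} [AddCommGroup E] [Module R E] [AddCommGroup E'] [Module S E']
    (φ : E → E') (h0 : φ 0 = 0) (hφ : ∀ (r : R) x, φ (r • x) = f r • φ x)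
    (hcog : ∀ (J : Ideal R) (w : R), w ∉ J → ∃ z : E, (∀ a ∈ J, a • z = 0) ∧ w • z ≠ 0)
    (hsoc : ∀ (y : E) (J : Ideal R), (∀ a : R, a • y = 0 → a ∈ J) → ∀ b : S, b • φ y = 0 →
      b ∈ J.map f) (s : S) (J : Ideal R)
    (hs : ∀ z : E, (∀ a ∈ J, a • z = 0) → s • φ z = 0) : s ∈ J.map f := by
  have hkrull := Ideal.iInf_pow_smul_eq_bot_of_isLocalRing (M := S ⧸ J.map f) _ hf
  rw [← Ideal.Quotient.eq_zero_iff_mem, ← Submodule.mem_bot S, ← hkrull, Submodule.mem_iInf]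
  intro t
  have h1 := hard_primary f φ h0 hφ hcog hsoc t s (J ⊔ maximalIdeal R ^ t) le_sup_right
    (fun z hz => hs z fun a ha => hz a (Ideal.mem_sup_left ha))
  rw [Ideal.map_sup, Ideal.map_pow, Submodule.mem_sup] at h1
  obtain ⟨j, hj, v, hv, rfl⟩ := h1
  rw [map_add, Ideal.Quotient.eq_zero_iff_mem.2 hj, zero_add]
  have : Ideal.Quotient.mk (J.map f) v = v • (1 : S ⧸ J.map f) := by
    rw [Algebra.smul_def, mul_one]; rfl
  rw [this]
  exact Submodule.smul_mem_smul hv trivial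

lemma nuExp_succ' (p e : ℕ) : nuExp p (e + 1) = 1 + p * nuExp p e := by
  simp only [nuExp, Finset.sum_range_succ', Finset.mul_sum, pow_succ']
  ring

lemma iter_add {R : Type*} [CommRing R] {p : ℕ} {E : Type*} [AddCommGroup E] [Module R E]
    (φ : FrobeniusMap R E p) (e : ℕ) (x y : E) :
    (φ.toFun)^[e] (x + y) = (φ.toFun)^[e] x + (φ.toFun)^[e] y := by
  induction e with
  | zero => rfl
  | succ e ih => simp only [Function.iterate_succ_apply', ih, φ.map_add']

lemma iter_smul {R : Type*} [CommRing R] {p : ℕ} {E : Type*} [AddCommGroup E] [Module R E]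
    (φ : FrobeniusMap R E p) (e : ℕ) (r : R) (x : E) :
    (φ.toFun)^[e] (r • x) = r ^ p ^ e • (φ.toFun)^[e] x := by
  induction e with
  | zero => simp
  | succ e ih => simp only [Function.iterate_succ_apply', ih, φ.map_smul', pow_succ, pow_mul]

lemma iter_T {R : Type*} [CommRing R] {p : ℕ} {E : Type*} [AddCommGroup E] [Module R E]
    (φ : FrobeniusMap R E p) (u : R) (e : ℕ) (x : E) :
    (fun y => u • φ.toFun y)^[e] x = u ^ nuExp p e • (φ.toFun)^[e] x := by
  induction e with
  | zero => simp [nuExp]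
  | succ e ih =>
    rw [Function.iterate_succ_apply', ih, Function.iterate_succ_apply', φ.map_smul', nuExp_succ',
      smul_smul, pow_add, pow_one, ← pow_mul, mul_comm p]

lemma iter_zero {R : Type*} [CommRing R] {p : ℕ} {E : Type*} [AddCommGroup E] [Module R E]
    (φ : FrobeniusMap R E p) (e : ℕ) : (φ.toFun)^[e] 0 = 0 := by
  have := iter_add φ e 0 0
  rw [add_zero] at this
  exact left_eq_add.1 this

lemma frobPow_eq {R : Type*} [CommRing R] (p : ℕ) [Fact p.Prime] [CharP R p] (e : ℕ)
    (I : Ideal R) : Ideal.frobPow (p ^ e) I = I.map (iterateFrobenius R p e) := rfl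

theorem hard_frob {R : Type uu} [CommRing R] [IsLocalRing R] [IsNoetherianRing R]
    (p : ℕ) [Fact p.Prime] [CharP R p] (hreg : IsRegularLocal R)
    (E : Type vv) [AddCommGroup E] [Module R E]
    (hE : IsInjectiveHullOfResidueField R E)
    (φ : FrobeniusMap R E p) (hφ : IsNaturalFrobenius p E φ) (e : ℕ) (he : 1 ≤ e)
    (J : Ideal R) (s : R) (hs : ∀ z ∈ annIn J E, s • (φ.toFun)^[e] z = 0) :
    s ∈ Ideal.frobPow (p ^ e) J := by
  have hp : p ^ e ≠ 0 := pow_ne_zero _ (Fact.out : p.Prime).ne_zero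
  have hsmall : Small.{vv} R := by
    refine small_of_injective (f := fun (r : R) (x : E) => r • φ.toFun x) ?_
    intro r r' hrr
    obtain ⟨v, -, hv⟩ := hφ 1 le_rfl ⟨fun x => r • φ.toFun x,
      fun x y => by rw [φ.map_add', smul_add],
      fun a x => by rw [φ.map_smul', smul_comm, pow_one]⟩
    rw [hv r (fun x => rfl), hv r' (fun x => congrFun hrr x)]
  obtain ⟨hinj, ι, hι, -⟩ := hE
  have hB := Module.Baer.of_injective hinj
  rw [frobPow_eq]
  have hff : ∀ x, iterateFrobenius R p e x = x ^ p ^ e := fun x => rfl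
  refine hard (iterateFrobenius R p e) (map_ne_top_of_pow _ _ hp hff) (φ.toFun)^[e]
    (iter_zero φ e) (fun r x => iter_smul φ e r x) ?_ ?_ s J hs
  · intro J w hw
    obtain ⟨g, hg⟩ := exists_cog hB ι hι (R ⧸ J) (Ideal.Quotient.mk J w)
      (by rwa [Ne, Ideal.Quotient.eq_zero_iff_mem])
    have hg1 : ∀ a : R, a • g 1 = g (Ideal.Quotient.mk J a) := fun a => by
      rw [← map_smul, Algebra.smul_def, mul_one]; rfl
    refine ⟨g 1, fun a ha => ?_, ?_⟩
    · rw [hg1, Ideal.Quotient.eq_zero_iff_mem.2 ha, map_zero]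
    · rwa [hg1]
  · intro y J hJ b hb
    refine socle_flat (iterateFrobenius R p e) (frob_flat hreg _ _ hp hff) (φ.toFun)^[e]
      (fun M _ _ x hx => exists_cog hB ι hι M x hx) ?_ y J hJ b hb
    intro θ h1 h2
    obtain ⟨v, hv, -⟩ := hφ e he ⟨θ, h1, h2⟩
    exact ⟨v, hv⟩

end main

end helpers

/-- Suppose `T` acts on `E_S = Ann_E I` as the restriction of `u • φ`
(i.e. `Δ(E_S)` is multiplication by `u`).  Let `L_α = (I^{[p^α]} :_R u^{ν_α})` and let `L`
be the stable value of the ascending chain `{L_α}` (here: `L = L_A = L_{A+1}` for some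
`A ≥ 1`).  Then `E_S / Ann_{E_S}(L)` is nilpotent, i.e. some power `T^m` maps `E_S` into
`Ann_{E_S}(L)`, and for every `E_S`-ideal `K ⊆ R` the quotient `E_S / Ann_{E_S}(K)` is
nilpotent if and only if `K ⊆ L`. -/
theorem stmt7 {R : Type*} [CommRing R] [IsLocalRing R] [IsNoetherianRing R]
    (p : ℕ) [Fact p.Prime] [CharP R p]
    (hreg : IsRegularLocal R) (hcomp : IsAdicComplete (maximalIdeal R) R)
    (E : Type*) [AddCommGroup E] [Module R E]
    (hE : IsInjectiveHullOfResidueField R E)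
    (φ : FrobeniusMap R E p) (hφ : IsNaturalFrobenius p E φ)
    (I : Ideal R) (u : R) (hu : u ∈ Submodule.colon (Ideal.frobPow p I) I)
    (Lseq : ℕ → Ideal R)
    (hLseq : ∀ α,
      Lseq α = Submodule.colon (Ideal.frobPow (p ^ α) I) (Ideal.span {u ^ nuExp p α}))
    (A : ℕ) (hA : 1 ≤ A) (hstab : Lseq A = Lseq (A + 1)) (L : Ideal R) (hL : L = Lseq A) :
    (∃ m, 1 ≤ m ∧ ∀ x ∈ annIn I E, ∀ a ∈ L, a • (fun y => u • φ.toFun y)^[m] x = 0) ∧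
    (∀ K : Ideal R, I ≤ K → (∀ x ∈ annIn K E, u • φ.toFun x ∈ annIn K E) →
      ((∃ m, 1 ≤ m ∧ ∀ x ∈ annIn I E, ∀ a ∈ K, a • (fun y => u • φ.toFun y)^[m] x = 0) ↔
        K ≤ L)) := by
  have hmemL : ∀ α a, a ∈ Lseq α ↔ a * u ^ nuExp p α ∈ Ideal.frobPow (p ^ α) I := by
    intro α a
    rw [hLseq, Submodule.mem_colon]
    constructor
    · intro h
      exact h _ (Ideal.mem_span_singleton_self _)
    · intro h s hs
      obtain ⟨c, rfl⟩ := Ideal.mem_span_singleton'.1 hs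
      rw [smul_eq_mul, mul_left_comm]
      exact Ideal.mul_mem_left _ _ h
  have hfl : (frobenius R p).Flat :=
    frob_flat hreg _ p (Fact.out : p.Prime).ne_zero (fun x => rfl)
  have hmap : ∀ α, Ideal.frobPow (p ^ (α + 1)) I =
      (Ideal.frobPow (p ^ α) I).map (frobenius R p) := by
    intro α
    rw [frobPow_eq, frobPow_eq, Ideal.map_map]
    congr 1
    ext x
    simp [iterateFrobenius_def, frobenius_def, pow_succ, pow_mul]
  have hrec : ∀ α a, a ∈ Lseq (α + 1) ↔ a * u ∈ (Lseq α).map (frobenius R p) := by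
    intro α a
    have hexp : a * u ^ nuExp p (α + 1) = (a * u) * frobenius R p (u ^ nuExp p α) := by
      rw [nuExp_succ', frobenius_def, pow_add, pow_one, ← pow_mul, mul_comm p, mul_assoc]
    rw [hmemL, hexp, hmap]
    constructor
    · intro h
      exact colon_flat _ hfl _ _ _ (fun b hb => (hmemL α b).2 hb) _ h
    · intro h
      have h2 : a * u * frobenius R p (u ^ nuExp p α) ∈
          (Lseq α * Ideal.span {u ^ nuExp p α}).map (frobenius R p) := by
        rw [Ideal.map_mul]
        exact Ideal.mul_mem_mul h (Ideal.mem_map_of_mem _ (Ideal.mem_span_singleton_self _))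
      refine Ideal.map_mono ?_ h2
      rw [Ideal.mul_le]
      intro b hb c hc
      obtain ⟨d, rfl⟩ := Ideal.mem_span_singleton'.1 hc
      rw [mul_left_comm]
      exact Ideal.mul_mem_left _ _ ((hmemL α b).1 hb)
  have hmono1 : ∀ α, Lseq α ≤ Lseq (α + 1) := by
    intro α
    induction α with
    | zero =>
      intro a ha
      rw [hmemL] at ha ⊢
      have ha' : a ∈ I := by
        rw [frobPow_eq, iterateFrobenius_zero, Ideal.map_id] at ha
        simpa [nuExp] using ha
      have := Submodule.mem_colon.1 hu a ha'
      simpa [nuExp, mul_comm] using this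
    | succ α ih =>
      intro a ha
      rw [hrec] at ha ⊢
      exact Ideal.map_mono ih ha
  have hmono : Monotone Lseq := monotone_nat_of_le_succ hmono1
  have hstable : ∀ k, Lseq (A + k) = Lseq A := by
    intro k
    induction k with
    | zero => rfl
    | succ k ih =>
      rw [hstab]
      ext a
      rw [← Nat.add_assoc, hrec, hrec, ih]
  have hle : ∀ m, Lseq m ≤ L := by
    intro m
    rw [hL, ← hstable m]
    exact hmono (Nat.le_add_left _ _)
  have hfirst : ∀ x ∈ annIn I E, ∀ a ∈ L, a • (fun y => u • φ.toFun y)^[A] x = 0 := by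
    intro x hx a ha
    rw [hL, hmemL, frobPow_eq] at ha
    rw [iter_T, smul_smul]
    exact kill_of_mem_map (iterateFrobenius R p A) (φ.toFun)^[A] (iter_zero φ A)
      (fun r x => iter_smul φ A r x) I x hx _ ha
  refine ⟨⟨A, hA, hfirst⟩, fun K _ _ => ⟨?_, fun hKL =>
    ⟨A, hA, fun x hx a ha => hfirst x hx a (hKL ha)⟩⟩⟩
  rintro ⟨m, hm, h⟩ a ha
  refine hle m ((hmemL m a).2 (hard_frob p hreg E hE φ hφ m hm I _ fun z hz => ?_))
  have := h z hz a ha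
  rwa [iter_T, smul_smul] at this
end
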